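/- (Adiprasito–Huh–Katz, Hard Lefschetz theorem) Let M be a loopless matroid of rank d+1 on a finite ground set E, let ℓ ∈ A¹(M)_ℝ be an ample class, and let 0 ≤ k ≤ d/2. Then multiplication by ℓ^{d−2k} determines an isomorphism of real vector spaces L_ℓ^k : A^k(M)_ℝ → A^{d−k}(M)_ℝ. -/

import Mathlib

structure FinMatroid (E : Type*) [Fintype E] [DecidableEq E] where
  Indep : Finset E → Prop
  indep_empty : Indep ∅
  indep_subset : ∀ ⦃I J : Finset E⦄, Indep J → I ⊆ J → Indep I
  indep_exchange : ∀ ⦃I J : Finset E⦄, Indep I → Indep J → I.card < J.card →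
    ∃ e ∈ J, e ∉ I ∧ Indep (insert e I)

namespace FinMatroid

variable {E : Type*} [Fintype E] [DecidableEq E]

open Classical in
noncomputable def rank (M : FinMatroid E) (A : Finset E) : ℕ :=
  (A.powerset.filter fun I => M.Indep I).sup Finset.card

noncomputable def rk (M : FinMatroid E) : ℕ := M.rank Finset.univ

noncomputable def closure (M : FinMatroid E) (A : Finset E) : Finset E :=
  Finset.univ.filter fun x => M.rank (insert x A) = M.rank A

def IsFlat (M : FinMatroid E) (F : Finset E) : Prop := M.closure F = F

def Loopless (M : FinMatroid E) : Prop := M.closure ∅ = ∅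

/-- The type of nonempty proper flats of `M`. -/
def ProperFlat (M : FinMatroid E) : Type _ :=
  {F : Finset E // M.IsFlat F ∧ F ≠ ∅ ∧ F ≠ Finset.univ}

instance (M : FinMatroid E) : Finite (ProperFlat M) := Subtype.finite

noncomputable instance (M : FinMatroid E) : Fintype (ProperFlat M) := Fintype.ofFinite _

variable (R : Type*) [CommRing R]

/-- The ideal of relations defining the Chow ring of a matroid: the linear relations (CH1)
`Σ_{F ∋ a} x_F = Σ_{F ∋ b} x_F` for `a, b ∈ E`, and the quadratic relations (CH2)
`x_F · x_{F'} = 0` for incomparable proper flats `F, F'`. -/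
noncomputable def chowIdeal (M : FinMatroid E) : Ideal (MvPolynomial (ProperFlat M) R) :=
  Ideal.span
    ((Set.range fun ab : E × E =>
        (∑ F : ProperFlat M, if ab.1 ∈ F.1 then MvPolynomial.X F else 0) -
        (∑ F : ProperFlat M, if ab.2 ∈ F.1 then MvPolynomial.X F else 0)) ∪
     {p | ∃ F F' : ProperFlat M, ¬F.1 ⊆ F'.1 ∧ ¬F'.1 ⊆ F.1 ∧
        p = MvPolynomial.X F * MvPolynomial.X F'})

/-- The Chow ring `A*(M)` (with coefficients in `R`). -/
abbrev ChowRing (M : FinMatroid E) := MvPolynomial (ProperFlat M) R ⧸ chowIdeal R M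

/-- The quotient map from the polynomial ring onto the Chow ring. -/
noncomputable def chowMk (M : FinMatroid E) :
    MvPolynomial (ProperFlat M) R →ₐ[R] ChowRing R M :=
  Ideal.Quotient.mkₐ R (chowIdeal R M)

/-- The degree-`k` graded piece `A^k(M)` of the Chow ring: the image of the homogeneous
degree-`k` polynomials. -/
noncomputable def piece (M : FinMatroid E) (k : ℕ) : Submodule R (ChowRing R M) :=
  (MvPolynomial.homogeneousSubmodule (ProperFlat M) R k).map (chowMk R M).toLinearMap

lemma mk_mem_piece {M : FinMatroid E} {p : MvPolynomial (ProperFlat M) R} {k : ℕ}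
    (hp : p.IsHomogeneous k) : chowMk R M p ∈ piece R M k :=
  ⟨p, (MvPolynomial.mem_homogeneousSubmodule _ _).2 hp, rfl⟩

lemma mul_mem_piece {M : FinMatroid E} {k l : ℕ} {a b : ChowRing R M}
    (ha : a ∈ piece R M k) (hb : b ∈ piece R M l) : a * b ∈ piece R M (k + l) := by
  obtain ⟨p, hp, rfl⟩ := ha
  obtain ⟨q, hq, rfl⟩ := hb
  refine ⟨p * q, ?_, by simp⟩
  simp only [SetLike.mem_coe, MvPolynomial.mem_homogeneousSubmodule] at hp hq ⊢
  exact hp.mul hq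

lemma pow_mem_piece {M : FinMatroid E} {a : ChowRing R M} (ha : a ∈ piece R M 1) (m : ℕ) :
    a ^ m ∈ piece R M m := by
  induction m with
  | zero =>
      refine ⟨1, ?_, by simp⟩
      simp only [SetLike.mem_coe, MvPolynomial.mem_homogeneousSubmodule]
      simpa using MvPolynomial.isHomogeneous_one (ProperFlat M) R
  | succ n ih =>
      have h := mul_mem_piece R ih ha
      simpa [pow_succ] using h

/-- The image in the Chow ring of the monomial attached to a flag of `d` proper flats lies in
the degree-`d` graded piece. -/
lemma flagMonomial_mem (M : FinMatroid E) (d : ℕ) (flag : Fin d → ProperFlat M) :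
    chowMk R M (∏ i, MvPolynomial.X (flag i)) ∈ piece R M d := by
  refine mk_mem_piece R ?_
  have h := MvPolynomial.IsHomogeneous.prod (R := R) Finset.univ
    (fun i => MvPolynomial.X (flag i)) (fun _ => 1)
    (fun i _ => MvPolynomial.isHomogeneous_X R (flag i))
  simpa using h

/-- Homogeneity (of degree one) of an `R`-linear combination of the variables. -/
lemma isHomogeneous_comb (M : FinMatroid E) (P : ProperFlat M → Prop) [DecidablePred P]
    (c : ProperFlat M → R) :
    MvPolynomial.IsHomogeneous
      (∑ F : ProperFlat M, if P F then MvPolynomial.C (c F) * MvPolynomial.X F else 0) 1 := by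
  refine MvPolynomial.IsHomogeneous.sum _ _ _ (fun F _ => ?_)
  by_cases h : P F
  · simp only [h, if_true]
    simpa using (MvPolynomial.isHomogeneous_C (ProperFlat M) (c F)).mul
      (MvPolynomial.isHomogeneous_X R F)
  · simp [h, MvPolynomial.isHomogeneous_zero]

end FinMatroid

namespace FinMatroid

variable {E : Type*} [Fintype E] [DecidableEq E]

/-- A strictly submodular function `c : 2^E → ℝ_{≥0}`: it is nonnegative, vanishes on `∅`
and `E`, and satisfies `c(A ∪ B) + c(A ∩ B) < c(A) + c(B)` for incomparable `A, B ⊆ E`. -/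
def StrictlySubmodular (c : Finset E → ℝ) : Prop :=
  (∀ A : Finset E, 0 ≤ c A) ∧ c ∅ = 0 ∧ c Finset.univ = 0 ∧
  ∀ A B : Finset E, ¬A ⊆ B → ¬B ⊆ A → c (A ∪ B) + c (A ∩ B) < c A + c B

/-- An element of `A¹(M)_ℝ` is ample if it is of the form `ℓ(c) = Σ_F c(F)·x_F` for some
strictly submodular function `c`. -/
def Ample (M : FinMatroid E) (l : ChowRing ℝ M) : Prop :=
  ∃ c : Finset E → ℝ, StrictlySubmodular c ∧
    l = chowMk ℝ M (∑ F : ProperFlat M, MvPolynomial.C (c F.1) * MvPolynomial.X F)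

lemma Ample.mem_piece_one {M : FinMatroid E} {l : ChowRing ℝ M} (h : M.Ample l) :
    l ∈ piece ℝ M 1 := by
  obtain ⟨c, -, rfl⟩ := h
  exact mk_mem_piece ℝ (by
    simpa using isHomogeneous_comb ℝ M (fun _ => True) (fun F => c F.1))

end FinMatroid

namespace AHK

/-- Rank functions of loopless matroids. -/
structure RkFn (α : Type*) [DecidableEq α] where
  r : Finset α → ℕ
  r_empty : r ∅ = 0
  r_insert : ∀ a S, r (insert a S) ≤ r S + 1
  mono : ∀ ⦃A B⦄, A ⊆ B → r A ≤ r B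
  submod : ∀ A B, r (A ∪ B) + r (A ∩ B) ≤ r A + r B
  loopless : ∀ a, r {a} = 1

variable {α : Type*} [DecidableEq α]

namespace RkFn

/-- `F` is a flat of the restriction to `X`. -/
def Flat (R : RkFn α) (X F : Finset α) : Prop :=
  F ⊆ X ∧ ∀ a ∈ X, a ∉ F → R.r F < R.r (insert a F)

noncomputable instance (R : RkFn α) (X : Finset α) : DecidablePred (R.Flat X) :=
  Classical.decPred _

variable {R : RkFn α} {X Y F G K S T : Finset α}

theorem Flat.lt (h : R.Flat X F) (hS : S ⊆ X) (hn : ¬ S ⊆ F) : R.r F < R.r (S ∪ F) := by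
  obtain ⟨a, ha, hb⟩ := Finset.not_subset.1 hn
  refine (h.2 a (hS ha) hb).trans_le (R.mono ?_)
  intro x hx
  rcases Finset.mem_insert.1 hx with rfl | hx
  · exact Finset.mem_union_left _ ha
  · exact Finset.mem_union_right _ hx

theorem Flat.lt_of_ssubset (h : R.Flat X F) (hS : S ⊆ X) (hn : F ⊂ S) : R.r F < R.r S := by
  have := h.lt hS hn.2
  rwa [Finset.union_eq_left.2 hn.1] at this

theorem flat_self : R.Flat X X := ⟨le_rfl, fun a h h' => (h' h).elim⟩

theorem flat_empty : R.Flat X ∅ :=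
  ⟨Finset.empty_subset _, fun a _ _ => by
    have := R.loopless a
    rw [R.r_empty, show insert a (∅ : Finset α) = {a} from rfl, this]; exact one_pos⟩

theorem Flat.inter (h : R.Flat X F) (hY : Y ⊆ X) : R.Flat Y (F ∩ Y) := by
  refine ⟨Finset.inter_subset_right, fun a ha hna => ?_⟩
  have haF : a ∉ F := fun h => hna (Finset.mem_inter.2 ⟨h, ha⟩)
  have h1 := R.submod F (insert a (F ∩ Y))
  have e1 : F ∪ insert a (F ∩ Y) = insert a F := by
    ext x; simp only [Finset.mem_union, Finset.mem_insert, Finset.mem_inter]; tauto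
  have e2 : F ∩ insert a (F ∩ Y) = F ∩ Y := by
    ext x; simp only [Finset.mem_insert, Finset.mem_inter]
    constructor
    · rintro ⟨hx, rfl | hx'⟩
      · exact (haF hx).elim
      · exact hx'
    · tauto
  rw [e1, e2] at h1
  have := h.2 a (hY ha) haF
  omega

theorem Flat.restrict (h : R.Flat X F) (hY : Y ⊆ X) (hF : F ⊆ Y) : R.Flat Y F := by
  have := h.inter hY
  rwa [Finset.inter_eq_left.2 hF] at this

theorem Flat.trans (h : R.Flat X F) (hG : R.Flat F G) : R.Flat X G := by
  refine ⟨hG.1.trans h.1, fun a ha hna => ?_⟩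
  by_cases haF : a ∈ F
  · exact hG.2 a haF hna
  have h1 := R.submod F (insert a G)
  have e1 : F ∪ insert a G = insert a F := by
    ext x; simp only [Finset.mem_union, Finset.mem_insert]
    have := @hG.1 x
    tauto
  have e2 : F ∩ insert a G = G := by
    ext x; simp only [Finset.mem_insert, Finset.mem_inter]
    constructor
    · rintro ⟨hx, rfl | hx'⟩
      · exact (haF hx).elim
      · exact hx'
    · intro hx; exact ⟨hG.1 hx, Or.inr hx⟩
  rw [e1, e2] at h1
  have := h.2 a ha haF
  omega

theorem Flat.inter_flat (h : R.Flat X F) (hG : R.Flat X G) : R.Flat X (F ∩ G) :=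
  hG.trans (h.inter hG.1)

theorem r_pos_of_nonempty (h : S.Nonempty) : 0 < R.r S := by
  obtain ⟨a, ha⟩ := h
  have h1 := R.loopless a
  have := R.mono (Finset.singleton_subset_iff.2 ha)
  omega

theorem r_union_eq (h : ∀ a ∈ T, R.r (insert a S) = R.r S) : R.r (S ∪ T) = R.r S := by
  induction T using Finset.induction_on with
  | empty => simp
  | insert a T haT ih =>
    have h1 := ih fun b hb => h b (Finset.mem_insert_of_mem hb)
    have h2 := h a (Finset.mem_insert_self _ _)
    have h3 := R.submod (S ∪ T) (insert a S)
    have e1 : S ∪ T ∪ insert a S = S ∪ insert a T := by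
      ext x; simp only [Finset.mem_union, Finset.mem_insert]; tauto
    have h4 : R.r S ≤ R.r ((S ∪ T) ∩ insert a S) :=
      R.mono (Finset.subset_inter Finset.subset_union_left (Finset.subset_insert _ _))
    have h5 : R.r S ≤ R.r (S ∪ insert a T) := R.mono Finset.subset_union_left
    rw [e1] at h3
    omega

/-- closure of `S` in the restriction to `X` -/
def cl (R : RkFn α) (X S : Finset α) : Finset α := X.filter fun a => R.r (insert a S) = R.r S

theorem subset_cl (hS : S ⊆ X) : S ⊆ R.cl X S := fun a ha =>
  Finset.mem_filter.2 ⟨hS ha, by rw [Finset.insert_eq_of_mem ha]⟩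

theorem cl_subset : R.cl X S ⊆ X := Finset.filter_subset _ _

theorem r_cl (hS : S ⊆ X) : R.r (R.cl X S) = R.r S := by
  have := r_union_eq (R := R) (S := S) (T := R.cl X S) fun a ha => (Finset.mem_filter.1 ha).2
  rwa [Finset.union_eq_right.2 (subset_cl hS)] at this

theorem flat_cl (hS : S ⊆ X) : R.Flat X (R.cl X S) := by
  refine ⟨cl_subset, fun a ha hna => ?_⟩
  have h1 : R.r (insert a S) ≠ R.r S := fun h => hna (Finset.mem_filter.2 ⟨ha, h⟩)
  have h2 := R.mono (Finset.subset_insert a S)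
  have h3 := R.mono (Finset.insert_subset_insert a (subset_cl (R := R) hS))
  rw [r_cl hS]; omega

theorem cl_min (hF : R.Flat X F) (hS : S ⊆ F) : R.cl X S ⊆ F := by
  have hSX := hS.trans hF.1
  by_contra hn
  have h1 := hF.lt cl_subset hn
  have h2 := R.submod (R.cl X S) F
  have h3 := r_cl (R := R) hSX
  have h4 : R.r S ≤ R.r (R.cl X S ∩ F) := R.mono (Finset.subset_inter (subset_cl hSX) hS)
  omega

theorem r_cl_union (hS : S ⊆ X) : R.r (R.cl X S ∪ T) = R.r (S ∪ T) := by
  have h2 := R.submod (R.cl X S) (S ∪ T)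
  have h3 := r_cl (R := R) hS
  have h4 : R.r S ≤ R.r (R.cl X S ∩ (S ∪ T)) :=
    R.mono (Finset.subset_inter (subset_cl hS) Finset.subset_union_left)
  have e : R.cl X S ∪ (S ∪ T) = R.cl X S ∪ T := by
    rw [← Finset.union_assoc, Finset.union_eq_left.2 (subset_cl hS)]
  have h5 : R.r (S ∪ T) ≤ R.r (R.cl X S ∪ T) :=
    R.mono (Finset.union_subset_union_left (subset_cl hS))
  rw [e] at h2
  omega

theorem r_insert' (a : α) (S : Finset α) : R.r S ≤ R.r (insert a S) :=
  R.mono (Finset.subset_insert _ _)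

end RkFn
end AHK

namespace AHK
open Finset

/-- Abstract Chow ring relations for the restriction of `R` to `X`. -/
structure ChowRel {α : Type*} [Fintype α] [DecidableEq α] (R : RkFn α) (X : Finset α)
    {B : Type*} [CommRing B] (x : Finset α → B) : Prop where
  zero : ∀ F, ¬ (R.Flat X F ∧ F.Nonempty) → x F = 0
  mul : ∀ F G, ¬ F ⊆ G → ¬ G ⊆ F → x F * x G = 0
  lin : ∀ a ∈ X, ∑ F with a ∈ F, x F = 0

section
variable {α : Type*} [Fintype α] [DecidableEq α] {B : Type*} [CommRing B] [Algebra ℝ B]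

/-- sum of the generators above `S` -/
def gS (x : Finset α → B) (S : Finset α) : B := ∑ F with S ⊆ F, x F

/-- generator with the convention that the empty flat gives `1` -/
def xb (x : Finset α → B) (F : Finset α) : B := if F = ∅ then 1 else x F

/-- linear span of generators strictly above `F` -/
def US (x : Finset α → B) (F : Finset α) : Submodule ℝ B :=
  Submodule.span ℝ (Set.image x {K | F ⊂ K})

variable {R : RkFn α} {X : Finset α} {x : Finset α → B}

theorem US_mem {F K : Finset α} (h : F ⊂ K) : x K ∈ US x F :=
  Submodule.subset_span ⟨K, h, rfl⟩

theorem US_mono {F K : Finset α} (h : F ⊆ K) : US x K ≤ US x F :=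
  Submodule.span_mono (Set.image_mono fun _ hL => lt_of_le_of_lt (Finset.le_iff_subset.2 h) hL)

theorem US_pow_mul {F : Finset α} {m n : ℕ} {u v : B} (hu : u ∈ US x F ^ m)
    (hv : v ∈ US x F ^ n) : u * v ∈ US x F ^ (m + n) := by
  rw [pow_add]; exact Submodule.mul_mem_mul hu hv

theorem US_pow_mono {F K : Finset α} (h : F ⊆ K) (n : ℕ) : US x K ^ n ≤ US x F ^ n :=
  pow_le_pow_left' (US_mono h) n

theorem pow_x_mem {F K : Finset α} (h : F ⊂ K) (n : ℕ) : x K ^ n ∈ US x F ^ n :=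
  Submodule.pow_mem_pow _ (US_mem h) n

theorem xb_of_nonempty {F : Finset α} (h : F.Nonempty) : xb x F = x F := by
  rw [xb, if_neg h.ne_empty]

theorem xb_of_ssubset {F K : Finset α} (h : F ⊂ K) : xb x K = x K :=
  xb_of_nonempty (Finset.nonempty_iff_ne_empty.2 (by rintro rfl; exact Finset.not_ssubset_empty _ h))

theorem sort_ind (hx : ChowRel R X x) (n : ℕ) : ∀ {K : Finset α} (W : Submodule ℝ B),
    (∀ K', K ⊂ K' → ∀ a b, 1 ≤ a → a + b = n + 1 → ∀ w ∈ US x K' ^ b, x K' ^ a * w ∈ W) →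
    ∀ u ∈ US x K ^ (n + 1), u ∈ W := by
  induction n with
  | zero =>
    intro K W h u hu
    rw [zero_add, pow_one] at hu
    refine Submodule.span_le.2 ?_ hu
    rintro _ ⟨K', hK', rfl⟩
    have := h K' hK' 1 0 le_rfl rfl 1 (by rw [pow_zero]; exact Submodule.one_le.1 le_rfl)
    simpa using this
  | succ n ih =>
    intro K W h u hu
    rw [pow_succ'] at hu
    refine Submodule.mul_induction_on hu ?_ (fun a b => W.add_mem)
    intro m hm v hv
    revert m
    suffices ∀ G, K ⊂ G → x G * v ∈ W by
      intro m hm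
      have : US x K ≤ W.comap (LinearMap.mulRight ℝ v) := by
        refine Submodule.span_le.2 ?_
        rintro _ ⟨G, hG, rfl⟩
        exact this G hG
      exact this hm
    intro G hG
    refine ih (W.comap (LinearMap.mulLeft ℝ (x G))) ?_ v hv
    intro K' hK' a b ha hab w hw
    change x G * (x K' ^ a * w) ∈ W
    obtain ⟨a, rfl⟩ : ∃ a', a = a' + 1 := ⟨a - 1, by omega⟩
    by_cases h1 : G ⊆ K'
    · rcases h1.eq_or_ssubset with rfl | h1
      · have := h G hG (a + 2) b (by omega) (by omega) w hw
        convert this using 1; ring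
      · have := h G hG 1 (n + 1) le_rfl (by omega) (x K' ^ (a + 1) * w) (by
          rw [← hab]
          exact US_pow_mul (pow_x_mem h1 _) (US_pow_mono h1.1 _ hw))
        simpa using this
    · by_cases h2 : K' ⊆ G
      · have h3 : K' ⊂ G := ⟨h2, h1⟩
        have := h K' hK' (a + 1) (b + 1) (by omega) (by omega) (x G * w) (by
          rw [pow_succ']; exact Submodule.mul_mem_mul (US_mem h3) hw)
        convert this using 1; ring
      · have := hx.mul G K' h1 h2
        rw [pow_succ', show x G * (x K' * x K' ^ a * w) = x G * x K' * (x K' ^ a * w) by ring,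
          this, zero_mul]
        exact W.zero_mem

theorem xb_mul_x (hx : ChowRel R X x) {F K : Finset α} (h1 : ¬ F ⊆ K) (h2 : ¬ K ⊆ F) :
    xb x F * x K = 0 := by
  rw [xb, if_neg (by rintro rfl; exact h1 (Finset.empty_subset _))]
  exact hx.mul _ _ h1 h2

theorem star (hx : ChowRel R X x) {S : Finset α} (hS : S ⊆ X) (n : ℕ) : ∀ {F : Finset α},
    R.Flat X F → ¬ S ⊆ F → R.r (S ∪ F) ≤ R.r F + n → xb x F * gS x S ^ n = 0 := by
  induction n with
  | zero =>
    intro F hF hn hr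
    have := hF.lt hS hn
    omega
  | succ n ih =>
    intro F hF hn hr
    obtain ⟨a, ha, haF⟩ := Finset.not_subset.1 hn
    have e : gS x S = - ∑ K with (a ∈ K ∧ ¬ S ⊆ K), x K := by
      have h1 := hx.lin a (hS ha)
      rw [← Finset.sum_filter_add_sum_filter_not _ (fun K => S ⊆ K), Finset.filter_filter,
        Finset.filter_filter] at h1
      rw [eq_neg_iff_add_eq_zero, ← h1, gS]
      congr 2
      ext K; simp only [Finset.mem_filter, Finset.mem_univ, true_and]
      exact ⟨fun h => ⟨h ha, h⟩, fun h => h.2⟩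
    rw [pow_succ']
    nth_rewrite 1 [e]
    rw [neg_mul, mul_neg, Finset.sum_mul, Finset.mul_sum, neg_eq_zero]
    refine Finset.sum_eq_zero fun K hK => ?_
    obtain ⟨haK, hSK⟩ := (Finset.mem_filter.1 hK).2
    by_cases hKf : R.Flat X K ∧ K.Nonempty
    swap
    · rw [hx.zero K hKf]; ring
    have hKF : ¬ K ⊆ F := fun h => haF (h haK)
    by_cases hFK : F ⊆ K
    · have h1 := R.submod K (S ∪ F)
      have e2 : K ∪ (S ∪ F) = S ∪ K := by
        ext y; simp only [Finset.mem_union]; have := @hFK y; tauto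
      have h3 : R.r (insert a F) ≤ R.r (K ∩ (S ∪ F)) := R.mono (by
        intro y hy
        rcases Finset.mem_insert.1 hy with rfl | hy
        · exact Finset.mem_inter.2 ⟨haK, Finset.mem_union_left _ ha⟩
        · exact Finset.mem_inter.2 ⟨hFK hy, Finset.mem_union_right _ hy⟩)
      have h4 := hF.2 a (hS ha) haF
      rw [e2] at h1
      have := ih hKf.1 hSK (by omega)
      rw [xb_of_nonempty hKf.2] at this
      rw [this, mul_zero]
    · rw [← mul_assoc, xb_mul_x hx hFK hKF, zero_mul]

theorem US_top (hx : ChowRel R X x) : US x X = ⊥ := by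
  rw [US, Submodule.span_eq_bot]
  rintro _ ⟨K, hK, rfl⟩
  exact hx.zero K fun h => hK.2 h.1.1

theorem gS_eq (S : Finset α) : gS x S = x S + ∑ F with S ⊂ F, x F := by
  rw [gS, ← Finset.sum_insert (s := univ.filter fun F => S ⊂ F) (a := S) (f := x)]
  · congr 1
    ext F; simp only [Finset.mem_filter, Finset.mem_univ, true_and, Finset.mem_insert]
    constructor
    · intro h; rcases h.eq_or_ssubset with h | h
      · exact Or.inl h.symm
      · exact Or.inr h
    · rintro (rfl | h)
      · exact le_rfl
      · exact h.1
  · simp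

theorem gS_top (hx : ChowRel R X x) : gS x X = x X := by
  rw [gS_eq, Finset.sum_eq_zero, add_zero]
  intro K hK
  exact hx.zero K fun h => (Finset.mem_filter.1 hK).2.2 h.1.1

theorem sum_above_mem (S : Finset α) : ∑ F with S ⊂ F, x F ∈ US x S :=
  Submodule.sum_mem _ fun _ hK => US_mem (Finset.mem_filter.1 hK).2

/-- decomposition principle -/
theorem dec_ind (hx : ChowRel R X x) {F : Finset α} (hF : R.Flat X F) (n : ℕ)
    (W : Submodule ℝ B) (hX : xb x F * x X ^ n ∈ W)
    (hK : ∀ K, R.Flat X K → F ⊂ K → K ⊂ X → ∀ a b, 1 ≤ a → R.r F + a < R.r K → a + b = n →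
      ∀ w ∈ US x K ^ b, xb x F * (x K ^ a * w) ∈ W) :
    ∀ u ∈ US x F ^ n, xb x F * u ∈ W := by
  rcases Nat.eq_zero_or_pos n with rfl | hn
  · intro u hu
    rw [pow_zero] at hu
    obtain ⟨c, rfl⟩ := Submodule.mem_one.1 hu
    rw [Algebra.algebraMap_eq_smul_one, mul_smul_comm]
    refine W.smul_mem _ ?_
    simpa using hX
  obtain ⟨n, rfl⟩ : ∃ n', n = n' + 1 := ⟨n - 1, by omega⟩
  suffices H : ∀ (N : ℕ) (K : Finset α), R.Flat X K → F ⊆ K → R.r X - R.r K ≤ N →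
      ∀ u ∈ US x K ^ (n + 1), xb x F * u ∈ W from H _ F hF le_rfl le_rfl
  intro N
  induction N with
  | zero =>
    intro K hKf hFK hN u hu
    have : K = X := by
      by_contra hne
      have := hKf.lt_of_ssubset le_rfl (hKf.1.ssubset_of_ne hne)
      omega
    subst this
    rw [US_top hx] at hu
    rw [show u = 0 by simpa using hu, mul_zero]; exact W.zero_mem
  | succ N ih =>
    intro K hKf hFK hN u hu
    refine sort_ind hx n (W.comap (LinearMap.mulLeft ℝ (xb x F))) ?_ u hu
    intro K' hKK' a b ha hab w hw
    change xb x F * (x K' ^ a * w) ∈ W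
    by_cases hf : R.Flat X K' ∧ K'.Nonempty
    swap
    · rw [hx.zero _ hf, zero_pow (by omega)]; simp
    by_cases hKX : K' = X
    · subst hKX
      rw [US_top hx] at hw
      rcases Nat.eq_zero_or_pos b with rfl | hb
      · rw [pow_zero] at hw
        obtain ⟨c, rfl⟩ := Submodule.mem_one.1 hw
        rw [Algebra.algebraMap_eq_smul_one, mul_smul_comm, mul_smul_comm, mul_one]
        rw [add_zero] at hab
        subst hab
        exact W.smul_mem _ hX
      · obtain ⟨b, rfl⟩ : ∃ n', b = n' + 1 := ⟨b - 1, by omega⟩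
        rw [show w = 0 by simpa using hw]; simp
    have hrK := hKf.lt_of_ssubset hf.1.1 hKK'
    have hP := ih K' hf.1 (hFK.trans hKK'.1) (by omega)
    clear hu
    induction a using Nat.strong_induction_on generalizing b w with
    | _ a iha =>
      have hFK' : F ⊂ K' := lt_of_le_of_lt (Finset.le_iff_subset.2 hFK) hKK'
      have hr' := hF.lt_of_ssubset hf.1.1 hFK'
      by_cases had : R.r F + a < R.r K'
      · exact hK K' hf.1 hFK' (hf.1.1.ssubset_of_ne hKX) a b ha had hab w hw
      set d := R.r K' - R.r F with hd
      obtain ⟨c, rfl⟩ : ∃ c, a = c + d := ⟨a - d, by omega⟩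
      have hst := star hx hf.1.1 d hF hFK'.2 (by
        rw [Finset.union_eq_left.2 hFK'.1]; omega)
      rw [gS_eq] at hst
      set T := ∑ F with K' ⊂ F, x F with hT
      have hTm : T ∈ US x K' := sum_above_mem K'
      have e1 : xb x F * (x K' ^ (c + d) * w) = xb x F * (x K' ^ (c + d) * w) -
          (x K' ^ c * w) * (xb x F * (x K' + T) ^ d) := by rw [hst]; ring
      rw [e1, add_comm (x K') T, add_pow, Finset.sum_range_succ', mul_add, mul_add]
      have e2 : (x K' ^ c * w) * (xb x F * (T ^ 0 * x K' ^ (d - 0) * (d.choose 0 : B))) =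
        xb x F * (x K' ^ (c + d) * w) := by simp [pow_add]; ring
      rw [e2, sub_add_cancel_right]
      refine W.neg_mem ?_
      rw [Finset.mul_sum, Finset.mul_sum]
      refine W.sum_mem fun j hj => ?_
      have hj := Finset.mem_range.1 hj
      have hTw : T ^ (j + 1) * w ∈ US x K' ^ (j + 1 + b) :=
        US_pow_mul (Submodule.pow_mem_pow _ hTm _) hw
      have e3 : x K' ^ c * w * (xb x F * (T ^ (j + 1) * x K' ^ (d - (j + 1)) *
          (d.choose (j + 1) : B))) =
          (d.choose (j + 1)) • (xb x F * (x K' ^ (c + (d - (j+1))) * (T ^ (j + 1) * w))) := by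
        rw [nsmul_eq_mul, pow_add]; ring
      rw [e3]
      refine W.smul_of_tower_mem _ ?_
      by_cases h0 : c + (d - (j + 1)) = 0
      · rw [h0, pow_zero, one_mul]
        refine hP _ ?_
        convert hTw using 2
        omega
      · exact iha (c + (d - (j+1))) (by omega) (j + 1 + b) (by omega) (by omega) _ hTw

theorem R1 (hx : ChowRel R X x) {F : Finset α} (hF : R.Flat X F) (hFX : F ≠ X) {n : ℕ}
    (hn : R.r X ≤ R.r F + n) : ∀ u ∈ US x F ^ n, xb x F * u = 0 := by
  generalize hN : R.r X - R.r F = N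
  induction N using Nat.strong_induction_on generalizing F n with
  | _ N ih =>
    intro u hu
    have hFs := hF.1.ssubset_of_ne hFX
    have := dec_ind hx hF n (⊥ : Submodule ℝ B) ?_ ?_ u hu
    · simpa using this
    · have := star hx le_rfl n hF hFs.2 (by rwa [Finset.union_eq_left.2 hF.1])
      rw [gS_top hx] at this
      simpa using this
    · intro K hK hFK hKX a b ha hab habn w hw
      have h0 := R.mono hK.1
      have h1 := ih (R.r X - R.r K) (by omega) hK hKX.ne (n := b) (by omega) rfl w hw
      rw [xb_of_ssubset hFK] at h1
      obtain ⟨a, rfl⟩ : ∃ n', a = n' + 1 := ⟨a - 1, by omega⟩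
      rw [pow_succ, mul_assoc, h1]; simp

theorem R1x (hx : ChowRel R X x) {F : Finset α} (hF : R.Flat X F) (hFn : F.Nonempty)
    (hFX : F ≠ X) {n : ℕ}
    (hn : R.r X ≤ R.r F + n) : ∀ u ∈ US x F ^ n, x F * u = 0 := by
  have := R1 hx hF hFX hn
  rwa [xb_of_nonempty hFn] at this

theorem topdim (hx : ChowRel R X x) {F : Finset α} (hF : R.Flat X F) {t : ℕ}
    (ht : R.r X = R.r F + t + 1) : ∀ u ∈ US x F ^ t, ∃ c : ℝ, xb x F * u = c • (xb x F * x X ^ t) := by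
  intro u hu
  have hm := dec_ind hx hF t (Submodule.span ℝ {xb x F * x X ^ t})
    (Submodule.mem_span_singleton_self _) ?_ u hu
  · obtain ⟨c, hc⟩ := Submodule.mem_span_singleton.1 hm
    exact ⟨c, hc.symm⟩
  · intro K hK hFK hKX a b ha hab habn w hw
    have h1 := R1 hx hK hKX.ne (n := b) (by omega) w hw
    rw [xb_of_ssubset hFK] at h1
    obtain ⟨a, rfl⟩ : ∃ n', a = n' + 1 := ⟨a - 1, by omega⟩
    rw [pow_succ, mul_assoc, h1]; simp

theorem two_term (hx : ChowRel R X x) {F₀ F : Finset α} (hF₀ : R.Flat X F₀) (hF : R.Flat X F)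
    (h0 : F₀ ⊂ F) {r' t : ℕ} (hr' : R.r F = R.r F₀ + r')
    (ht : R.r X = R.r F + t + 1) :
    xb x F₀ * (x F ^ r' * x X ^ t) = - (xb x F₀ * x X ^ (r' + t)) := by
  have hFX : F ⊂ X := hF.1.ssubset_of_ne (by rintro rfl; omega)
  have hFn : F.Nonempty := Finset.nonempty_iff_ne_empty.2
    (by rintro rfl; exact Finset.not_ssubset_empty _ h0)
  have hXX : R.Flat X X := R.flat_self
  have k1 : ∀ G, F ⊂ G → G ≠ X → x G * x X ^ t = 0 := by
    intro G hG hGX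
    by_cases hf : R.Flat X G ∧ G.Nonempty
    · have h1 := hF.lt_of_ssubset hf.1.1 hG
      exact R1x hx hf.1 hf.2 hGX (by omega) _ (pow_x_mem (hf.1.1.ssubset_of_ne hGX) t)
    · rw [hx.zero _ hf, zero_mul]
  have k2 : gS x F * x X ^ t = (x F + x X) * x X ^ t := by
    rw [gS_eq, add_mul, add_mul]
    congr 1
    rw [Finset.sum_mul, Finset.sum_eq_single X (fun G hG hne => k1 G (Finset.mem_filter.1 hG).2 hne)
      (fun h => (h (Finset.mem_filter.2 ⟨Finset.mem_univ _, hFX⟩)).elim)]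
  have k3 : x F * x X ^ (t + 1) = 0 :=
    R1x hx hF hFn hFX.ne (by omega) _ (pow_x_mem hFX (t+1))
  have k4 : ∀ m, gS x F ^ (m + 1) * x X ^ t = x F ^ (m+1) * x X ^ t + x X ^ (m + 1) * x X ^ t := by
    intro m
    induction m with
    | zero => rw [zero_add, pow_one, k2]; ring
    | succ m ih =>
      have e : gS x F ^ (m + 1 + 1) * x X ^ t = gS x F ^ (m+1) * x X ^ t * gS x F := by ring
      rw [e, ih]
      have e2 : (x F ^ (m + 1) * x X ^ t + x X ^ (m + 1) * x X ^ t) * gS x F =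
        (x F ^ (m + 1) + x X ^ (m + 1)) * (gS x F * x X ^ t) := by ring
      rw [e2, k2]
      have e3 : (x F ^ (m + 1) + x X ^ (m + 1)) * ((x F + x X) * x X ^ t) =
        x F ^ (m + 1 + 1) * x X ^ t + x X ^ (m + 1 + 1) * x X ^ t
        + x F ^ m * (x F * x X ^ (t+1)) + x X ^ m * (x F * x X ^ (t + 1)) := by ring
      rw [e3, k3]; ring
  have hpos := hF₀.lt_of_ssubset hF.1 h0
  obtain ⟨m, rfl⟩ : ∃ n', r' = n' + 1 := ⟨r' - 1, by omega⟩
  have hst := star hx hF.1 (m + 1) hF₀ h0.2 (by rw [Finset.union_eq_left.2 h0.1]; omega)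
  have h5 : xb x F₀ * (gS x F ^ (m + 1) * x X ^ t) = 0 := by rw [← mul_assoc, hst, zero_mul]
  rw [k4, mul_add, ← pow_add] at h5
  exact eq_neg_of_add_eq_zero_left h5

end
end AHK

namespace AHK
open Finset

section
variable {α : Type*} [Fintype α] [DecidableEq α] {B : Type*} [CommRing B] [Algebra ℝ B]
variable {R : RkFn α} {X : Finset α} {x : Finset α → B}

/-- validity of a pair in the decomposition -/
def Val (R : RkFn α) (X F : Finset α) (n : ℕ) (K : Finset α) (a : ℕ) : Prop :=
  R.Flat X K ∧ F ⊂ K ∧ K ⊂ X ∧ 1 ≤ a ∧ R.r F + a < R.r K ∧ a ≤ n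

theorem rep (hx : ChowRel R X x) {F : Finset α} (hF : R.Flat X F) (n : ℕ) :
    ∀ u ∈ US x F ^ n, ∃ (l : ℝ) (w : Finset α → ℕ → B),
      (∀ K a, Val R X F n K a → w K a ∈ US x K ^ (n - a)) ∧
      (∀ K a, ¬ Val R X F n K a → w K a = 0) ∧
      xb x F * u = l • (xb x F * x X ^ n) +
        ∑ K, ∑ a ∈ range (n + 1), xb x F * (x K ^ a * w K a) := by
  classical
  let W : Submodule ℝ B :=
    { carrier := {y | ∃ (l : ℝ) (w : Finset α → ℕ → B),
        (∀ K a, Val R X F n K a → w K a ∈ US x K ^ (n - a)) ∧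
        (∀ K a, ¬ Val R X F n K a → w K a = 0) ∧
        y = l • (xb x F * x X ^ n) + ∑ K, ∑ a ∈ range (n + 1), xb x F * (x K ^ a * w K a)}
      zero_mem' := ⟨0, fun _ _ => 0, fun _ _ _ => Submodule.zero_mem _, fun _ _ _ => rfl, by simp⟩
      add_mem' := by
        rintro _ _ ⟨l, w, h1, h2, rfl⟩ ⟨l', w', h1', h2', rfl⟩
        refine ⟨l + l', fun K a => w K a + w' K a,
          fun K a h => Submodule.add_mem _ (h1 K a h) (h1' K a h),
          fun K a h => by dsimp only; rw [h2 K a h, h2' K a h, add_zero], ?_⟩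
        simp only [mul_add, Finset.sum_add_distrib, add_smul]
        abel
      smul_mem' := by
        rintro c _ ⟨l, w, h1, h2, rfl⟩
        refine ⟨c * l, fun K a => c • w K a,
          fun K a h => Submodule.smul_mem _ _ (h1 K a h),
          fun K a h => by dsimp only; rw [h2 K a h, smul_zero], ?_⟩
        simp only [mul_smul_comm, smul_add, mul_smul, Finset.smul_sum] }
  refine dec_ind hx hF n W ?_ ?_
  · exact ⟨1, fun _ _ => 0, fun _ _ _ => Submodule.zero_mem _, fun _ _ _ => rfl, by simp⟩
  · intro K hK hFK hKX a b ha hab habn w hw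
    refine ⟨0, fun K' a' => if K' = K ∧ a' = a then w else 0, ?_, ?_, ?_⟩
    · intro K' a' _
      dsimp only
      split_ifs with h
      · rw [h.1, h.2, ← habn, Nat.add_sub_cancel_left]; exact hw
      · exact Submodule.zero_mem _
    · intro K' a' h
      dsimp only
      rw [if_neg]
      rintro ⟨rfl, rfl⟩
      exact h ⟨hK, hFK, hKX, ha, hab, by omega⟩
    · rw [zero_smul, zero_add, Finset.sum_eq_single K, Finset.sum_eq_single a]
      · simp
      · intro a' _ h; simp [h]
      · intro h; exact (h (Finset.mem_range.2 (by omega))).elim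
      · intro K' _ h; simp [h]
      · intro h; exact (h (Finset.mem_univ _)).elim

theorem top_ne (hx : ChowRel R X x) {F : Finset α} (hF : R.Flat X F) {d t : ℕ}
    (hd : R.r X = d + 1) (hne : x X ^ d ≠ 0)
    (ht : R.r X = R.r F + t + 1) : xb x F * x X ^ t ≠ 0 := by
  rcases F.eq_empty_or_nonempty with rfl | hFn
  · rw [R.r_empty] at ht
    rw [xb, if_pos rfl, one_mul, show t = d by omega]; exact hne
  · intro h
    have h2 := two_term hx (F₀ := ∅) R.flat_empty hF (Finset.empty_ssubset.2 hFn)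
      (r' := R.r F) (by rw [R.r_empty, zero_add]) ht
    have hp := R.r_pos_of_nonempty hFn
    obtain ⟨m, hm⟩ : ∃ n', R.r F = n' + 1 := ⟨R.r F - 1, by omega⟩
    rw [xb_of_nonempty hFn] at h
    rw [xb, if_pos rfl, one_mul, one_mul, hm, pow_succ, mul_assoc, h, mul_zero,
      zero_eq_neg, show m + 1 + t = d by omega] at h2
    exact hne h2

theorem PD (hx : ChowRel R X x) {d : ℕ}
    (hd : R.r X = d + 1) (hne : x X ^ d ≠ 0) {F : Finset α} (hF : R.Flat X F) {t n s : ℕ}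
    (ht : R.r X = R.r F + t + 1) (hns : n + s = t) :
    ∀ u ∈ US x F ^ n, (∀ v ∈ US x F ^ s, xb x F * (u * v) = 0) → xb x F * u = 0 := by
  generalize hN : R.r X - R.r F = N
  induction N using Nat.strong_induction_on generalizing F n s t with
  | _ N ih =>
    intro u hu hv
    obtain ⟨l, w, hw, hw0, e⟩ := rep hx hF n u hu
    have hFX : F ⊂ X := hF.1.ssubset_of_ne (by rintro rfl; omega)
    have hXn : X.Nonempty := Finset.nonempty_iff_ne_empty.2 (by
      rintro rfl; exact Finset.not_ssubset_empty _ hFX)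
    have key : ∀ K a, xb x F * (x K ^ a * w K a) = 0 := by
      intro K a
      by_contra hcon
      -- choose maximal a
      have hmax : ∃ a, xb x F * (x K ^ a * w K a) ≠ 0 ∧
          ∀ a', a < a' → xb x F * (x K ^ a' * w K a') = 0 := by
        by_contra hno
        push Not at hno
        have : ∀ m, ∃ a, m ≤ a ∧ xb x F * (x K ^ a * w K a) ≠ 0 := by
          intro m
          induction m with
          | zero => exact ⟨a, Nat.zero_le _, hcon⟩
          | succ m ihm =>
            obtain ⟨a, h1, h2⟩ := ihm
            obtain ⟨a', h3, h4⟩ := hno a h2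
            exact ⟨a', by omega, h4⟩
        obtain ⟨a, h1, h2⟩ := this (n + 1)
        apply h2
        rw [hw0 K a (fun h => by have := h.2.2.2.2.2; omega)]; simp
      clear hcon
      obtain ⟨a, hcon, hmax⟩ := hmax
      by_cases hval : Val R X F n K a
      swap
      · apply hcon; rw [hw0 K a hval]; simp
      apply hcon
      have hwK := hw K a hval
      obtain ⟨hK, hFK, hKX, ha1, haK, han⟩ := hval
      have hKn : K.Nonempty := Finset.nonempty_iff_ne_empty.2 (by
        rintro rfl; exact Finset.not_ssubset_empty _ hFK)
      suffices hxw : x K * w K a = 0 by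
        obtain ⟨a, rfl⟩ : ∃ n', a = n' + 1 := ⟨a - 1, by omega⟩
        rw [pow_succ, mul_assoc, hxw]; simp
      have hrK := hK.lt_of_ssubset le_rfl hKX
      obtain ⟨tK, htK⟩ : ∃ tK, R.r X = R.r K + tK + 1 := ⟨R.r X - R.r K - 1, by omega⟩
      by_cases hbig : tK < n - a
      · exact R1x hx hK hKn hKX.ne (by omega) _ hwK
      obtain ⟨sK, hsK⟩ : ∃ sK, (n - a) + sK = tK := ⟨tK - (n - a), by omega⟩
      have := ih (R.r X - R.r K) (by omega) hK htK hsK rfl (w K a) hwK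
      rw [xb_of_ssubset hFK] at this
      refine this fun v hvK => ?_
      obtain ⟨dK, hdK⟩ : ∃ dK, R.r K = R.r F + dK := ⟨R.r K - R.r F, by omega⟩
      have htest := hv (x K ^ (dK - a) * v) (by
        have := US_pow_mul (pow_x_mem hFK (dK - a)) (US_pow_mono hFK.1 _ hvK)
        convert this using 2; omega)
      rw [← mul_assoc, e, add_mul, Finset.sum_mul] at htest
      -- lambda term
      have z1 : l • (xb x F * x X ^ n) * (x K ^ (dK - a) * v) = 0 := by
        have h0 : x K * (x X ^ n * v) = 0 := R1x hx hK hKn hKX.ne (n := n + sK) (by omega) _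
          (US_pow_mul (pow_x_mem hKX n) hvK)
        obtain ⟨q, hq⟩ : ∃ q, dK - a = q + 1 := ⟨dK - a - 1, by omega⟩
        rw [hq, smul_mul_assoc, show xb x F * x X ^ n * (x K ^ (q + 1) * v) =
          xb x F * x K ^ q * (x K * (x X ^ n * v)) by ring, h0]; simp
      rw [z1, zero_add] at htest
      rw [Finset.sum_eq_single K, Finset.sum_mul, Finset.sum_eq_single a] at htest
      · -- main term
        have hWv := US_pow_mul hwK hvK
        rw [hsK] at hWv
        obtain ⟨c, hc⟩ := topdim hx hK htK _ hWv
        rw [xb_of_ssubset hFK] at hc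
        rw [hc]
        obtain ⟨q, hq⟩ : ∃ q, dK = q + 1 := ⟨dK - 1, by omega⟩
        have e1 : xb x F * (x K ^ a * w K a) * (x K ^ (dK - a) * v) =
            xb x F * x K ^ q * (x K * (w K a * v)) := by
          have : x K ^ a * x K ^ (dK - a) = x K ^ q * x K := by
            rw [← pow_add, ← pow_succ]; congr 1; omega
          linear_combination xb x F * w K a * v * this
        rw [e1, hc, mul_smul_comm] at htest
        have e2 : xb x F * x K ^ q * (x K * x X ^ tK) = xb x F * (x K ^ dK * x X ^ tK) := by
          rw [hq]; ring
        rw [e2, two_term hx hF hK hFK hdK htK] at htest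
        have hne' := top_ne hx hF hd hne ht
        rw [show dK + tK = t by omega, smul_neg, neg_eq_zero] at htest
        rcases smul_eq_zero.1 htest with h | h
        · rw [h, zero_smul]
        · exact (hne' h).elim
      · -- the other terms
        intro a' _ haa'
        by_cases hlt : a < a'
        · rw [hmax a' hlt, zero_mul]
        by_cases hval' : Val R X F n K a'
        swap
        · rw [hw0 K a' hval']; simp
        have h0 : x K * (w K a' * v) = 0 := R1x hx hK hKn hKX.ne (n := (n - a') + sK) (by omega) _
          (US_pow_mul (hw K a' hval') hvK)
        obtain ⟨q, hq⟩ : ∃ q, dK - a = q + 1 := ⟨dK - a - 1, by omega⟩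
        rw [hq, show xb x F * (x K ^ a' * w K a') * (x K ^ (q + 1) * v) =
          xb x F * x K ^ a' * x K ^ q * (x K * (w K a' * v)) by ring, h0]; simp
      · intro h; exact (h (Finset.mem_range.2 (by omega))).elim
      · intro K' _ hKK'
        rw [Finset.sum_mul]
        refine Finset.sum_eq_zero fun a' _ => ?_
        by_cases hval' : Val R X F n K' a'
        swap
        · rw [hw0 K' a' hval']; simp
        have hwK' := hw K' a' hval'
        obtain ⟨hK', hFK', hKX', ha1', haK', han'⟩ := hval'
        obtain ⟨q, hq⟩ : ∃ q, dK - a = q + 1 := ⟨dK - a - 1, by omega⟩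
        obtain ⟨p, rfl⟩ : ∃ p, a' = p + 1 := ⟨a' - 1, by omega⟩
        by_cases c1 : K ⊆ K'
        · have c1 : K ⊂ K' := c1.ssubset_of_ne (Ne.symm hKK')
          have h0 : x K * (x K' ^ (p + 1) * w K' (p+1) * v) = 0 :=
            R1x hx hK hKn hKX.ne (n := (p + 1) + (n - (p+1)) + sK) (by omega) _
            (US_pow_mul (US_pow_mul (pow_x_mem c1 _) (US_pow_mono c1.1 _ hwK')) hvK)
          rw [hq, show xb x F * (x K' ^ (p + 1) * w K' (p + 1)) * (x K ^ (q + 1) * v) =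
            xb x F * x K ^ q * (x K * (x K' ^ (p + 1) * w K' (p+1) * v)) by ring, h0]; simp
        · by_cases c2 : K' ⊆ K
          · have c2 : K' ⊂ K := c2.ssubset_of_ne hKK'
            have hKn' : K'.Nonempty := Finset.nonempty_iff_ne_empty.2 (by
              rintro rfl; exact Finset.not_ssubset_empty _ hFK')
            have h0 : x K' * (w K' (p+1) * x K ^ (dK - a) * v) = 0 :=
              R1x hx hK' hKn' hKX'.ne (n := (n - (p+1)) + (dK - a) + sK) (by omega) _
              (US_pow_mul (US_pow_mul hwK' (pow_x_mem c2 _)) (US_pow_mono c2.1 _ hvK))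
            rw [show xb x F * (x K' ^ (p + 1) * w K' (p + 1)) * (x K ^ (dK - a) * v) =
              xb x F * x K' ^ p * (x K' * (w K' (p+1) * x K ^ (dK - a) * v)) by ring, h0]; simp
          · rw [hq, show xb x F * (x K' ^ (p + 1) * w K' (p + 1)) * (x K ^ (q + 1) * v) =
              xb x F * x K' ^ p * w K' (p+1) * x K ^ q * v * (x K' * x K) by ring,
              hx.mul K' K c2 c1]; simp
      · intro h; exact (h (Finset.mem_univ _)).elim
    have e0 : xb x F * u = l • (xb x F * x X ^ n) := by
      rw [e, Finset.sum_eq_zero, add_zero]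
      intro K _
      exact Finset.sum_eq_zero fun a _ => key K a
    have h1 := hv (x X ^ s) (pow_x_mem hFX s)
    rw [← mul_assoc, e0, smul_mul_assoc, mul_assoc, ← pow_add, hns] at h1
    rcases smul_eq_zero.1 h1 with h | h
    · rw [e0, h, zero_smul]
    · exact (top_ne hx hF hd hne ht h).elim

end
end AHK

namespace AHK
open Finset

section
variable {α : Type*} [Fintype α] [DecidableEq α]

/-- ideal of Chow relations (with a generator for the top flat) -/
noncomputable def chowI (R : RkFn α) (X : Finset α) : Ideal (MvPolynomial (Finset α) ℝ) :=
  Ideal.span {p | (∃ F, ¬ (R.Flat X F ∧ F.Nonempty) ∧ p = MvPolynomial.X F) ∨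
    (∃ F G : Finset α, ¬ F ⊆ G ∧ ¬ G ⊆ F ∧ p = MvPolynomial.X F * MvPolynomial.X G) ∨
    (∃ a ∈ X, p = ∑ F with a ∈ F, MvPolynomial.X F)}

/-- the Chow ring of the restriction of `R` to `X` -/
def Chow (R : RkFn α) (X : Finset α) : Type _ := MvPolynomial (Finset α) ℝ ⧸ chowI R X

noncomputable instance (R : RkFn α) (X : Finset α) : CommRing (Chow R X) :=
  inferInstanceAs (CommRing (MvPolynomial (Finset α) ℝ ⧸ chowI R X))

noncomputable instance (R : RkFn α) (X : Finset α) : Algebra ℝ (Chow R X) :=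
  inferInstanceAs (Algebra ℝ (MvPolynomial (Finset α) ℝ ⧸ chowI R X))

/-- quotient map -/
noncomputable def Chow.mk (R : RkFn α) (X : Finset α) :
    MvPolynomial (Finset α) ℝ →ₐ[ℝ] Chow R X := Ideal.Quotient.mkₐ ℝ (chowI R X)

/-- generators -/
noncomputable def cx (R : RkFn α) (X F : Finset α) : Chow R X := Chow.mk R X (MvPolynomial.X F)

theorem Chow.mk_eq_zero {R : RkFn α} {X : Finset α} {p : MvPolynomial (Finset α) ℝ}
    (h : p ∈ chowI R X) : Chow.mk R X p = 0 := Ideal.Quotient.eq_zero_iff_mem.2 h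

theorem chowRel_cx (R : RkFn α) (X : Finset α) : ChowRel R X (cx R X) where
  zero F h := Chow.mk_eq_zero (Ideal.subset_span (Or.inl ⟨F, h, rfl⟩))
  mul F G h h' := by
    rw [cx, cx, ← map_mul]
    exact Chow.mk_eq_zero (Ideal.subset_span (Or.inr (Or.inl ⟨F, G, h, h', rfl⟩)))
  lin a ha := by
    simp only [cx]
    rw [← map_sum]
    exact Chow.mk_eq_zero (Ideal.subset_span (Or.inr (Or.inr ⟨a, ha, rfl⟩)))

variable {B : Type*} [CommRing B] [Algebra ℝ B]

/-- universal property -/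
noncomputable def Chow.lift {R : RkFn α} {X : Finset α} {x : Finset α → B}
    (hx : ChowRel R X x) : Chow R X →ₐ[ℝ] B :=
  Ideal.Quotient.liftₐ (chowI R X) (MvPolynomial.aeval x) (by
    intro p hp
    suffices chowI R X ≤ RingHom.ker (MvPolynomial.aeval (R := ℝ) x) from RingHom.mem_ker.1 (this hp)
    rw [chowI, Ideal.span_le]
    rintro p (⟨F, hF, rfl⟩ | ⟨F, G, h1, h2, rfl⟩ | ⟨a, ha, rfl⟩)
    · simpa using hx.zero F hF
    · simpa using hx.mul F G h1 h2
    · simpa using hx.lin a ha)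

@[simp] theorem Chow.lift_cx {R : RkFn α} {X : Finset α} {x : Finset α → B}
    (hx : ChowRel R X x) (F : Finset α) : Chow.lift hx (cx R X F) = x F := by
  change MvPolynomial.aeval x (MvPolynomial.X F) = x F
  exact MvPolynomial.aeval_X x F

theorem Chow.hom_ext {R : RkFn α} {X : Finset α} {f g : Chow R X →ₐ[ℝ] B}
    (h : ∀ F, f (cx R X F) = g (cx R X F)) : f = g := by
  have : f.comp (Chow.mk R X) = g.comp (Chow.mk R X) := MvPolynomial.algHom_ext h
  ext y
  obtain ⟨p, rfl⟩ := Ideal.Quotient.mk_surjective (I := chowI R X) y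
  exact DFunLike.congr_fun this p

/-! dragon Hall–Rado functional -/

/-- weight of a family -/
def wt (s : Finset α →₀ ℕ) (T : Finset (Finset α)) : ℕ := ∑ S ∈ T, s S

/-- dragon Hall–Rado condition -/
def DHR (R : RkFn α) (s : Finset α →₀ ℕ) : Prop :=
  ∀ T : Finset (Finset α), 0 < wt s T → wt s T + 1 ≤ R.r (T.sup id)

theorem wt_add_single (s : Finset α →₀ ℕ) (A : Finset α) (T : Finset (Finset α)) :
    wt (s + Finsupp.single A 1) T = wt s T + if A ∈ T then 1 else 0 := by
  simp only [wt, Finsupp.add_apply, Finset.sum_add_distrib, Finsupp.single_apply]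
  congr 1
  simp [Finset.sum_ite_eq]

theorem wt_mono (s : Finset α →₀ ℕ) {T T' : Finset (Finset α)} (h : T ⊆ T') : wt s T ≤ wt s T' :=
  Finset.sum_le_sum_of_subset h

theorem wt_union_inter (s : Finset α →₀ ℕ) (T T' : Finset (Finset α)) :
    wt s (T ∪ T') + wt s (T ∩ T') = wt s T + wt s T' := Finset.sum_union_inter

/-- condition C -/
def CC (R : RkFn α) (s : Finset α →₀ ℕ) (m : ℕ) (A : Finset α) : Prop :=
  ∀ T : Finset (Finset α), wt s T + m ≤ R.r (A ∪ T.sup id)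

theorem DHR_add {R : RkFn α} {s : Finset α →₀ ℕ} {A : Finset α} :
    DHR R (s + Finsupp.single A 1) ↔ DHR R s ∧ CC R s 2 A := by
  constructor
  · intro h
    constructor
    · intro T hT
      have := h T
      rw [wt_add_single] at this
      have := this (by omega)
      omega
    · intro T
      have := h (insert A T)
      rw [wt_add_single, if_pos (Finset.mem_insert_self _ _), Finset.sup_insert] at this
      have h1 := this (by omega)
      have h2 := wt_mono s (Finset.subset_insert A T)
      have h3 : R.r (id A ⊔ T.sup id) = R.r (A ∪ T.sup id) := rfl
      omega
  · rintro ⟨h1, h2⟩ T hT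
    rw [wt_add_single] at hT ⊢
    split_ifs at hT ⊢ with hA
    · have := h2 T
      have h3 : A ∪ T.sup id = T.sup id := Finset.union_eq_right.2 (Finset.le_sup (f := id) hA)
      rw [h3] at this; omega
    · exact h1 T hT

theorem CC_add {R : RkFn α} {s : Finset α →₀ ℕ} {A B : Finset α} :
    CC R (s + Finsupp.single A 1) 2 B ↔ CC R s 2 B ∧ CC R s 3 (A ∪ B) := by
  constructor
  · intro h
    constructor
    · intro T
      have := h T
      rw [wt_add_single] at this; omega
    · intro T
      have := h (insert A T)
      rw [wt_add_single, if_pos (Finset.mem_insert_self _ _), Finset.sup_insert] at this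
      have h2 := wt_mono s (Finset.subset_insert A T)
      have h3 : B ∪ (id A ⊔ T.sup id) = A ∪ B ∪ T.sup id := by
        ext y; simp only [Finset.mem_union, Finset.sup_eq_union, id]; tauto
      rw [h3] at this; omega
  · rintro ⟨h1, h2⟩ T
    rw [wt_add_single]
    split_ifs with hA
    · have := h2 T
      have h4 : A ⊆ T.sup id := Finset.le_sup (f := id) hA
      have h3 : A ∪ B ∪ T.sup id = B ∪ T.sup id := by
        ext y; simp only [Finset.mem_union]; have := @h4 y; tauto
      rw [h3] at this; omega
    · have := h1 T; omega

theorem CC_or {R : RkFn α} {s : Finset α →₀ ℕ} {F G : Finset α} (hs : DHR R s)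
    (h : CC R s 3 (F ∪ G)) : CC R s 2 F ∨ CC R s 2 G := by
  by_contra hcon
  push Not at hcon
  obtain ⟨h1, h2⟩ := hcon
  simp only [CC, not_forall, not_le] at h1 h2
  obtain ⟨T₁, h1⟩ := h1
  obtain ⟨T₂, h2⟩ := h2
  have h3 := R.submod (F ∪ T₁.sup id) (G ∪ T₂.sup id)
  have h4 := wt_union_inter s T₁ T₂
  have h5 := h (T₁ ∪ T₂)
  have h6 : F ∪ G ∪ (T₁ ∪ T₂).sup id = F ∪ T₁.sup id ∪ (G ∪ T₂.sup id) := by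
    rw [Finset.sup_union]
    ext y; simp only [Finset.mem_union, Finset.sup_eq_union]; tauto
  rw [h6] at h5
  by_cases h0 : 0 < wt s (T₁ ∩ T₂)
  · have h7 := hs _ h0
    have h8 : R.r ((T₁ ∩ T₂).sup id) ≤ R.r ((F ∪ T₁.sup id) ∩ (G ∪ T₂.sup id)) := by
      refine R.mono (Finset.subset_inter ?_ ?_)
      · exact (Finset.le_iff_subset.1 (Finset.sup_mono Finset.inter_subset_left)).trans
          Finset.subset_union_right
      · exact (Finset.le_iff_subset.1 (Finset.sup_mono Finset.inter_subset_right)).trans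
          Finset.subset_union_right
    omega
  · omega

open Classical in
/-- the functional on polynomials in the `h` variables -/
noncomputable def Dh (R : RkFn α) (d : ℕ) : MvPolynomial (Finset α) ℝ →ₗ[ℝ] ℝ :=
  (MvPolynomial.basisMonomials (Finset α) ℝ).constr ℝ
    (fun s => if s.degree = d ∧ DHR R s then (1 : ℝ) else 0)

open Classical in
theorem Dh_monomial (R : RkFn α) (d : ℕ) (s : Finset α →₀ ℕ) :
    Dh R d (MvPolynomial.monomial s 1) = if s.degree = d ∧ DHR R s then (1 : ℝ) else 0 := by
  have := (MvPolynomial.basisMonomials (Finset α) ℝ).constr_basis ℝ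
    (fun s => if s.degree = d ∧ DHR R s then (1 : ℝ) else 0) s
  rwa [MvPolynomial.coe_basisMonomials] at this

/-- annihilator ideal -/
noncomputable def Jh (R : RkFn α) (d : ℕ) : Ideal (MvPolynomial (Finset α) ℝ) where
  carrier := {p | ∀ q, Dh R d (p * q) = 0}
  zero_mem' q := by simp
  add_mem' := by
    intro a b ha hb q
    rw [add_mul, map_add, ha q, hb q, add_zero]
  smul_mem' := by
    intro c a ha q
    rw [smul_eq_mul, show c * a * q = a * (c * q) by ring]; exact ha _

theorem mem_Jh_of_monomial {R : RkFn α} {d : ℕ} {p : MvPolynomial (Finset α) ℝ}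
    (h : ∀ s, Dh R d (p * MvPolynomial.monomial s 1) = 0) : p ∈ Jh R d := by
  intro q
  induction q using MvPolynomial.induction_on' with
  | monomial s c =>
    have : MvPolynomial.monomial s c = c • (MvPolynomial.monomial s (1:ℝ)) := by
      rw [MvPolynomial.smul_monomial, smul_eq_mul, mul_one]
    rw [this, mul_smul_comm, map_smul, h, smul_zero]
  | add p q hp hq => rw [mul_add, map_add, hp, hq, add_zero]

theorem X_mul_monomial (A : Finset α) (s : Finset α →₀ ℕ) :
    (MvPolynomial.X A : MvPolynomial (Finset α) ℝ) * MvPolynomial.monomial s 1 =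
      MvPolynomial.monomial (s + Finsupp.single A 1) 1 := by
  rw [mul_comm, MvPolynomial.X, MvPolynomial.monomial_mul, mul_one]

open Classical in
theorem Dh_two (R : RkFn α) (d : ℕ) (A A' : Finset α) (s : Finset α →₀ ℕ) :
    Dh R d (MvPolynomial.X A * (MvPolynomial.X A' * MvPolynomial.monomial s 1)) =
      if s.degree + 2 = d ∧ DHR R s ∧ CC R s 2 A ∧ CC R s 2 A' ∧ CC R s 3 (A' ∪ A) then 1 else 0 := by
  rw [X_mul_monomial, X_mul_monomial, Dh_monomial]
  refine if_congr ?_ rfl rfl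
  rw [DHR_add, DHR_add, CC_add, map_add, map_add, Finsupp.degree_single, Finsupp.degree_single]
  tauto

theorem quad_mem {R : RkFn α} {d : ℕ} {F G K : Finset α}
    (hK : ∀ T, R.r (K ∪ T) = R.r (F ∪ G ∪ T)) (hFK : F ⊆ K) (hGK : G ⊆ K) :
    ((MvPolynomial.X F - MvPolynomial.X K) * (MvPolynomial.X G - MvPolynomial.X K) :
      MvPolynomial (Finset α) ℝ) ∈ Jh R d := by
  classical
  refine mem_Jh_of_monomial fun s => ?_
  have e : ((MvPolynomial.X F - MvPolynomial.X K) * (MvPolynomial.X G - MvPolynomial.X K) :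
      MvPolynomial (Finset α) ℝ) * MvPolynomial.monomial s 1 =
      MvPolynomial.X F * (MvPolynomial.X G * MvPolynomial.monomial s 1) -
      MvPolynomial.X F * (MvPolynomial.X K * MvPolynomial.monomial s 1) -
      MvPolynomial.X G * (MvPolynomial.X K * MvPolynomial.monomial s 1) +
      MvPolynomial.X K * (MvPolynomial.X K * MvPolynomial.monomial s 1) := by ring
  rw [e, map_add, map_sub, map_sub, Dh_two, Dh_two, Dh_two, Dh_two]
  rw [Finset.union_eq_left.2 hFK, Finset.union_eq_left.2 hGK, Finset.union_self]
  have h1 : CC R s 3 K ↔ CC R s 3 (G ∪ F) := by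
    rw [Finset.union_comm]; simp only [CC, hK]
  rw [h1]
  by_cases h0 : s.degree + 2 = d ∧ DHR R s
  swap
  · rw [if_neg (by tauto), if_neg (by tauto), if_neg (by tauto), if_neg (by tauto)]; ring
  by_cases hE : CC R s 3 (G ∪ F)
  swap
  · rw [if_neg (by tauto), if_neg (by tauto), if_neg (by tauto), if_neg (by tauto)]; ring
  have hCK : CC R s 2 K := fun T => by have := h1.2 hE T; omega
  rcases CC_or h0.2 hE with h | h
  · by_cases h' : CC R s 2 F
    · rw [if_pos (by tauto), if_pos (by tauto), if_pos (by tauto), if_pos (by tauto)]; ring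
    · rw [if_neg (by tauto), if_neg (by tauto), if_pos (by tauto), if_pos (by tauto)]; ring
  · by_cases h' : CC R s 2 G
    · rw [if_pos (by tauto), if_pos (by tauto), if_pos (by tauto), if_pos (by tauto)]; ring
    · rw [if_neg (by tauto), if_pos (by tauto), if_neg (by tauto), if_pos (by tauto)]; ring

theorem lin_mem {R : RkFn α} {d : ℕ} {S : Finset α} (hS : R.r S ≤ 1) :
    (MvPolynomial.X S : MvPolynomial (Finset α) ℝ) ∈ Jh R d := by
  classical
  refine mem_Jh_of_monomial fun s => ?_
  rw [X_mul_monomial, Dh_monomial, if_neg]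
  rintro ⟨-, h⟩
  have := (DHR_add.1 h).2 ∅
  simp [wt] at this
  omega

/-- Möbius inverted generators -/
noncomputable def mob (R : RkFn α) (X : Finset α) (F : Finset α) : MvPolynomial (Finset α) ℝ :=
  if R.Flat X F ∧ F.Nonempty then
    - MvPolynomial.X F - ∑ K ∈ (univ.filter (F ⊂ ·)).attach, mob R X K.1 else 0
termination_by Fintype.card α - F.card
decreasing_by
  have h1 := Finset.card_lt_card (Finset.mem_filter.1 K.2).2
  have h2 := Finset.card_le_univ K.1
  omega

theorem mob_zero {R : RkFn α} {X F : Finset α} (h : ¬ (R.Flat X F ∧ F.Nonempty)) :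
    mob R X F = 0 := by rw [mob, if_neg h]

theorem mob_sum {R : RkFn α} {X F : Finset α} (h : R.Flat X F ∧ F.Nonempty) :
    gS (mob R X) F = - MvPolynomial.X F := by
  rw [gS_eq, mob, if_pos h, Finset.sum_attach (univ.filter (F ⊂ ·)) (fun K => mob R X K)]
  ring

theorem mul_of_quad {R : RkFn α} {X : Finset α} {x : Finset α → B}
    (hz : ∀ F, ¬ (R.Flat X F ∧ F.Nonempty) → x F = 0)
    (hq : ∀ F G, R.Flat X F → F.Nonempty → R.Flat X G → G.Nonempty →
      (gS x F - gS x (R.cl X (F ∪ G))) * (gS x G - gS x (R.cl X (F ∪ G))) = 0) :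
    ∀ F G, ¬ F ⊆ G → ¬ G ⊆ F → x F * x G = 0 := by
  intro F G
  generalize hN : 2 * Fintype.card α - (F.card + G.card) = N
  induction N using Nat.strong_induction_on generalizing F G with
  | _ N ih =>
    intro h1 h2
    by_cases hF : R.Flat X F ∧ F.Nonempty
    swap
    · rw [hz F hF, zero_mul]
    by_cases hG : R.Flat X G ∧ G.Nonempty
    swap
    · rw [hz G hG, mul_zero]
    have h := hq F G hF.1 hF.2 hG.1 hG.2
    set K := R.cl X (F ∪ G) with hK
    have hFGK : F ∪ G ⊆ K := R.subset_cl (Finset.union_subset hF.1.1 hG.1.1)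
    have hs : ∀ F', F' ⊆ K → gS x F' - gS x K = ∑ L with (F' ⊆ L ∧ ¬ K ⊆ L), x L := by
      intro F' hF'
      rw [sub_eq_iff_eq_add, gS, ← Finset.sum_filter_add_sum_filter_not _ (fun L => K ⊆ L),
        Finset.filter_filter, Finset.filter_filter, add_comm, gS]
      congr 2
      ext L; simp only [Finset.mem_filter, Finset.mem_univ, true_and]
      exact ⟨fun h => h.2, fun h => ⟨hF'.trans h, h⟩⟩
    rw [hs F (Finset.subset_union_left.trans hFGK), hs G (Finset.subset_union_right.trans hFGK),
      Finset.sum_mul_sum, Finset.sum_eq_single F, Finset.sum_eq_single G] at h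
    · exact h
    · intro L hL hLG
      obtain ⟨hL1, hL2⟩ := (Finset.mem_filter.1 hL).2
      by_cases hLf : R.Flat X L ∧ L.Nonempty
      swap
      · rw [hz L hLf, mul_zero]
      have hc := Finset.card_lt_card (hL1.ssubset_of_ne (Ne.symm hLG))
      have hc1 := Finset.card_le_univ L
      have hc2 := Finset.card_le_univ F
      refine ih _ ?_ F L rfl ?_ ?_
      · omega
      · intro hFL
        exact hL2 (R.cl_min hLf.1 (Finset.union_subset hFL hL1))
      · intro hLF
        exact h2 (hL1.trans hLF)
    · intro h'
      refine (h' (Finset.mem_filter.2 ⟨Finset.mem_univ _, le_rfl, fun h'' => ?_⟩)).elim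
      exact h1 ((Finset.subset_union_left.trans hFGK).trans h'')
    · intro L hL hLF
      refine Finset.sum_eq_zero fun L' hL' => ?_
      obtain ⟨hL1, hL2⟩ := (Finset.mem_filter.1 hL).2
      obtain ⟨hL1', hL2'⟩ := (Finset.mem_filter.1 hL').2
      by_cases hLf : R.Flat X L ∧ L.Nonempty
      swap
      · rw [hz L hLf, zero_mul]
      by_cases hLf' : R.Flat X L' ∧ L'.Nonempty
      swap
      · rw [hz L' hLf', mul_zero]
      have hc := Finset.card_lt_card (hL1.ssubset_of_ne (Ne.symm hLF))
      have hc' := Finset.card_le_card hL1'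
      have hc1 := Finset.card_le_univ L
      have hc2 := Finset.card_le_univ L'
      refine ih _ ?_ L L' rfl ?_ ?_
      · omega
      · intro hh
        exact hL2' (R.cl_min hLf'.1 (Finset.union_subset (hL1.trans hh) hL1'))
      · intro hh
        exact hL2 (R.cl_min hLf.1 (Finset.union_subset hL1 (hL1'.trans hh)))
    · intro h'
      refine (h' (Finset.mem_filter.2 ⟨Finset.mem_univ _, le_rfl, fun h'' => ?_⟩)).elim
      exact h2 ((Finset.subset_union_right.trans hFGK).trans h'')

theorem map_gS {B' : Type*} [CommRing B'] [Algebra ℝ B'] (f : B →ₐ[ℝ] B') (x : Finset α → B)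
    (S : Finset α) : gS (fun F => f (x F)) S = f (gS x S) := by
  simp only [gS, map_sum]

theorem mob_rel (R : RkFn α) (X : Finset α) (d : ℕ) :
    ChowRel R X (fun F => Ideal.Quotient.mkₐ ℝ (Jh R d) (mob R X F)) := by
  have hz : ∀ F, ¬ (R.Flat X F ∧ F.Nonempty) →
      (fun F => Ideal.Quotient.mkₐ ℝ (Jh R d) (mob R X F)) F = 0 := fun F h => by
    dsimp only; rw [mob_zero h, map_zero]
  refine ⟨hz, mul_of_quad hz ?_, ?_⟩
  · intro F G hF hF' hG hG'
    have hFG := Finset.union_subset hF.1 hG.1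
    have hsub := R.subset_cl hFG
    rw [map_gS, map_gS, map_gS, mob_sum ⟨hF, hF'⟩, mob_sum ⟨hG, hG'⟩,
      mob_sum ⟨R.flat_cl hFG, (hF'.mono Finset.subset_union_left).mono hsub⟩, ← map_sub, ← map_sub,
      ← map_mul]
    refine Ideal.Quotient.eq_zero_iff_mem.2 ?_
    have := quad_mem (R := R) (d := d) (F := F) (G := G) (K := R.cl X (F ∪ G))
      (fun T => R.r_cl_union hFG) (Finset.subset_union_left.trans hsub)
      (Finset.subset_union_right.trans hsub)
    convert this using 1
    ring
  · intro a ha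
    have ha' := Finset.singleton_subset_iff.2 ha
    have hcl := R.subset_cl ha'
    have e : ∑ F with a ∈ F, Ideal.Quotient.mkₐ ℝ (Jh R d) (mob R X F) =
        gS (fun F => Ideal.Quotient.mkₐ ℝ (Jh R d) (mob R X F)) (R.cl X {a}) := by
      rw [gS, Finset.sum_filter, Finset.sum_filter]
      refine Finset.sum_congr rfl fun F _ => ?_
      by_cases hF : R.Flat X F ∧ F.Nonempty
      · refine if_congr ?_ rfl rfl
        exact ⟨fun h => R.cl_min hF.1 (Finset.singleton_subset_iff.2 h),
          fun h => h (hcl (Finset.mem_singleton_self a))⟩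
      · have := hz F hF
        dsimp only at this
        rw [this]; simp
    rw [e, map_gS, mob_sum ⟨R.flat_cl ha', ⟨a, hcl (Finset.mem_singleton_self a)⟩⟩, map_neg,
      neg_eq_zero]
    refine Ideal.Quotient.eq_zero_iff_mem.2 (lin_mem ?_)
    rw [R.r_cl ha', R.loopless]

/-- the functional on the quotient by the annihilator -/
noncomputable def degQ (R : RkFn α) (d : ℕ) : (MvPolynomial (Finset α) ℝ ⧸ Jh R d) →ₗ[ℝ] ℝ :=
  Submodule.liftQ ((Jh R d).restrictScalars ℝ) (Dh R d) (by
      intro p hp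
      have := hp 1
      rw [mul_one] at this
      exact this)

/-- degree functional on the Chow ring -/
noncomputable def deg (R : RkFn α) (X : Finset α) : Chow R X →ₗ[ℝ] ℝ :=
  (degQ R (R.r X - 1)).comp ((Chow.lift (mob_rel R X (R.r X - 1))).toLinearMap)

theorem deg_eq {R : RkFn α} {X : Finset α} {y : Chow R X} {p : MvPolynomial (Finset α) ℝ}
    (h : Chow.lift (mob_rel R X (R.r X - 1)) y = Ideal.Quotient.mkₐ ℝ _ p) :
    deg R X y = Dh R (R.r X - 1) p := by
  change degQ R (R.r X - 1) (Chow.lift (mob_rel R X (R.r X - 1)) y) = _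
  rw [h]
  rfl

theorem deg_top {R : RkFn α} {X : Finset α} {d : ℕ} (hd : R.r X = d + 1) :
    deg R X (cx R X X ^ d) = (-1) ^ d := by
  classical
  have hXn : X.Nonempty := Finset.nonempty_iff_ne_empty.2 (by
    rintro rfl; rw [R.r_empty] at hd; omega)
  have e : mob R X X = - MvPolynomial.X X := by
    have := mob_sum (R := R) (X := X) (F := X) ⟨R.flat_self, hXn⟩
    rw [gS_eq, Finset.sum_eq_zero, add_zero] at this
    · exact this
    · intro K hK
      exact mob_zero fun h => (Finset.mem_filter.1 hK).2.2 h.1.1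
  rw [deg_eq (p := (-MvPolynomial.X X) ^ d) (by rw [map_pow, Chow.lift_cx, e, map_pow])]
  rw [neg_pow, show ((-1) ^ d * MvPolynomial.X X ^ d : MvPolynomial (Finset α) ℝ) =
    ((-1 : ℝ) ^ d) • MvPolynomial.monomial (Finsupp.single X d) 1 by
      rw [MvPolynomial.X_pow_eq_monomial, MvPolynomial.smul_eq_C_mul]; simp, map_smul,
      Dh_monomial, if_pos]
  · simp
  · refine ⟨by rw [Finsupp.degree_single]; omega, fun T hT => ?_⟩
    have : wt (Finsupp.single X d) T = if X ∈ T then d else 0 := by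
      simp only [wt, Finsupp.single_apply]; simp
    rw [this] at hT ⊢
    split_ifs at hT ⊢ with h
    · rw [← hd]; exact R.mono (Finset.le_sup (f := id) h)
    · omega

end
end AHK

namespace AHK
open Finset

section gen
variable {A : Type*} [CommRing A] [Algebra ℝ A]

theorem one_mem_pow_zero (V : Submodule ℝ A) : (1 : A) ∈ V ^ 0 := by
  rw [pow_zero]; exact Submodule.one_le.1 le_rfl

theorem pow_mul_mem {V : Submodule ℝ A} {m n : ℕ} {a b : A} (ha : a ∈ V ^ m) (hb : b ∈ V ^ n) :
    a * b ∈ V ^ (m + n) := by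
  rw [pow_add]; exact Submodule.mul_mem_mul ha hb

theorem mul_mem_pow_succ {V : Submodule ℝ A} {n : ℕ} {a b : A} (ha : a ∈ V) (hb : b ∈ V ^ n) :
    a * b ∈ V ^ (n + 1) := by
  rw [pow_succ']; exact Submodule.mul_mem_mul ha hb

theorem sup_pow_ind {I J : Submodule ℝ A} (n : ℕ) : ∀ (W : Submodule ℝ A),
    (∀ p q, p + q = n → ∀ u ∈ I ^ p, ∀ v ∈ J ^ q, u * v ∈ W) → ∀ y ∈ (I ⊔ J) ^ n, y ∈ W := by
  induction n with
  | zero =>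
    intro W h y hy
    rw [pow_zero] at hy
    have := h 0 0 rfl y (by rwa [pow_zero]) 1 (one_mem_pow_zero _)
    simpa using this
  | succ n ih =>
    intro W h y hy
    rw [pow_succ'] at hy
    refine Submodule.mul_induction_on hy ?_ (fun a b => W.add_mem)
    intro m hm z hz
    refine ih (W.comap (LinearMap.mulLeft ℝ m)) ?_ z hz
    intro p q hpq u hu v hv
    change m * (u * v) ∈ W
    obtain ⟨m1, hm1, m2, hm2, rfl⟩ := Submodule.mem_sup.1 hm
    rw [add_mul]
    refine W.add_mem ?_ ?_
    · rw [← mul_assoc]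
      exact h (p + 1) q (by omega) _ (mul_mem_pow_succ hm1 hu) v hv
    · rw [mul_left_comm]
      exact h p (q + 1) (by omega) _ hu _ (mul_mem_pow_succ hm2 hv)

theorem mod_span {S : Set A} {W : Submodule ℝ A} {z : A} (h : ∀ s ∈ S, ∃ w ∈ W, z * s = z * w) :
    ∀ v ∈ Submodule.span ℝ S, ∃ w ∈ W, z * v = z * w := by
  intro v hv
  induction hv using Submodule.span_induction with
  | mem s hs => exact h s hs
  | zero => exact ⟨0, W.zero_mem, rfl⟩
  | add a b _ _ ha hb =>
    obtain ⟨w, hw, e⟩ := ha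
    obtain ⟨w', hw', e'⟩ := hb
    exact ⟨w + w', W.add_mem hw hw', by rw [mul_add, mul_add, e, e']⟩
  | smul c a _ ha =>
    obtain ⟨w, hw, e⟩ := ha
    exact ⟨c • w, W.smul_mem _ hw, by rw [mul_smul_comm, mul_smul_comm, e]⟩

theorem mod_pow {V W : Submodule ℝ A} {z : A} (h : ∀ v ∈ V, ∃ w ∈ W, z * v = z * w) (n : ℕ) :
    ∀ v ∈ V ^ n, ∃ w ∈ W ^ n, z * v = z * w := by
  induction n with
  | zero => intro v hv; exact ⟨v, by simpa using hv, rfl⟩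
  | succ n ih =>
    intro v hv
    rw [pow_succ'] at hv
    refine Submodule.mul_induction_on hv ?_ ?_
    · intro m hm u hu
      obtain ⟨w, hw, e⟩ := h m hm
      obtain ⟨w', hw', e'⟩ := ih u hu
      refine ⟨w * w', mul_mem_pow_succ hw hw', ?_⟩
      linear_combination u * e + w * e'
    · rintro a b ⟨w, hw, e⟩ ⟨w', hw', e'⟩
      exact ⟨w + w', Submodule.add_mem _ hw hw', by rw [mul_add, mul_add, e, e']⟩

end gen

section
variable {α : Type*} [Fintype α] [DecidableEq α] {B : Type*} [CommRing B] [Algebra ℝ B]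
variable {R : RkFn α} {X Y : Finset α} {x : Finset α → B}

/-- generators of the restriction inside the big ring -/
def thx (Y : Finset α) (x : Finset α → B) (G : Finset α) : B :=
  if G = ∅ then 0 else ∑ K with K ∩ Y = G, x K

theorem thx_sum (P : Finset α → Prop) [DecidablePred P] (hP : ¬ P ∅) :
    ∑ G with P G, thx Y x G = ∑ K with P (K ∩ Y), x K := by
  have : ∀ G ∈ univ.filter P, thx Y x G = ∑ K with K ∩ Y = G, x K := by
    intro G hG
    rw [thx, if_neg]
    rintro rfl
    exact hP (Finset.mem_filter.1 hG).2
  rw [Finset.sum_congr rfl this]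
  rw [← Finset.sum_fiberwise_of_maps_to (s := univ.filter fun K => P (K ∩ Y)) (t := univ.filter P)
    (g := fun K => K ∩ Y) (fun K hK => by simpa using hK)]
  refine Finset.sum_congr rfl fun G hG => Finset.sum_congr ?_ fun _ _ => rfl
  ext K
  simp only [Finset.mem_filter, Finset.mem_univ, true_and]
  have := (Finset.mem_filter.1 hG).2
  constructor
  · rintro rfl; exact ⟨this, rfl⟩
  · exact fun h => h.2

theorem thx_rel (hx : ChowRel R X x) (hY : Y ⊆ X) : ChowRel R Y (thx Y x) where
  zero G hG := by
    rw [thx]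
    split_ifs with h
    · rfl
    · refine Finset.sum_eq_zero fun K hK => hx.zero K fun hf => hG ?_
      have := hf.1.inter hY
      rw [(Finset.mem_filter.1 hK).2] at this
      exact ⟨this, Finset.nonempty_iff_ne_empty.2 h⟩
  mul F G h1 h2 := by
    rw [thx, thx]
    split_ifs
    · simp
    · simp
    · simp
    · rw [Finset.sum_mul_sum]
      refine Finset.sum_eq_zero fun K hK => Finset.sum_eq_zero fun L hL => hx.mul K L ?_ ?_
      · intro h
        apply h1
        rw [← (Finset.mem_filter.1 hK).2, ← (Finset.mem_filter.1 hL).2]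
        exact Finset.inter_subset_inter_right h
      · intro h
        apply h2
        rw [← (Finset.mem_filter.1 hK).2, ← (Finset.mem_filter.1 hL).2]
        exact Finset.inter_subset_inter_right h
  lin a ha := by
    rw [thx_sum (fun G => a ∈ G) (Finset.notMem_empty a), ← hx.lin a (hY ha)]
    refine Finset.sum_congr ?_ fun _ _ => rfl
    ext K; simp [ha]

theorem gS_thx {S : Finset α} (hS : S.Nonempty) (hSY : S ⊆ Y) : gS (thx Y x) S = gS x S := by
  rw [gS, thx_sum (fun G => S ⊆ G) (fun h => hS.ne_empty (Finset.subset_empty.1 h)), gS]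
  refine Finset.sum_congr ?_ fun _ _ => rfl
  ext K; simp [Finset.subset_inter_iff, hSY]

/-- span of the generators -/
def Vx (x : Finset α → B) : Submodule ℝ B := Submodule.span ℝ (Set.range x)

theorem x_mem_Vx (F : Finset α) : x F ∈ Vx x := Submodule.subset_span ⟨F, rfl⟩

theorem Vx_eq (hx : ChowRel R X x) : Vx x = US x ∅ := by
  refine le_antisymm (Submodule.span_le.2 ?_) (Submodule.span_mono (Set.image_subset_range _ _))
  rintro _ ⟨F, rfl⟩
  rcases F.eq_empty_or_nonempty with rfl | h
  · rw [hx.zero ∅ (fun h => by simp at h)]; exact Submodule.zero_mem _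
  · exact US_mem (Finset.empty_ssubset.2 h)

theorem Vx_le_span_gS (hx : ChowRel R X x) :
    Vx x ≤ Submodule.span ℝ {y | ∃ S, S.Nonempty ∧ S ⊆ X ∧ y = gS x S} := by
  refine Submodule.span_le.2 ?_
  rintro _ ⟨F, rfl⟩
  generalize hN : Fintype.card α - F.card = N
  induction N using Nat.strong_induction_on generalizing F with
  | _ N ih =>
    by_cases hF : R.Flat X F ∧ F.Nonempty
    swap
    · rw [hx.zero F hF]; exact Submodule.zero_mem _
    have h1 := gS_eq (x := x) F
    rw [← sub_eq_iff_eq_add] at h1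
    rw [← h1]
    refine Submodule.sub_mem _ (Submodule.subset_span ⟨F, hF.2, hF.1.1, rfl⟩)
      (Submodule.sum_mem _ fun K hK => ?_)
    have h1 := Finset.card_lt_card (Finset.mem_filter.1 hK).2
    have h2 := Finset.card_le_univ K
    exact ih _ (by omega) K rfl

theorem Vx_pow_eq_zero (hx : ChowRel R X x) (hX : X.Nonempty) {n : ℕ} (hn : R.r X ≤ n) :
    ∀ u ∈ Vx x ^ n, u = 0 := by
  intro u hu
  rw [Vx_eq hx] at hu
  have := R1 hx R.flat_empty hX.ne_empty.symm (n := n) (by rw [R.r_empty]; omega) u hu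
  simpa [xb] using this

theorem Vx_top (hx : ChowRel R X x) {d : ℕ} (hd : R.r X = d + 1) :
    ∀ u ∈ Vx x ^ d, ∃ c : ℝ, u = c • x X ^ d := by
  intro u hu
  rw [Vx_eq hx] at hu
  have := topdim hx R.flat_empty (t := d) (by rw [R.r_empty]; omega) u hu
  simpa [xb] using this

theorem gS_mem_Vx (S : Finset α) : gS x S ∈ Vx x := Submodule.sum_mem _ fun F _ => x_mem_Vx F

theorem x_mul_gS (hx : ChowRel R X x) {H S : Finset α} (hSH : ¬ S ⊆ H) :
    ∃ w ∈ US x H, x H * gS x S = x H * w := by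
  refine ⟨∑ K with H ⊂ K ∧ S ⊆ K, x K, Submodule.sum_mem _ fun K hK =>
    US_mem (Finset.mem_filter.1 hK).2.1, ?_⟩
  rw [gS, ← Finset.sum_filter_add_sum_filter_not _ (fun L => H ⊂ L), mul_add,
    Finset.filter_filter, Finset.filter_filter]
  have : x H * ∑ K with S ⊆ K ∧ ¬ H ⊂ K, x K = 0 := by
    rw [Finset.mul_sum]
    refine Finset.sum_eq_zero fun K hK => hx.mul _ _ ?_ ?_
    · intro h
      have h2 := (Finset.mem_filter.1 hK).2
      rcases h.eq_or_ssubset with rfl | h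
      · exact hSH h2.1
      · exact h2.2 h
    · intro h
      exact hSH ((Finset.mem_filter.1 hK).2.1.trans h)
  rw [this, add_zero]
  congr 2
  ext K; simp [and_comm]

/-- Lemma Z -/
theorem lemZ (hx : ChowRel R X x) {F : Finset α} {i : α} (hF : R.Flat X F) (hFn : F.Nonempty)
    (hH : R.Flat X (insert i F)) (hiF : i ∉ F) (hHX : insert i F ≠ X) {m : ℕ}
    (hm : R.r X = m + 2) :
    ∀ b ∈ Vx (thx (X.erase i) x) ^ m, x (insert i F) * b = 0 := by
  have hx' := thx_rel hx (Finset.erase_subset i X)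
  have hxF := thx_rel hx hF.1
  have hHn : (insert i F).Nonempty := Finset.insert_nonempty _ _
  have hFH : F ⊂ insert i F := Finset.ssubset_insert hiF
  have hr1 := hF.lt_of_ssubset hH.1 hFH
  have hr2 := R.r_insert i F
  intro b hb
  have key : ∀ v ∈ Vx (thx (X.erase i) x), ∃ w ∈ US x (insert i F) ⊔ Vx (thx F x),
      x (insert i F) * v = x (insert i F) * w := by
    intro v hv
    refine mod_span ?_ v (Vx_le_span_gS hx' hv)
    rintro _ ⟨S, hSn, hS, rfl⟩
    rw [gS_thx hSn hS]
    by_cases hSF : S ⊆ F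
    · refine ⟨gS x S, Submodule.mem_sup_right ?_, rfl⟩
      rw [← gS_thx hSn hSF]
      exact gS_mem_Vx S
    · obtain ⟨w, hw, e⟩ := x_mul_gS hx (H := insert i F) (S := S) (by
        intro h
        apply hSF
        intro y hy
        rcases Finset.mem_insert.1 (h hy) with rfl | h'
        · exact ((Finset.mem_erase.1 (hS hy)).1 rfl).elim
        · exact h')
      exact ⟨w, Submodule.mem_sup_left hw, e⟩
  obtain ⟨w, hw, e⟩ := mod_pow key m b hb
  rw [e]
  have := sup_pow_ind m (LinearMap.ker (LinearMap.mulLeft ℝ (x (insert i F)))) ?_ w hw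
  · exact this
  intro p q hpq u hu v hv
  change x (insert i F) * (u * v) = 0
  by_cases hp : R.r X ≤ R.r (insert i F) + p
  · rw [← mul_assoc, R1x hx hH hHn hHX hp u hu, zero_mul]
  · rw [Vx_pow_eq_zero hxF hFn (n := q) (by omega) v hv]; simp

theorem thx_erase (hx : ChowRel R X x) {i : α} (hi : i ∈ X) {G : Finset α} (hG : G.Nonempty)
    (hiG : i ∉ G) (hGX : G ⊆ X) : thx (X.erase i) x G = x G + x (insert i G) := by
  rw [thx, if_neg hG.ne_empty, ← Finset.sum_pair (f := x) (a := G) (b := insert i G)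
    (by rintro h; rw [h] at hiG; exact hiG (Finset.mem_insert_self _ _))]
  symm
  refine Finset.sum_subset ?_ ?_
  · intro K hK
    simp only [Finset.mem_insert, Finset.mem_singleton] at hK
    simp only [Finset.mem_filter, Finset.mem_univ, true_and]
    rcases hK with rfl | rfl
    · ext y; simp only [Finset.mem_inter, Finset.mem_erase]
      constructor
      · exact fun h => h.1
      · exact fun h => ⟨h, fun e => hiG (e ▸ h), hGX h⟩
    · ext y; simp only [Finset.mem_inter, Finset.mem_erase, Finset.mem_insert]
      constructor
      · rintro ⟨h | h, h', -⟩
        · exact (h' h).elim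
        · exact h
      · exact fun h => ⟨Or.inr h, fun e => hiG (e ▸ h), hGX h⟩
  · intro K hK hK'
    refine hx.zero K fun hf => hK' ?_
    simp only [Finset.mem_filter, Finset.mem_univ, true_and] at hK
    have hKX := hf.1.1
    simp only [Finset.mem_insert, Finset.mem_singleton]
    by_cases hiK : i ∈ K
    · right
      rw [← hK]
      ext y
      simp only [Finset.mem_inter, Finset.mem_erase, Finset.mem_insert]
      constructor
      · intro h
        by_cases hy : y = i
        · exact Or.inl hy
        · exact Or.inr ⟨h, hy, hKX h⟩
      · rintro (rfl | h)
        · exact hiK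
        · exact h.1
    · left
      rw [← hK]
      ext y
      simp only [Finset.mem_inter, Finset.mem_erase]
      constructor
      · exact fun h => ⟨h, fun e => hiK (e ▸ h), hKX h⟩
      · exact fun h => h.1

theorem lemZ' (hx : ChowRel R X x) {i : α} (hi : i ∈ X) (τ : Finset (Finset α)) :
    ∀ (F₀ : Finset α) {m : ℕ}, (∀ F ∈ insert F₀ τ, R.Flat X F ∧ F.Nonempty ∧ i ∉ F ∧ insert i F ≠ X) →
    F₀ ∉ τ → R.r X = m + τ.card + 2 → ∀ b ∈ Vx (thx (X.erase i) x) ^ m,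
      (∏ F ∈ τ, x F) * x (insert i F₀) * b = 0 := by
  induction τ using Finset.induction_on with
  | empty =>
    intro F₀ m h hn hr b hb
    obtain ⟨h1, h2, h3, h4⟩ := h F₀ (Finset.mem_insert_self _ _)
    rw [Finset.prod_empty, one_mul]
    by_cases hH : R.Flat X (insert i F₀)
    · exact lemZ hx h1 h2 hH h3 h4 (by simpa using hr) b hb
    · rw [hx.zero _ (fun h => hH h.1), zero_mul]
  | insert G τ hG ih =>
    intro F₀ m h hn hr b hb
    obtain ⟨h1, h2, h3, h4⟩ := h F₀ (Finset.mem_insert_self _ _)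
    obtain ⟨g1, g2, g3, g4⟩ := h G (by simp)
    have hGF : G ≠ F₀ := by rintro rfl; exact hn (Finset.mem_insert_self _ _)
    rw [Finset.card_insert_of_notMem hG] at hr
    rw [Finset.prod_insert hG]
    have eG := thx_erase hx hi g2 g3 g1.1
    have eF := thx_erase hx hi h2 h3 h1.1
    have i1 := ih F₀ (m := m + 1) (fun F hF => h F (by
      rcases Finset.mem_insert.1 hF with h | h <;> simp [h])) (fun h => hn (by simp [h]))
      (by omega) (thx (X.erase i) x G * b) (mul_mem_pow_succ (x_mem_Vx G) hb)
    have i2 := ih G (m := m + 1) (fun F hF => h F (by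
      rcases Finset.mem_insert.1 hF with h | h <;> simp [h])) hG
      (by omega) (thx (X.erase i) x F₀ * b) (mul_mem_pow_succ (x_mem_Vx F₀) hb)
    by_cases c1 : F₀ ⊆ G
    · have : x G * x (insert i F₀) = 0 := by
        refine hx.mul _ _ ?_ ?_
        · intro hc
          apply hGF
          refine Finset.Subset.antisymm ?_ c1
          intro y hy
          rcases Finset.mem_insert.1 (hc hy) with rfl | h
          · exact (g3 hy).elim
          · exact h
        · intro hc
          exact g3 (hc (Finset.mem_insert_self _ _))
      linear_combination (∏ F ∈ τ, x F) * b * this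
    · by_cases c2 : G ⊆ F₀
      · have : x F₀ * x (insert i G) = 0 := by
          refine hx.mul _ _ ?_ ?_
          · intro hc
            apply hGF
            refine Finset.Subset.antisymm c2 ?_
            intro y hy
            rcases Finset.mem_insert.1 (hc hy) with rfl | h
            · exact (h3 hy).elim
            · exact h
          · intro hc
            exact h3 (hc (Finset.mem_insert_self _ _))
        rw [eG] at i1
        rw [eF] at i2
        linear_combination i1 - i2 + (∏ F ∈ τ, x F) * b * this
      · have : x (insert i F₀) * x (insert i G) = 0 := by
          refine hx.mul _ _ ?_ ?_
          · intro hc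
            apply c1
            intro y hy
            rcases Finset.mem_insert.1 (hc (Finset.mem_insert_of_mem hy)) with rfl | h
            · exact (h3 hy).elim
            · exact h
          · intro hc
            apply c2
            intro y hy
            rcases Finset.mem_insert.1 (hc (Finset.mem_insert_of_mem hy)) with rfl | h
            · exact (g3 hy).elim
            · exact h
        rw [eG] at i1
        linear_combination i1 - (∏ F ∈ τ, x F) * b * this

theorem thx_prod (hx : ChowRel R X x) {i : α} (hi : i ∈ X) (σ : Finset (Finset α)) :
    ∀ {m : ℕ}, (∀ F ∈ σ, R.Flat X F ∧ F.Nonempty ∧ i ∉ F ∧ insert i F ≠ X) →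
    R.r X = m + σ.card + 1 → ∀ b ∈ Vx (thx (X.erase i) x) ^ m,
      (∏ F ∈ σ, thx (X.erase i) x F) * b = (∏ F ∈ σ, x F) * b := by
  induction σ using Finset.induction_on with
  | empty => intros; simp
  | insert G τ hG ih =>
    intro m h hr b hb
    obtain ⟨g1, g2, g3, g4⟩ := h G (by simp)
    rw [Finset.card_insert_of_notMem hG] at hr
    rw [Finset.prod_insert hG, Finset.prod_insert hG]
    have eG := thx_erase hx hi g2 g3 g1.1
    have h1 := ih (m := m + 1) (fun F hF => h F (by simp [hF])) (by omega)
      (thx (X.erase i) x G * b) (mul_mem_pow_succ (x_mem_Vx G) hb)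
    have h2 := lemZ' hx hi τ G h hG (by omega) b hb
    rw [eG] at h1 ⊢
    linear_combination h1 + h2

/-! specialization to the Chow rings -/

/-- pullback along a restriction -/
noncomputable def theta (R : RkFn α) {X Y : Finset α} (hY : Y ⊆ X) : Chow R Y →ₐ[ℝ] Chow R X :=
  Chow.lift (thx_rel (chowRel_cx R X) hY)

theorem theta_cx (hY : Y ⊆ X) (G : Finset α) : theta R hY (cx R Y G) = thx Y (cx R X) G :=
  Chow.lift_cx _ G

/-- degree-one part of the Chow ring -/
noncomputable def CV (R : RkFn α) (X : Finset α) : Submodule ℝ (Chow R X) := Vx (cx R X)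

theorem theta_V (hY : Y ⊆ X) : (CV R Y).map (theta R hY).toLinearMap = Vx (thx Y (cx R X)) := by
  rw [CV, Vx, Submodule.map_span, ← Set.range_comp, Vx]
  congr 2
  funext G
  exact theta_cx hY G

theorem theta_V_pow (hY : Y ⊆ X) (n : ℕ) :
    (CV R Y ^ n).map (theta R hY).toLinearMap = Vx (thx Y (cx R X)) ^ n := by
  rw [Submodule.map_pow, theta_V]

theorem theta_mem (hY : Y ⊆ X) {n : ℕ} {b : Chow R Y} (hb : b ∈ CV R Y ^ n) :
    theta R hY b ∈ Vx (thx Y (cx R X)) ^ n := by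
  rw [← theta_V_pow hY]; exact ⟨b, hb, rfl⟩

theorem thx_le : Vx (thx Y x) ≤ Vx x := by
  refine Submodule.span_le.2 ?_
  rintro _ ⟨G, rfl⟩
  rw [thx]
  split_ifs
  · exact Submodule.zero_mem _
  · exact Submodule.sum_mem _ fun K _ => x_mem_Vx K

theorem deg_theta (hY : Y ⊆ X) {d : ℕ} (hd : R.r X = d + 1) (hd' : R.r Y = d + 1)
    {b : Chow R Y} (hb : b ∈ CV R Y ^ d) : deg R X (theta R hY b) = deg R Y b := by
  obtain ⟨c, rfl⟩ := Vx_top (chowRel_cx R Y) hd' b hb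
  have hYn : Y.Nonempty := Finset.nonempty_iff_ne_empty.2 (by
    rintro rfl; rw [R.r_empty] at hd'; omega)
  have e : theta R hY (cx R Y Y) = cx R X X := by
    have h1 := gS_top (thx_rel (chowRel_cx R X) hY)
    rw [gS_thx hYn le_rfl] at h1
    rw [theta_cx, ← h1, gS, Finset.sum_eq_single X]
    · intro K hK hKX
      refine (chowRel_cx R X).zero K fun hf => ?_
      have h2 := hf.1.lt_of_ssubset le_rfl (hf.1.1.ssubset_of_ne hKX)
      have h3 := R.mono (Finset.mem_filter.1 hK).2
      omega
    · intro h; exact (h (by simpa using hY)).elim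
  rw [map_smul, map_pow, e, map_smul, map_smul, deg_top hd, deg_top hd']

theorem deg_hyper {F : Finset α} (hF : R.Flat X F) {d : ℕ} (hd : R.r X = d + 2)
    (hd' : R.r F = d + 1) {b : Chow R F} (hb : b ∈ CV R F ^ d) :
    deg R X (cx R X F * theta R hF.1 b) = deg R F b := by
  obtain ⟨c, rfl⟩ := Vx_top (chowRel_cx R F) hd' b hb
  have hFn : F.Nonempty := Finset.nonempty_iff_ne_empty.2 (by
    rintro rfl; rw [R.r_empty] at hd'; omega)
  have hFX : F ⊂ X := hF.1.ssubset_of_ne (by rintro rfl; omega)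
  have hz : cx R X F * cx R X X = 0 := by
    have := R1x (chowRel_cx R X) hF hFn hFX.ne (n := 1) (by omega) (cx R X X)
      (by rw [pow_one]; exact US_mem hFX)
    exact this
  have e : theta R hF.1 (cx R F F) = cx R X F + cx R X X := by
    have h1 := gS_top (thx_rel (chowRel_cx R X) hF.1)
    rw [gS_thx hFn le_rfl] at h1
    rw [theta_cx, ← h1, gS_eq, Finset.sum_eq_single X]
    · intro K hK hKX
      refine (chowRel_cx R X).zero K fun hf => ?_
      have h2 := hf.1.lt_of_ssubset le_rfl (hf.1.1.ssubset_of_ne hKX)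
      have h3 := hF.lt_of_ssubset hf.1.1 (Finset.mem_filter.1 hK).2
      omega
    · intro h; exact (h (by simpa using hFX)).elim
  have e2 : ∀ n, cx R X F * (cx R X F + cx R X X) ^ n = cx R X F ^ (n + 1) := by
    intro n
    induction n with
    | zero => simp
    | succ n ih =>
      rw [pow_succ, ← mul_assoc, ih, mul_add, pow_succ (cx R X F) n, mul_assoc _ _ (cx R X X), hz]
      ring
  have e3 : cx R X F ^ (d + 1) = - cx R X X ^ (d + 1) := by
    have := two_term (chowRel_cx R X) R.flat_empty hF (Finset.empty_ssubset.2 hFn)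
      (r' := d + 1) (t := 0) (by rw [R.r_empty]; omega) (by omega)
    simpa [xb] using this
  rw [map_smul, map_pow, e, mul_smul_comm, e2, e3, map_smul, map_smul, map_neg,
    deg_top (d := d + 1) (by omega), deg_top hd']
  ring_nf

end
end AHK

namespace AHK
open Finset Matrix Filter Topology

theorem open_lem {ι κ : Type*} [Fintype ι] [Fintype κ] (q : ℝ → (ι → ℝ) → ℝ)
    (C : ℝ → (ι → ℝ) → (κ → ℝ))
    (hq : Continuous (Function.uncurry q)) (hC : Continuous (Function.uncurry C))
    (hq2 : ∀ (t c : ℝ) (v : ι → ℝ), q t (c • v) = c ^ 2 * q t v)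
    (hC1 : ∀ (t c : ℝ) (v : ι → ℝ), C t (c • v) = c • C t v)
    (t₀ : ℝ) (h : ∀ v, v ≠ 0 → C t₀ v = 0 → 0 < q t₀ v) :
    ∀ᶠ t in 𝓝 t₀, ∀ v, v ≠ 0 → C t v = 0 → 0 < q t v := by
  have hK : IsCompact (Metric.sphere (0 : ι → ℝ) 1) := isCompact_sphere _ _
  have := hK.eventually_forall_of_forall_eventually (x₀ := t₀)
    (P := fun t v => C t v ≠ 0 ∨ 0 < q t v) ?_
  · filter_upwards [this] with t ht v hv hCv
    have hn : 0 < ‖v‖ := norm_pos_iff.2 hv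
    have h1 := ht (‖v‖⁻¹ • v) (by
      rw [mem_sphere_zero_iff_norm, norm_smul, norm_inv, norm_norm, inv_mul_cancel₀ hn.ne'])
    rcases h1 with h1 | h1
    · rw [hC1, hCv, smul_zero] at h1; exact (h1 rfl).elim
    · rw [hq2] at h1
      exact (mul_pos_iff_of_pos_left (by positivity)).1 h1
  · intro v hv
    have hv0 : v ≠ 0 := by
      rintro rfl
      simp at hv
    by_cases hCv : C t₀ v = 0
    · have h1 := h v hv0 hCv
      have : ∀ᶠ z : ℝ × (ι → ℝ) in 𝓝 (t₀, v), 0 < Function.uncurry q z :=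
        hq.continuousAt.eventually (lt_mem_nhds (by exact h1))
      filter_upwards [this] with z hz
      exact Or.inr hz
    · have : ∀ᶠ z : ℝ × (ι → ℝ) in 𝓝 (t₀, v), Function.uncurry C z ≠ 0 :=
        hC.continuousAt.eventually_ne (by exact hCv)
      filter_upwards [this] with z hz
      exact Or.inl hz

/-- positivity on the primitive part, in coordinates -/
def Good {ι κ : Type*} [Fintype ι] [Fintype κ] (Q : Matrix ι ι ℝ) (L : Matrix ι κ ℝ) : Prop :=
  ∀ v : ι → ℝ, v ≠ 0 → (Lᵀ * Q) *ᵥ v = 0 → 0 < v ⬝ᵥ (Q *ᵥ v)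

theorem path_mat {ι κ : Type*} [Fintype ι] [Fintype κ] [DecidableEq κ]
    (Q : ℝ → Matrix ι ι ℝ) (L : ℝ → Matrix ι κ ℝ) (hQ : Continuous Q) (hL : Continuous L)
    (hs : ∀ t, (Q t)ᵀ = Q t)
    (hQn : ∀ t ∈ Set.Icc (0:ℝ) 1, ∀ v, Q t *ᵥ v = 0 → v = 0)
    (hRn : ∀ t ∈ Set.Icc (0:ℝ) 1, ∀ w, ((L t)ᵀ * Q t * L t) *ᵥ w = 0 → w = 0)
    (h0 : Good (Q 0) (L 0)) : Good (Q 1) (L 1) := by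
  classical
  set Rm : ℝ → Matrix κ κ ℝ := fun t => (L t)ᵀ * Q t * L t with hRm
  have hRc : Continuous Rm := (hL.matrix_transpose.matrix_mul hQ).matrix_mul hL
  set pr : ℝ → (ι → ℝ) → (ι → ℝ) := fun t v =>
    (Rm t).det • v - (L t * (Rm t).adjugate * ((L t)ᵀ * Q t)) *ᵥ v with hpr
  have hprc : ∀ v, Continuous fun t => pr t v := by
    intro v
    refine (hRc.matrix_det.smul continuous_const).sub ?_
    exact Continuous.matrix_mulVec ((hL.matrix_mul hRc.matrix_adjugate).matrix_mul
      (hL.matrix_transpose.matrix_mul hQ)) continuous_const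
  have hprim : ∀ t v, ((L t)ᵀ * Q t) *ᵥ pr t v = 0 := by
    intro t v
    simp only [hpr]
    rw [Matrix.mulVec_sub, Matrix.mulVec_smul, Matrix.mulVec_mulVec]
    have : (L t)ᵀ * Q t * (L t * (Rm t).adjugate * ((L t)ᵀ * Q t)) =
        (Rm t * (Rm t).adjugate) * ((L t)ᵀ * Q t) := by
      simp only [hRm, Matrix.mul_assoc]
    rw [this, Matrix.mul_adjugate, Matrix.smul_mul, Matrix.one_mul, Matrix.smul_mulVec, sub_self]
  have hdet : ∀ t ∈ Set.Icc (0:ℝ) 1, (Rm t).det ≠ 0 := by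
    intro t ht hd
    obtain ⟨w, hw, hw'⟩ := Matrix.exists_mulVec_eq_zero_iff.2 hd
    exact hw (hRn t ht w hw')
  have hiff : ∀ t ∈ Set.Icc (0:ℝ) 1,
      (Good (Q t) (L t) ↔ ∀ v, 0 ≤ pr t v ⬝ᵥ (Q t *ᵥ pr t v)) := by
    intro t ht
    constructor
    · intro hg v
      by_cases hv : pr t v = 0
      · rw [hv]; simp
      · exact (hg _ hv (hprim t v)).le
    · intro hg
      have hnn : ∀ v, ((L t)ᵀ * Q t) *ᵥ v = 0 → 0 ≤ v ⬝ᵥ (Q t *ᵥ v) := by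
        intro v hv
        have h1 := hg v
        have h2 : pr t v = (Rm t).det • v := by
          simp only [hpr]
          rw [← Matrix.mulVec_mulVec, hv]; simp
        rw [h2, Matrix.mulVec_smul, smul_dotProduct, dotProduct_smul, smul_eq_mul, smul_eq_mul,
          ← mul_assoc] at h1
        have h3 : 0 < (Rm t).det * (Rm t).det := mul_self_pos.2 (hdet t ht)
        exact (mul_nonneg_iff_of_pos_left h3).1 h1
      have hsym : ∀ u v, u ⬝ᵥ (Q t *ᵥ v) = v ⬝ᵥ (Q t *ᵥ u) := by
        intro u v
        rw [Matrix.dotProduct_mulVec, ← Matrix.mulVec_transpose, hs, dotProduct_comm]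
      intro v hv hCv
      refine lt_of_le_of_ne (hnn v hCv) fun h => hv (hQn t ht v ?_)
      have horth : ∀ u, ((L t)ᵀ * Q t) *ᵥ u = 0 → u ⬝ᵥ (Q t *ᵥ v) = 0 := by
        intro u hu
        have key : ∀ c : ℝ, 0 ≤ u ⬝ᵥ (Q t *ᵥ u) + 2 * c * (u ⬝ᵥ (Q t *ᵥ v)) := by
          intro c
          have := hnn (u + c • v) (by
            rw [Matrix.mulVec_add, Matrix.mulVec_smul, hu, hCv]; simp)
          rw [Matrix.mulVec_add, Matrix.mulVec_smul, add_dotProduct, dotProduct_add,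
            dotProduct_add, smul_dotProduct, smul_dotProduct, dotProduct_smul, dotProduct_smul,
            ← h, hsym v u] at this
          simp only [smul_eq_mul] at this
          linarith
        by_contra hne
        have := key (-(u ⬝ᵥ (Q t *ᵥ u) + 1) / (2 * (u ⬝ᵥ (Q t *ᵥ v))))
        have e : 2 * (-(u ⬝ᵥ (Q t *ᵥ u) + 1) / (2 * (u ⬝ᵥ (Q t *ᵥ v)))) * (u ⬝ᵥ (Q t *ᵥ v))
          = -(u ⬝ᵥ (Q t *ᵥ u) + 1) := by field_simp
        rw [e] at this
        linarith
      have hall : ∀ u, u ⬝ᵥ (Q t *ᵥ v) = 0 := by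
        intro u
        have h1 := horth (pr t u) (hprim t u)
        have hz : ∀ w, (L t *ᵥ w) ⬝ᵥ (Q t *ᵥ v) = 0 := by
          intro w
          rw [dotProduct_comm, Matrix.dotProduct_mulVec, ← Matrix.mulVec_transpose,
            Matrix.mulVec_mulVec, hCv, zero_dotProduct]
        simp only [hpr] at h1
        rw [sub_dotProduct, smul_dotProduct, Matrix.mul_assoc, ← Matrix.mulVec_mulVec, hz,
          sub_zero, smul_eq_mul] at h1
        exact (mul_eq_zero.1 h1).resolve_left (hdet t ht)
      funext i
      have := hall (Pi.single i 1)
      simpa using this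
  have hclosed : IsClosed {t | ∀ v, 0 ≤ pr t v ⬝ᵥ (Q t *ᵥ pr t v)} := by
    rw [Set.setOf_forall]
    refine isClosed_iInter fun v => isClosed_le continuous_const ?_
    exact Continuous.dotProduct (hprc v) (Continuous.matrix_mulVec hQ (hprc v))
  have hsub := IsClosed.Icc_subset_of_forall_mem_nhdsWithin (a := (0:ℝ)) (b := 1)
    (s := {t | ∀ v, 0 ≤ pr t v ⬝ᵥ (Q t *ᵥ pr t v)}) (hclosed.inter isClosed_Icc)
    ((hiff 0 (by simp)).1 h0) ?_
  · exact (hiff 1 (by simp)).2 (hsub (by simp))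
  · rintro t ⟨ht, ht'⟩
    have hg := (hiff t ⟨ht'.1, ht'.2.le⟩).2 ht
    have := open_lem (fun t v => v ⬝ᵥ (Q t *ᵥ v)) (fun t v => ((L t)ᵀ * Q t) *ᵥ v) ?_ ?_ ?_ ?_ t hg
    · have h1 : ∀ᶠ t' in 𝓝[>] t, t' ∈ Set.Icc (0:ℝ) 1 := by
        filter_upwards [Ioo_mem_nhdsGT ht'.2] with t' h
        exact ⟨ht'.1.trans h.1.le, h.2.le⟩
      filter_upwards [nhdsWithin_le_nhds this, h1] with t' h2 h3
      exact (hiff t' h3).1 h2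
    · exact Continuous.dotProduct continuous_snd
        (Continuous.matrix_mulVec (hQ.comp continuous_fst) continuous_snd)
    · exact (Continuous.matrix_mulVec ((hL.matrix_transpose.matrix_mul hQ).comp continuous_fst)
        continuous_snd)
    · intro t c v
      simp only [Matrix.mulVec_smul, smul_dotProduct, dotProduct_smul, smul_eq_mul]; ring
    · intro t c v
      simp only [Matrix.mulVec_smul]

end AHK

namespace AHK
open Finset Matrix Filter Topology

section abstractHR
variable {A : Type*} [CommRing A] [Algebra ℝ A]

/-- the piece of degree one lower (zero if there is none) -/
def Wm (V : Submodule ℝ A) : ℕ → Submodule ℝ A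
  | 0 => ⊥
  | j + 1 => V ^ j

def HRk (V : Submodule ℝ A) (D : A →ₗ[ℝ] ℝ) (k m : ℕ) (l : A) : Prop :=
  ∀ a ∈ V ^ k, (∀ b ∈ Wm V k, D (l ^ (m + 1) * (a * b)) = 0) →
    (∃ b ∈ V ^ (k + m), D (a * b) ≠ 0) → 0 < (-1) ^ k * D (l ^ m * (a * a))

def HR (V : Submodule ℝ A) (D : A →ₗ[ℝ] ℝ) (n : ℕ) (l : A) : Prop :=
  ∀ k m, 2 * k + m = n → HRk V D k m l

def HLk (V : Submodule ℝ A) (D : A →ₗ[ℝ] ℝ) (k m : ℕ) (l : A) : Prop :=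
  ∀ a ∈ V ^ k, (∀ b ∈ V ^ k, D (l ^ m * (a * b)) = 0) → ∀ b ∈ V ^ (k + m), D (a * b) = 0

theorem mul_Wm {V : Submodule ℝ A} {l : A} (hl : l ∈ V) {k : ℕ} {b : A} (hb : b ∈ Wm V k) :
    l * b ∈ V ^ k := by
  cases k with
  | zero => rw [Wm, Submodule.mem_bot] at hb; subst hb; simp
  | succ j => rw [pow_succ']; exact Submodule.mul_mem_mul hl hb

theorem HRk.hl {V : Submodule ℝ A} {D : A →ₗ[ℝ] ℝ} {k m : ℕ} {l : A} (hl : l ∈ V)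
    (h : HRk V D k m l) : HLk V D k m l := by
  intro a ha hab b hb
  by_contra hne
  have h1 := h a ha ?_ ⟨b, hb, hne⟩
  · rw [hab a ha] at h1; simp at h1
  · intro c hc
    have := hab (l * c) (mul_Wm hl hc)
    rw [← this]; congr 1; ring

theorem coords (U N : Submodule ℝ A) [FiniteDimensional ℝ U] :
    ∃ (p : ℕ) (e : Fin p → A), (∀ i, e i ∈ U) ∧ (∀ a ∈ U, ∃ v : Fin p → ℝ, a - ∑ i, v i • e i ∈ N) ∧
      (∀ v : Fin p → ℝ, ∑ i, v i • e i ∈ N → v = 0) := by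
  let N' := N.comap U.subtype
  let B := Module.finBasis ℝ (U ⧸ N')
  choose e he using fun i => Submodule.mkQ_surjective N' (B i)
  refine ⟨_, fun i => (e i : A), fun i => (e i).2, ?_, ?_⟩
  · intro a ha
    refine ⟨fun i => B.repr (N'.mkQ ⟨a, ha⟩) i, ?_⟩
    have h1 : N'.mkQ (⟨a, ha⟩ - ∑ i, B.repr (N'.mkQ ⟨a, ha⟩) i • e i) = 0 := by
      rw [map_sub, map_sum]
      simp only [map_smul, he]
      rw [B.sum_repr, sub_self]
    rw [Submodule.mkQ_apply, Submodule.Quotient.mk_eq_zero] at h1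
    have h2 : U.subtype (⟨a, ha⟩ - ∑ i, B.repr (N'.mkQ ⟨a, ha⟩) i • e i) ∈ N := h1
    simpa using h2
  · intro v hv
    have h1 : N'.mkQ (∑ i, v i • e i) = 0 := by
      rw [Submodule.mkQ_apply, Submodule.Quotient.mk_eq_zero]
      show U.subtype _ ∈ N
      simpa using hv
    rw [map_sum] at h1
    simp only [map_smul, he] at h1
    funext i
    exact Fintype.linearIndependent_iff.1 B.linearIndependent v h1 i

/-- the radical against a submodule -/
def radD (D : A →ₗ[ℝ] ℝ) (U : Submodule ℝ A) : Submodule ℝ A where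
  carrier := {a | ∀ b ∈ U, D (a * b) = 0}
  add_mem' := by
    intro a b ha hb c hc
    rw [add_mul, map_add, ha c hc, hb c hc, add_zero]
  zero_mem' := by intro c _; simp
  smul_mem' := by
    intro r a ha c hc
    rw [smul_mul_assoc, map_smul, ha c hc, smul_zero]

theorem mem_radD {D : A →ₗ[ℝ] ℝ} {U : Submodule ℝ A} {a : A} :
    a ∈ radD D U ↔ ∀ b ∈ U, D (a * b) = 0 := Iff.rfl

theorem cont_pow (D : A →ₗ[ℝ] ℝ) (u v : A) (m : ℕ) :
    ∀ x, Continuous fun t : ℝ => D ((u + t • v) ^ m * x) := by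
  induction m with
  | zero => intro x; simp only [pow_zero]; exact continuous_const
  | succ m ih =>
    intro x
    have : (fun t : ℝ => D ((u + t • v) ^ (m + 1) * x)) =
        fun t : ℝ => D ((u + t • v) ^ m * (u * x)) + t * D ((u + t • v) ^ m * (v * x)) := by
      funext t
      rw [← smul_eq_mul (a := t), ← map_smul, ← map_add]
      congr 1
      simp only [Algebra.smul_def]
      ring
    rw [this]
    exact (ih _).add (continuous_id.mul (ih _))

theorem lin_pow_mem {V : Submodule ℝ A} {l : A} (hl : l ∈ V) (m : ℕ) : l ^ m ∈ V ^ m :=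
  Submodule.pow_mem_pow V hl m

theorem path_HR {V : Submodule ℝ A} {D : A →ₗ[ℝ] ℝ} (hfin : ∀ k, FiniteDimensional ℝ (V ^ k : Submodule ℝ A))
    {l₀ l₁ : A} (h₀ : l₀ ∈ V) (h₁ : l₁ ∈ V) {k m : ℕ}
    (hHL : ∀ t ∈ Set.Icc (0:ℝ) 1, HLk V D k m (l₀ + t • (l₁ - l₀)))
    (hHL' : ∀ t ∈ Set.Icc (0:ℝ) 1, ∀ j, k = j + 1 → HLk V D j (m + 2) (l₀ + t • (l₁ - l₀)))
    (h : HRk V D k m l₀) : HRk V D k m l₁ := by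
  have hW : FiniteDimensional ℝ (Wm V k) := by
    cases k with
    | zero => show FiniteDimensional ℝ (⊥ : Submodule ℝ A); infer_instance
    | succ j => exact hfin j
  have := hfin k
  set N := radD D (V ^ (k + m)) with hN
  set N' := radD D (V ^ (k + m + 1)) with hN'
  obtain ⟨p, e, heU, hec, hei⟩ := coords (V ^ k) N
  obtain ⟨p', f, hfU, hfc, hfi⟩ := coords (Wm V k) N'
  set l : ℝ → A := fun t => l₀ + t • (l₁ - l₀) with hl
  have hlV : ∀ t, l t ∈ V := fun t => V.add_mem h₀ (V.smul_mem t (V.sub_mem h₁ h₀))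
  choose L0 hL0 using fun j => hec (l₀ * f j) (mul_Wm h₀ (hfU j))
  choose L1 hL1 using fun j => hec (l₁ * f j) (mul_Wm h₁ (hfU j))
  let E : (Fin p → ℝ) →ₗ[ℝ] A := Fintype.linearCombination ℝ e
  let F : (Fin p' → ℝ) →ₗ[ℝ] A := Fintype.linearCombination ℝ f
  have hE : ∀ v, E v = ∑ i, v i • e i := fun v => Fintype.linearCombination_apply ℝ e v
  have hF : ∀ v, F v = ∑ i, v i • f i := fun v => Fintype.linearCombination_apply ℝ f v
  have hEm : ∀ v, E v ∈ V ^ k := fun v => by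
    rw [hE]; exact Submodule.sum_mem _ fun i _ => Submodule.smul_mem _ _ (heU i)
  have hFm : ∀ v, F v ∈ Wm V k := fun v => by
    rw [hF]; exact Submodule.sum_mem _ fun i _ => Submodule.smul_mem _ _ (hfU i)
  let Q : ℝ → Matrix (Fin p) (Fin p) ℝ := fun t => Matrix.of fun i j => (-1) ^ k * D (l t ^ m * (e i * e j))
  let L : ℝ → Matrix (Fin p) (Fin p') ℝ := fun t => Matrix.of fun i j => L0 j i + t * (L1 j i - L0 j i)
  have hQ : ∀ t u v, u ⬝ᵥ (Q t *ᵥ v) = (-1) ^ k * D (l t ^ m * (E u * E v)) := by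
    intro t u v
    rw [hE, hE]
    simp only [dotProduct, Matrix.mulVec, Q, Matrix.of_apply, Finset.sum_mul, Finset.mul_sum,
      map_sum, smul_mul_assoc, mul_smul_comm, map_smul, smul_eq_mul]
    rw [Finset.sum_comm]
    refine Finset.sum_congr rfl fun i _ => Finset.sum_congr rfl fun j _ => ?_
    ring
  have hLw : ∀ t w, l t * F w - E (L t *ᵥ w) ∈ N := by
    intro t w
    have e1 : l t * F w - E (L t *ᵥ w) = ∑ j, w j • ((l₀ * f j - ∑ i, L0 j i • e i) +
        t • ((l₁ * f j - ∑ i, L1 j i • e i) - (l₀ * f j - ∑ i, L0 j i • e i))) := by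
      have e2 : E (L t *ᵥ w) = ∑ j, w j • (∑ i, L0 j i • e i + t • (∑ i, L1 j i • e i - ∑ i, L0 j i • e i)) := by
        rw [hE]
        simp only [dotProduct, Matrix.mulVec, L, Matrix.of_apply, Finset.smul_sum, Finset.sum_smul,
          ← Finset.sum_sub_distrib, ← Finset.sum_add_distrib]
        rw [Finset.sum_comm]
        refine Finset.sum_congr rfl fun i _ => Finset.sum_congr rfl fun j _ => ?_
        simp only [smul_sub, smul_add, smul_smul, ← sub_smul, ← add_smul]
        congr 1; ring
      rw [e2, hF, Finset.mul_sum, ← Finset.sum_sub_distrib]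
      refine Finset.sum_congr rfl fun j _ => ?_
      simp only [hl]
      rw [mul_smul_comm, ← smul_sub]
      congr 1
      simp only [smul_sub, add_mul, smul_mul_assoc, sub_mul]
      abel
    rw [e1]
    exact Submodule.sum_mem _ fun j _ => Submodule.smul_mem _ _ (Submodule.add_mem _ (hL0 j)
      (Submodule.smul_mem _ _ (Submodule.sub_mem _ (hL1 j) (hL0 j))))
  have hpm : ∀ t, ∀ a ∈ V ^ k, l t ^ m * a ∈ V ^ (k + m) := by
    intro t a ha
    rw [add_comm, pow_add]; exact Submodule.mul_mem_mul (lin_pow_mem (hlV t) m) ha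
  have hpm' : ∀ t, ∀ a ∈ V ^ k, l t ^ (m + 1) * a ∈ V ^ (k + m + 1) := by
    intro t a ha
    rw [add_assoc, add_comm, pow_add]; exact Submodule.mul_mem_mul (lin_pow_mem (hlV t) _) ha
  have hLQ : ∀ t v w, (L t *ᵥ w) ⬝ᵥ (Q t *ᵥ v) = (-1) ^ k * D (l t ^ (m + 1) * (E v * F w)) := by
    intro t v w
    rw [hQ]
    have h1 := hLw t w _ (hpm t _ (hEm v))
    rw [sub_mul, map_sub, sub_eq_zero] at h1
    congr 1
    rw [show l t ^ m * (E (L t *ᵥ w) * E v) = E (L t *ᵥ w) * (l t ^ m * E v) by ring, ← h1]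
    congr 1; ring
  have hLQ0 : ∀ t v, ((L t)ᵀ * Q t) *ᵥ v = 0 ↔ ∀ b ∈ Wm V k, D (l t ^ (m + 1) * (E v * b)) = 0 := by
    intro t v
    have h1 : ∀ w, w ⬝ᵥ (((L t)ᵀ * Q t) *ᵥ v) = (-1) ^ k * D (l t ^ (m + 1) * (E v * F w)) := by
      intro w
      rw [← hLQ, ← Matrix.mulVec_mulVec, Matrix.dotProduct_mulVec, Matrix.vecMul_transpose]
    constructor
    · intro h2 b hb
      obtain ⟨w, hw⟩ := hfc b hb
      have h3 := h1 w
      rw [h2, dotProduct_zero] at h3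
      have h4 := hw _ (hpm' t _ (hEm v))
      rw [← hF, sub_mul, map_sub, sub_eq_zero] at h4
      have h5 : D (l t ^ (m + 1) * (E v * F w)) = 0 := by
        rcases mul_eq_zero.1 h3.symm with h | h
        · exact absurd h (pow_ne_zero _ (by norm_num))
        · exact h
      rw [show l t ^ (m + 1) * (E v * b) = b * (l t ^ (m + 1) * E v) by ring, h4, ← h5]
      congr 1; ring
    · intro h2
      funext i
      have := h1 (Pi.single i 1)
      rw [h2 _ (hFm _)] at this
      simpa using this
  have hgood : ∀ t, Good (Q t) (L t) ↔ HRk V D k m (l t) := by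
    intro t
    constructor
    · intro hg a ha hab hb
      obtain ⟨v, hv⟩ := hec a ha
      rw [← hE] at hv
      have hsub : ∀ c ∈ V ^ (k + m), D (a * c) = D (E v * c) := by
        intro c hc
        have := hv c hc
        rwa [sub_mul, map_sub, sub_eq_zero] at this
      have h1 := hg v ?_ ?_
      · rw [hQ] at h1
        rw [show l t ^ m * (a * a) = a * (l t ^ m * a) by ring, hsub _ (hpm t a ha),
          show E v * (l t ^ m * a) = a * (l t ^ m * E v) by ring, hsub _ (hpm t _ (hEm v)),
          show E v * (l t ^ m * E v) = l t ^ m * (E v * E v) by ring]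
        exact h1
      · rintro rfl
        obtain ⟨b, hb, hb'⟩ := hb
        rw [hsub b hb] at hb'
        simp at hb'
      · rw [hLQ0]
        intro b hb
        rw [← hab b hb]
        have := hsub (l t ^ (m + 1) * b) ?_
        · rw [show l t ^ (m + 1) * (E v * b) = E v * (l t ^ (m + 1) * b) by ring, ← this]
          congr 1; ring
        · have := hpm t _ (mul_Wm (hlV t) hb)
          rwa [← mul_assoc, ← pow_succ] at this
    · intro hg v hv hLv
      rw [hQ]
      refine hg _ (hEm v) ((hLQ0 t v).1 hLv) ?_
      by_contra hcon
      push Not at hcon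
      refine hv (hei v ?_)
      rw [← hE]; exact hcon
  have hfinal := path_mat Q L ?_ ?_ ?_ ?_ ?_ ((hgood 0).2 (by simpa [hl] using h))
  · have := (hgood 1).1 hfinal
    simpa [hl] using this
  · refine continuous_matrix fun i j => ?_
    exact continuous_const.mul (cont_pow D _ _ _ _)
  · refine continuous_matrix fun i j => ?_
    exact continuous_const.add (continuous_id.mul continuous_const)
  · intro t
    ext i j
    simp only [Matrix.transpose_apply, Q, Matrix.of_apply]
    rw [mul_comm (e i)]
  · intro t ht v hv
    refine hei v ?_
    rw [← hE]
    refine hHL t ht (E v) (hEm v) ?_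
    intro b hb
    obtain ⟨w, hw⟩ := hec b hb
    have h1 := hw _ (hpm t _ (hEm v))
    rw [← hE, sub_mul, map_sub, sub_eq_zero] at h1
    have h2 := hQ t w v
    rw [hv, dotProduct_zero] at h2
    have h5 : D (l t ^ m * (E w * E v)) = 0 := by
      rcases mul_eq_zero.1 h2.symm with h | h
      · exact absurd h (pow_ne_zero _ (by norm_num))
      · exact h
    show D (l t ^ m * (E v * b)) = 0
    rw [show l t ^ m * (E v * b) = b * (l t ^ m * E v) by ring, h1, ← h5]
    congr 1; ring
  · intro t ht w hw
    refine hfi w ?_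
    rw [← hF]
    rw [← Matrix.mulVec_mulVec] at hw
    have h1 := (hLQ0 t _).1 hw
    have hz : ∀ b ∈ Wm V k, D (l t ^ (m + 2) * (F w * b)) = 0 := by
      intro b hb
      have h2 := hpm t _ (mul_Wm (hlV t) hb)
      rw [← mul_assoc, ← pow_succ] at h2
      have h3 := hLw t w _ h2
      rw [sub_mul, map_sub, sub_eq_zero] at h3
      rw [show l t ^ (m + 2) * (F w * b) = l t * F w * (l t ^ (m + 1) * b) by ring, h3,
        ← h1 b hb]
      congr 1; ring
    have hFw := hFm w
    clear_value E F Q L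
    cases k with
    | zero =>
      rw [Wm, Submodule.mem_bot] at hFw
      rw [hFw]; exact Submodule.zero_mem _
    | succ j =>
      have := hHL' t ht j rfl (F w) hFw hz
      intro b hb
      refine this b ?_
      rwa [show j + (m + 2) = j + 1 + m + 1 by ring]

end abstractHR
end AHK

namespace AHK
open Finset Matrix Filter Topology

section abstractHR
variable {A : Type*} [CommRing A] [Algebra ℝ A]

/-- the functional `p ↦ D (z * p)` -/
noncomputable def mD (D : A →ₗ[ℝ] ℝ) (z : A) : A →ₗ[ℝ] ℝ := D ∘ₗ LinearMap.mulLeft ℝ z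

@[simp] theorem mD_apply (D : A →ₗ[ℝ] ℝ) (z p : A) : mD D z p = D (z * p) := rfl

theorem mem_of_add {V : Submodule ℝ A} {i j n : ℕ} {a b : A} (ha : a ∈ V ^ i) (hb : b ∈ V ^ j)
    (h : i + j = n) : a * b ∈ V ^ n := by
  subst h; rw [pow_add]; exact Submodule.mul_mem_mul ha hb

theorem Wm_mul {V : Submodule ℝ A} {i j n : ℕ} {a b : A} (ha : a ∈ Wm V i) (hb : b ∈ V ^ j)
    (h : i + j = n) : a * b ∈ Wm V n := by
  subst h
  cases i with
  | zero => rw [Wm, Submodule.mem_bot] at ha; subst ha; simp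
  | succ i =>
    rw [show i + 1 + j = i + j + 1 by ring]
    exact mem_of_add ha hb rfl

theorem Wm_mono {V V' : Submodule ℝ A} (h : V' ≤ V) (k : ℕ) : Wm V' k ≤ Wm V k := by
  cases k with
  | zero => exact le_rfl
  | succ k => exact pow_le_pow_left' h k

theorem Wm_zero {V : Submodule ℝ A} {a : A} (h : a ∈ Wm V 0) : a = 0 := by
  rwa [Wm, Submodule.mem_bot] at h

theorem HR_transfer {A' : Type*} [CommRing A'] [Algebra ℝ A'] {V : Submodule ℝ A}
    {V' : Submodule ℝ A'} {D : A →ₗ[ℝ] ℝ} {D' : A' →ₗ[ℝ] ℝ} (φ : A' →ₐ[ℝ] A) {n : ℕ} {l : A}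
    {l' : A'} (hV : ∀ v ∈ V', φ v ∈ V)
    (hgen : ∀ k, ∀ a ∈ V ^ k, ∃ a' ∈ V' ^ k, ∀ b, D (a * b) = D (φ a' * b))
    (hD : ∀ b ∈ V' ^ n, D' b = D (φ b)) (hl : ∀ b, D (l * b) = D (φ l' * b)) (hl' : l' ∈ V')
    (h : HR V' D' n l') : HR V D n l := by
  have hVk : ∀ k, ∀ v ∈ V' ^ k, φ v ∈ V ^ k := by
    intro k v hv
    have h1 : V'.map φ.toLinearMap ≤ V := by
      rintro _ ⟨v, hv, rfl⟩; exact hV v hv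
    have h2 : φ v ∈ (V' ^ k).map φ.toLinearMap := ⟨v, hv, rfl⟩
    rw [Submodule.map_pow] at h2
    exact pow_le_pow_left' h1 k h2
  have hWk : ∀ k, ∀ v ∈ Wm V' k, φ v ∈ Wm V k := by
    intro k v hv
    cases k with
    | zero => rw [Wm_zero hv, map_zero]; exact Submodule.zero_mem _
    | succ k => exact hVk k v hv
  have hlp : ∀ j b, D (l ^ j * b) = D (φ l' ^ j * b) := by
    intro j
    induction j with
    | zero => intro b; simp
    | succ j ih =>
      intro b
      rw [pow_succ, mul_assoc, ih, show φ l' ^ j * (l * b) = l * (φ l' ^ j * b) by ring, hl]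
      congr 1; ring
  intro k m hkm a ha hab hb
  obtain ⟨a', ha', haa⟩ := hgen k a ha
  have haa2 : ∀ b, D (b * a) = D (b * φ a') := by
    intro b; rw [mul_comm, haa, mul_comm]
  have h1 := h k m hkm a' ha' ?_ ?_
  · rw [hlp, show φ l' ^ m * (a * a) = a * (φ l' ^ m * a) by ring, haa,
      show φ a' * (φ l' ^ m * a) = a * (φ a' * φ l' ^ m) by ring, haa]
    rw [hD _ (mem_of_add (lin_pow_mem hl' m) (mem_of_add ha' ha' rfl) (by omega))] at h1
    simp only [map_mul, map_pow] at h1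
    convert h1 using 3; ring
  · intro b hb
    have h2 : l' ^ (m + 1) * (a' * b) ∈ V' ^ n := by
      cases k with
      | zero => rw [Wm_zero hb]; simp
      | succ j =>
        exact mem_of_add (lin_pow_mem hl' (m + 1)) (mem_of_add ha' (show b ∈ V' ^ j from hb) rfl)
          (by omega)
    rw [hD _ h2]
    simp only [map_mul, map_pow]
    rw [← hlp, show l ^ (m + 1) * (φ a' * φ b) = φ a' * (l ^ (m + 1) * φ b) by ring, ← haa,
      ← hab (φ b) (hWk k b hb)]
    congr 1; ring
  · obtain ⟨b, hb, hne⟩ := hb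
    obtain ⟨b', hb', hbb⟩ := hgen _ b hb
    refine ⟨b', hb', ?_⟩
    rw [hD _ (mem_of_add ha' hb' (by omega)), map_mul, mul_comm, ← hbb, mul_comm, ← haa]
    exact hne

theorem HL_step {V : Submodule ℝ A} {D : A →ₗ[ℝ] ℝ} {ι : Type*} (S : Finset ι) (x : ι → A)
    {n : ℕ} {l : A} (hx : ∀ G ∈ S, x G ∈ V)
    (hE : ∀ G ∈ S, HR V (mD D (x G)) n l)
    (hgen : ∀ v ∈ V, ∃ c : ι → ℝ, ∀ p, D (v * p) = ∑ G ∈ S, c G * D (x G * p))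
    (hpos : ∀ G₀ ∈ S, ∃ c : ι → ℝ, (∀ G ∈ S, 0 ≤ c G) ∧ 0 < c G₀ ∧
      ∀ p, D (l * p) = ∑ G ∈ S, c G * D (x G * p)) (hl : l ∈ V)
    {k m : ℕ} (hkm : 2 * k + m = n + 1) : HLk V D k m l := by
  intro a ha hab
  cases m with
  | zero =>
    intro b hb
    have := hab b (by simpa using hb)
    simpa using this
  | succ m =>
    have hdich : ∀ G ∈ S, (∀ b ∈ V ^ (k + m), D (x G * (a * b)) = 0) ∨
        0 < (-1) ^ k * D (x G * (l ^ m * (a * a))) := by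
      intro G hG
      by_cases hb : ∃ b ∈ V ^ (k + m), mD D (x G) (a * b) ≠ 0
      · right
        refine hE G hG k m (by omega) a ha ?_ hb
        intro b hb
        rw [← hab (x G * b) (mul_Wm (hx G hG) hb), mD_apply]
        congr 1; ring
      · left
        push Not at hb
        exact hb
    have hnn : ∀ G ∈ S, 0 ≤ (-1) ^ k * D (x G * (l ^ m * (a * a))) := by
      intro G hG
      rcases hdich G hG with h | h
      · have := h (l ^ m * a) (mem_of_add (lin_pow_mem hl m) ha (by omega))
        rw [show x G * (l ^ m * (a * a)) = x G * (a * (l ^ m * a)) by ring, this, mul_zero]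
      · exact h.le
    have hrad : ∀ G ∈ S, ∀ b ∈ V ^ (k + m), D (x G * (a * b)) = 0 := by
      intro G₀ hG₀
      rcases hdich G₀ hG₀ with h | h
      · exact h
      · exfalso
        obtain ⟨c, hc0, hcp, hc⟩ := hpos G₀ hG₀
        have h1 := hc (l ^ m * (a * a))
        have h2 : D (l * (l ^ m * (a * a))) = 0 := by
          rw [← hab a ha]; congr 1; ring
        rw [h2] at h1
        have h3 : 0 < ∑ G ∈ S, c G * ((-1) ^ k * D (x G * (l ^ m * (a * a)))) :=
          Finset.sum_pos' (fun G hG => mul_nonneg (hc0 G hG) (hnn G hG))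
            ⟨G₀, hG₀, mul_pos hcp h⟩
        have h4 : ∑ G ∈ S, c G * ((-1) ^ k * D (x G * (l ^ m * (a * a)))) =
            (-1) ^ k * ∑ G ∈ S, c G * D (x G * (l ^ m * (a * a))) := by
          rw [Finset.mul_sum]; exact Finset.sum_congr rfl fun _ _ => by ring
        rw [h4, ← h1, mul_zero] at h3
        exact lt_irrefl _ h3
    intro b hb
    rw [show k + (m + 1) = (k + m) + 1 by ring, pow_succ'] at hb
    refine Submodule.mul_induction_on hb ?_ ?_
    · intro v hv b' hb'
      obtain ⟨c, hc⟩ := hgen v hv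
      rw [show a * (v * b') = v * (a * b') by ring, hc]
      exact Finset.sum_eq_zero fun G hG => by rw [hrad G hG b' hb', mul_zero]
    · intro b b' h h'
      rw [mul_add, map_add, h, h', add_zero]

theorem SS_expand {V' : Submodule ℝ A} {D : A →ₗ[ℝ] ℝ} {ι : Type*} [DecidableEq ι] (S : Finset ι)
    (x : ι → A) (E : ι → A →ₗ[ℝ] ℝ) {n : ℕ}
    (o2 : ∀ j ∈ S, ∀ b ∈ Wm V' n, D (x j * b) = 0)
    (o3 : ∀ i ∈ S, ∀ j ∈ S, i ≠ j → ∀ n', n' + 2 = n → ∀ b ∈ V' ^ n', D (x i * x j * b) = 0)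
    (o4 : ∀ j ∈ S, ∀ n', n' + 2 = n → ∀ b ∈ V' ^ n', D (x j * x j * b) = - E j b)
    {i i' s : ℕ} (hn : i + i' + s = n) {b b' p : A} {c c' : ι → A} (hb : b ∈ V' ^ i)
    (hb' : b' ∈ V' ^ i') (hp : p ∈ V' ^ s) (hc : ∀ j ∈ S, c j ∈ Wm V' i)
    (hc' : ∀ j ∈ S, c' j ∈ Wm V' i') :
    D (p * ((b + ∑ j ∈ S, x j * c j) * (b' + ∑ j ∈ S, x j * c' j))) =
      D (p * (b * b')) - ∑ j ∈ S, E j (p * (c j * c' j)) := by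
  have e : p * ((b + ∑ j ∈ S, x j * c j) * (b' + ∑ j ∈ S, x j * c' j)) =
      p * (b * b') + ∑ j ∈ S, x j * (c j * (b' * p)) + ∑ j ∈ S, x j * (c' j * (b * p)) +
      ∑ j ∈ S, ∑ j' ∈ S, x j * x j' * (p * (c j * c' j')) := by
    have e1 : ∑ j ∈ S, x j * (c j * (b' * p)) = (∑ j ∈ S, x j * c j) * (b' * p) := by
      rw [Finset.sum_mul]; exact Finset.sum_congr rfl fun _ _ => by ring
    have e2 : ∑ j ∈ S, x j * (c' j * (b * p)) = (∑ j ∈ S, x j * c' j) * (b * p) := by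
      rw [Finset.sum_mul]; exact Finset.sum_congr rfl fun _ _ => by ring
    have e3 : ∑ j ∈ S, ∑ j' ∈ S, x j * x j' * (p * (c j * c' j')) =
        (∑ j ∈ S, x j * c j) * (∑ j ∈ S, x j * c' j) * p := by
      rw [Finset.sum_mul_sum, Finset.sum_mul]
      refine Finset.sum_congr rfl fun _ _ => ?_
      rw [Finset.sum_mul]
      exact Finset.sum_congr rfl fun _ _ => by ring
    rw [e1, e2, e3]; ring
  rw [e]
  simp only [map_add, map_sum]
  rw [Finset.sum_eq_zero (fun j hj => o2 j hj _
      (Wm_mul (hc j hj) (mem_of_add hb' hp rfl) (by omega))),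
    Finset.sum_eq_zero (fun j hj => o2 j hj _
      (Wm_mul (hc' j hj) (mem_of_add hb hp rfl) (by omega))), add_zero, add_zero, sub_eq_add_neg,
    ← Finset.sum_neg_distrib]
  congr 1
  refine Finset.sum_congr rfl fun j hj => ?_
  cases i with
  | zero => simp [Wm_zero (hc j hj)]
  | succ i =>
  cases i' with
  | zero =>
    rw [Wm_zero (hc' j hj)]
    simp only [mul_zero, map_zero, neg_zero]
    exact Finset.sum_eq_zero fun j' hj' => by rw [Wm_zero (hc' j' hj')]; simp
  | succ i' =>
    have hmem : ∀ j' ∈ S, p * (c j * c' j') ∈ V' ^ (i + i' + s) := fun j' hj' =>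
      mem_of_add hp (mem_of_add (show c j ∈ V' ^ i from hc j hj)
        (show c' j' ∈ V' ^ i' from hc' j' hj') rfl) (by omega)
    rw [Finset.sum_eq_single j]
    · exact o4 j hj _ (by omega) _ (hmem j hj)
    · intro j' hj' hne
      exact o3 j hj j' hj' hne.symm _ (by omega) _ (hmem j' hj')
    · intro h; exact absurd hj h

theorem SS {V V' : Submodule ℝ A} {D : A →ₗ[ℝ] ℝ} {ι : Type*} [DecidableEq ι] (S : Finset ι)
    (x : ι → A) (E : ι → A →ₗ[ℝ] ℝ) {n : ℕ} {l : A} (hVV : V' ≤ V) (hx : ∀ j ∈ S, x j ∈ V)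
    (hl : l ∈ V') (hD : HR V' D n l) (hE : ∀ j ∈ S, ∀ n', n' + 2 = n → HR V (E j) n' l)
    (o2 : ∀ j ∈ S, ∀ b ∈ Wm V' n, D (x j * b) = 0)
    (o3 : ∀ i ∈ S, ∀ j ∈ S, i ≠ j → ∀ n', n' + 2 = n → ∀ b ∈ V' ^ n', D (x i * x j * b) = 0)
    (o4 : ∀ j ∈ S, ∀ n', n' + 2 = n → ∀ b ∈ V' ^ n', D (x j * x j * b) = - E j b)
    (s1 : ∀ k, ∀ a ∈ V ^ k, ∃ b ∈ V' ^ k, ∃ c : ι → A, (∀ j ∈ S, c j ∈ Wm V' k) ∧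
      ∀ p, D (a * p) = D ((b + ∑ j ∈ S, x j * c j) * p))
    (s2 : ∀ k, ∀ j ∈ S, ∀ a ∈ V ^ k, ∃ b ∈ V' ^ k, ∀ p, E j (a * p) = E j (b * p)) :
    HR V D n l := by
  intro k m hkm a ha hab hq
  obtain ⟨b, hb, c, hc, hac⟩ := s1 k a ha
  have hlp : ∀ j, l ^ j ∈ V' ^ j := fun j => lin_pow_mem hl j
  have hval : D (l ^ m * (a * a)) = D (l ^ m * (b * b)) - ∑ j ∈ S, E j (l ^ m * (c j * c j)) := by
    rw [← SS_expand S x E o2 o3 o4 (by omega : k + k + m = n) hb hb (hlp m) hc hc,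
      show l ^ m * (a * a) = a * (l ^ m * a) by ring, hac,
      show (b + ∑ j ∈ S, x j * c j) * (l ^ m * a) = a * ((b + ∑ j ∈ S, x j * c j) * l ^ m) by ring,
      hac]
    congr 1; ring
  have hprim : ∀ w ∈ Wm V k, D (l ^ (m + 1) * ((b + ∑ j ∈ S, x j * c j) * w)) = 0 := by
    intro w hw
    rw [← hab w hw, show l ^ (m + 1) * (a * w) = a * (l ^ (m + 1) * w) by ring, hac]
    congr 1; ring
  -- `b` is primitive
  have hbd : (∀ b' ∈ V' ^ (k + m), D (b * b') = 0) ∨ 0 < (-1) ^ k * D (l ^ m * (b * b)) := by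
    by_cases hcon : ∃ b' ∈ V' ^ (k + m), D (b * b') ≠ 0
    · right
      refine hD k m hkm b hb ?_ hcon
      intro w hw
      cases k with
      | zero => rw [Wm_zero hw]; simp
      | succ k =>
        have h1 := SS_expand S x E o2 o3 o4 (by omega : (k + 1) + k + (m + 1) = n) hb
          (show w ∈ V' ^ k from hw) (hlp (m + 1)) hc (c' := fun _ => 0)
          (fun _ _ => Submodule.zero_mem _)
        simp only [mul_zero, Finset.sum_const_zero, add_zero, map_zero, sub_zero] at h1
        rw [← h1]
        exact hprim w (Wm_mono hVV _ hw)
    · left; push Not at hcon; exact hcon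
  have hcd : ∀ j ∈ S, (∀ q ∈ Wm V (k + m), E j (c j * q) = 0) ∨
      0 < (-1) ^ k * -E j (l ^ m * (c j * c j)) := by
    intro j hj
    cases k with
    | zero => left; intro q _; rw [Wm_zero (hc j hj)]; simp
    | succ k =>
      have hcj : c j ∈ V' ^ k := hc j hj
      by_cases hcon : ∃ q ∈ V ^ (k + m), E j (c j * q) ≠ 0
      · right
        have h1 := hE j hj (2 * k + m) (by omega) k m rfl (c j)
          (pow_le_pow_left' hVV k hcj) ?_ hcon
        · rw [pow_succ]; linarith
        · intro w hw
          have hw' : ∃ w' ∈ Wm V' k, ∀ p, E j (w * p) = E j (w' * p) := by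
            cases k with
            | zero => exact ⟨0, Submodule.zero_mem _, by rw [Wm_zero hw]; simp⟩
            | succ k => exact s2 k j hj w hw
          obtain ⟨w', hw', hww⟩ := hw'
          rw [show l ^ (m + 1) * (c j * w) = w * (l ^ (m + 1) * c j) by ring, hww]
          have h1 := SS_expand S x E o2 o3 o4 (by omega : (k + 1) + k + (m + 1) = n) hb
            (Submodule.zero_mem (V' ^ k)) (hlp (m + 1)) hc (c' := fun i => if i = j then w' else 0)
            (fun i _ => by
              by_cases h : i = j
              · simpa [h] using hw'
              · simp [h])
          simp only [mul_zero, map_zero, zero_sub, mul_ite, zero_add, Finset.sum_ite_eq', hj,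
            if_true, apply_ite (E _)] at h1
          rw [hprim] at h1
          · rw [show w' * (l ^ (m + 1) * c j) = l ^ (m + 1) * (c j * w') by ring]
            linarith
          · have h3 := mul_Wm (hx j hj) (Wm_mono hVV _ hw')
            exact h3
      · left; push Not at hcon
        rw [show k + 1 + m = k + m + 1 by ring]
        exact hcon
  have hcn : ∀ j ∈ S, 0 ≤ (-1) ^ k * -E j (l ^ m * (c j * c j)) := by
    intro j hj
    rcases hcd j hj with h | h
    · rw [show l ^ m * (c j * c j) = c j * (c j * l ^ m) by ring, h]
      · simp
      · exact Wm_mul (Wm_mono hVV _ (hc j hj)) (pow_le_pow_left' hVV m (hlp m)) rfl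
    · exact h.le
  have hbn : 0 ≤ (-1) ^ k * D (l ^ m * (b * b)) := by
    rcases hbd with h | h
    · rw [show l ^ m * (b * b) = b * (b * l ^ m) by ring, h _ (mem_of_add hb (hlp m) rfl)]
      simp
    · exact h.le
  rw [hval]
  have e : (-1) ^ k * (D (l ^ m * (b * b)) - ∑ j ∈ S, E j (l ^ m * (c j * c j))) =
      (-1) ^ k * D (l ^ m * (b * b)) + ∑ j ∈ S, (-1) ^ k * -E j (l ^ m * (c j * c j)) := by
    rw [← Finset.mul_sum, Finset.sum_neg_distrib]; ring
  rw [e]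
  by_contra hneg
  have hsn : 0 ≤ ∑ j ∈ S, (-1) ^ k * -E j (l ^ m * (c j * c j)) := Finset.sum_nonneg hcn
  have hb0 : (-1) ^ k * D (l ^ m * (b * b)) = 0 := by linarith
  have hs0 : ∑ j ∈ S, (-1) ^ k * -E j (l ^ m * (c j * c j)) = 0 := by linarith
  rw [Finset.sum_eq_zero_iff_of_nonneg hcn] at hs0
  obtain ⟨q, hq, hne⟩ := hq
  obtain ⟨b', hb', c', hc', hqc⟩ := s1 _ q hq
  apply hne
  rw [hac, mul_comm, hqc, mul_comm]
  have h1 := SS_expand S x E o2 o3 o4 (by omega : k + (k + m) + 0 = n) hb hb'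
    (one_mem_pow_zero V') hc hc'
  rw [one_mul, one_mul] at h1
  rw [h1, Finset.sum_eq_zero, sub_zero]
  · rcases hbd with h | h
    · exact h _ hb'
    · linarith
  · intro j hj
    rw [one_mul]
    rcases hcd j hj with h | h
    · exact h _ (Wm_mono hVV _ (hc' j hj))
    · have := hs0 j hj; linarith

end abstractHR
end AHK

namespace AHK
open Finset Matrix Filter Topology

section abstractHR
variable {A : Type*} [CommRing A] [Algebra ℝ A]

theorem solve_dual {U : Type*} [AddCommGroup U] [Module ℝ U] [FiniteDimensional ℝ U]
    (T : U →ₗ[ℝ] U →ₗ[ℝ] ℝ) (hs : ∀ a b, T a b = T b a) (f : U →ₗ[ℝ] ℝ)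
    (hf : ∀ c, T c = 0 → f c = 0) : ∃ a, T a = f := by
  have h1 : f ∈ (LinearMap.ker T).dualAnnihilator := by
    rw [Submodule.mem_dualAnnihilator]
    intro c hc
    exact hf c hc
  rw [← LinearMap.range_dualMap_eq_dualAnnihilator_ker] at h1
  obtain ⟨φ, hφ⟩ := h1
  obtain ⟨a, rfl⟩ := (Module.evalEquiv ℝ U).surjective φ
  refine ⟨a, ?_⟩
  rw [← hφ]
  ext b
  simp [hs a b]

/-- divided difference of powers -/
noncomputable def gg (l e : A) (s : ℝ) : ℕ → A
  | 0 => 0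
  | μ + 1 => l * gg l e s μ + (l + s • e) ^ μ

theorem gg_pow (l e : A) (s : ℝ) (μ : ℕ) : (l + s • e) ^ μ = l ^ μ + s • (e * gg l e s μ) := by
  induction μ with
  | zero => simp [gg]
  | succ μ ih =>
    rw [gg, pow_succ, mul_add, mul_add (b := l * _)]
    conv_lhs => enter [1]; rw [ih]
    simp only [Algebra.smul_def]
    ring

theorem gg_pow_y {l e y : A} (hy : y * y = y * e) (s : ℝ) (μ : ℕ) :
    (l + s • y) ^ μ = l ^ μ + s • (y * gg l e s μ) := by
  induction μ with
  | zero => simp [gg]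
  | succ μ ih =>
    rw [gg, pow_succ, ih, gg_pow]
    simp only [Algebra.smul_def]
    linear_combination (algebraMap ℝ A s) ^ 2 * gg l e s μ * hy

theorem gg_zero (l e : A) (μ : ℕ) : gg l e 0 (μ + 1) = ((μ : ℝ) + 1) • l ^ μ := by
  induction μ with
  | zero => simp [gg]
  | succ μ ih =>
    rw [gg, ih, zero_smul, add_zero, mul_smul_comm, ← pow_succ']
    push_cast
    rw [add_smul ((μ:ℝ) + 1) (1:ℝ), one_smul]

theorem y_formula {l e y : A} (hy : y * y = y * e) (s : ℝ) (μ : ℕ) (b b' c c' : A) :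
    (l + s • y) ^ μ * ((b + y * (s • b')) * (c + y * (s • c'))) = l ^ μ * (b * c) +
      s • (y * (gg l e s μ * (b * c) + (l + s • e) ^ μ * (b * c' + b' * c) +
        s • ((l + s • e) ^ μ * (e * (b' * c'))))) := by
  have h1 : y * (l + s • y) ^ μ = y * (l + s • e) ^ μ := by
    rw [gg_pow l e, gg_pow_y hy]
    simp only [Algebra.smul_def]
    linear_combination (algebraMap ℝ A s) * gg l e s μ * hy
  have h2 : (l + s • y) ^ μ = l ^ μ + s • (y * gg l e s μ) := gg_pow_y hy s μ
  simp only [Algebra.smul_def] at *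
  linear_combination (b * c) * h2 + (algebraMap ℝ A s * (b * c' + b' * c) +
    (algebraMap ℝ A s) ^ 2 * y * b' * c') * h1 + (algebraMap ℝ A s) ^ 2 * b' * c' *
      (l + algebraMap ℝ A s * e) ^ μ * hy

theorem cont_gg (D : A →ₗ[ℝ] ℝ) (l e : A) (μ : ℕ) :
    ∀ x, Continuous fun s : ℝ => D (gg l e s μ * x) := by
  induction μ with
  | zero => intro x; simp only [gg]; exact continuous_const
  | succ μ ih =>
    intro x
    have : (fun s : ℝ => D (gg l e s (μ + 1) * x)) =
        fun s : ℝ => D (gg l e s μ * (l * x)) + D ((l + s • e) ^ μ * x) := by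
      funext s
      rw [gg, ← map_add]; congr 1; ring
    rw [this]
    exact (ih _).add (cont_pow D _ _ _ _)

theorem joint1 {ι : Type*} [Fintype ι] [DecidableEq ι] (D : A →ₗ[ℝ] ℝ) (B : ℝ → A)
    (hB : ∀ x, Continuous fun s => D (B s * x)) (P : (ι → ℝ) →ₗ[ℝ] A) (x : A) :
    Continuous fun z : ℝ × (ι → ℝ) => D (B z.1 * (P z.2 * x)) := by
  have : (fun z : ℝ × (ι → ℝ) => D (B z.1 * (P z.2 * x))) = fun z =>
      ∑ i, z.2 i * D (B z.1 * (P (Pi.single i 1) * x)) := by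
    funext z
    conv_lhs => rw [P.pi_apply_eq_sum_univ z.2]
    simp only [Finset.sum_mul, Finset.mul_sum, map_sum, smul_mul_assoc, mul_smul_comm, map_smul,
      smul_eq_mul]
    refine Finset.sum_congr rfl fun i _ => ?_
    congr 5
    funext j; simp [Pi.single_apply, eq_comm]
  rw [this]
  refine continuous_finset_sum _ fun i _ => ?_
  exact ((continuous_apply i).comp continuous_snd).mul ((hB _).comp continuous_fst)

theorem joint2 {ι : Type*} [Fintype ι] [DecidableEq ι] (D : A →ₗ[ℝ] ℝ) (B : ℝ → A)
    (hB : ∀ x, Continuous fun s => D (B s * x)) (P P' : (ι → ℝ) →ₗ[ℝ] A) :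
    Continuous fun z : ℝ × (ι → ℝ) => D (B z.1 * (P z.2 * P' z.2)) := by
  have : (fun z : ℝ × (ι → ℝ) => D (B z.1 * (P z.2 * P' z.2))) = fun z =>
      ∑ i, z.2 i * D (B z.1 * (P z.2 * P' (Pi.single i 1))) := by
    funext z
    conv_lhs => rw [P'.pi_apply_eq_sum_univ z.2]
    simp only [Finset.sum_mul, Finset.mul_sum, map_sum, smul_mul_assoc, mul_smul_comm, map_smul,
      smul_eq_mul]
    refine Finset.sum_congr rfl fun i _ => ?_
    congr 5
    funext j; simp [Pi.single_apply, eq_comm]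
  rw [this]
  refine continuous_finset_sum _ fun i _ => ?_
  exact ((continuous_apply i).comp continuous_snd).mul (joint1 D B hB P _)

theorem HRk_of_rep {V : Submodule ℝ A} {D : A →ₗ[ℝ] ℝ} {k m : ℕ} {l : A} (hl : l ∈ V) (T : Set A)
    (hT : ∀ a ∈ V ^ k, ∃ a' ∈ V ^ k, a' ∈ T ∧ ∀ q ∈ V ^ (k + m), D (a * q) = D (a' * q))
    (h : ∀ a ∈ V ^ k, a ∈ T → (∀ b ∈ Wm V k, D (l ^ (m + 1) * (a * b)) = 0) →
      (∃ b ∈ V ^ (k + m), D (a * b) ≠ 0) → 0 < (-1) ^ k * D (l ^ m * (a * a))) :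
    HRk V D k m l := by
  intro a ha hab hb
  obtain ⟨a', ha', haT, haa⟩ := hT a ha
  have h1 := h a' ha' haT ?_ ?_
  · rw [show l ^ m * (a * a) = a * (l ^ m * a) by ring,
      haa _ (mem_of_add (lin_pow_mem hl m) ha (add_comm _ _)),
      show a' * (l ^ m * a) = a * (l ^ m * a') by ring,
      haa _ (mem_of_add (lin_pow_mem hl m) ha' (add_comm _ _))]
    convert h1 using 3; ring
  · intro b hb
    rw [← hab b hb, show l ^ (m + 1) * (a' * b) = a' * (l ^ m * (l * b)) by ring,
      ← haa _ (mem_of_add (lin_pow_mem hl m) (mul_Wm hl hb) (add_comm _ _))]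
    congr 1; ring
  · obtain ⟨b, hb, hne⟩ := hb
    exact ⟨b, hb, by rwa [← haa b hb]⟩

/-- the piece two degrees lower -/
def Wm2 (V : Submodule ℝ A) : ℕ → Submodule ℝ A
  | 0 => ⊥
  | j + 1 => Wm V j

theorem mul_Wm2 {V : Submodule ℝ A} {l : A} (hl : l ∈ V) {k : ℕ} {b : A} (hb : b ∈ Wm2 V k) :
    l * b ∈ Wm V k := by
  cases k with
  | zero => rw [Wm2, Submodule.mem_bot] at hb; subst hb; simp
  | succ j => exact mul_Wm hl hb

/-- Limit statement for adding a coloop. -/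
theorem coloop_limit {W : Submodule ℝ A} {D : A →ₗ[ℝ] ℝ}
    (hfin : ∀ k, FiniteDimensional ℝ (W ^ k : Submodule ℝ A)) {N k m : ℕ} (hkm : 2 * k + m = N + 1)
    {l e : A} (hl : l ∈ W) (h : HR W D N l) {b b' : A} (hb : b ∈ W ^ k) (hb' : b' ∈ Wm W k)
    (h1 : ∀ c ∈ Wm W k, ((m : ℝ) + 1) * D (l ^ m * (b * c)) + D (l ^ (m + 1) * (b' * c)) = 0)
    (h2 : ∀ c ∈ Wm2 W k, D (l ^ (m + 1) * (b * c)) = 0)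
    (hne : ¬ ((∀ q ∈ Wm W (k + m), D (b * q) = 0) ∧ (∀ q ∈ W ^ (k + m), D (b' * q) = 0))) :
    0 < (-1) ^ k * (D (gg l e 0 m * (b * b)) + 2 * D (l ^ m * (b * b'))) := by
  have hWf : FiniteDimensional ℝ (Wm W k) := by
    cases k with
    | zero => show FiniteDimensional ℝ (⊥ : Submodule ℝ A); infer_instance
    | succ j => exact hfin j
  have HLf : ∀ a ∈ Wm W k, (∀ c ∈ Wm W k, D (l ^ (m + 1) * (a * c)) = 0) →
      ∀ q ∈ W ^ (k + m), D (a * q) = 0 := by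
    intro a ha hac q hq
    cases k with
    | zero => rw [Wm_zero ha]; simp
    | succ k =>
      refine (h k (m + 1) (by omega)).hl hl a ha hac q ?_
      rwa [show k + (m + 1) = k + 1 + m by ring]
  have HRf : ∀ a ∈ Wm W k, (∀ c ∈ Wm2 W k, D (l ^ (m + 2) * (a * c)) = 0) →
      (∀ q ∈ W ^ (k + m), D (a * q) = 0) ∨ 0 < -((-1) ^ k * D (l ^ (m + 1) * (a * a))) := by
    intro a ha hac
    cases k with
    | zero => left; intro q _; rw [Wm_zero ha]; simp
    | succ k =>
      by_cases hcon : ∃ q ∈ W ^ (k + (m + 1)), D (a * q) ≠ 0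
      · right
        have := h k (m + 1) (by omega) a ha hac hcon
        rw [pow_succ]; linarith
      · left
        push Not at hcon
        rwa [show k + 1 + m = k + (m + 1) by ring]
  have hlb : l ^ m * b ∈ W ^ (k + m) := mem_of_add (lin_pow_mem hl m) hb (add_comm _ _)
  obtain ⟨a1, ha1, ha1'⟩ : ∃ a1 ∈ Wm W k, ∀ c ∈ Wm W k,
      D (l ^ (m + 1) * (a1 * c)) = D (l ^ m * (b * c)) := by
    let T : Wm W k →ₗ[ℝ] Wm W k →ₗ[ℝ] ℝ := LinearMap.mk₂ ℝ
      (fun a c => D (l ^ (m + 1) * ((a : A) * (c : A))))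
      (fun a a' c => by simp [add_mul, mul_add]) (fun r a c => by simp)
      (fun a c c' => by simp [mul_add]) (fun r a c => by simp)
    let f : Wm W k →ₗ[ℝ] ℝ := mD D (l ^ m * b) ∘ₗ (Wm W k).subtype
    have hT1 : ∀ a c, T a c = T c a := by
      intro a c
      simp only [T, LinearMap.mk₂_apply]; rw [mul_comm (a : A)]
    have hT2 : ∀ c, T c = 0 → f c = 0 := by
      intro c hc
      simp only [f, LinearMap.comp_apply, Submodule.subtype_apply, mD_apply]
      rw [mul_comm]
      refine HLf c c.2 ?_ _ hlb
      intro c' hc'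
      exact LinearMap.congr_fun hc ⟨c', hc'⟩
    obtain ⟨a, ha⟩ := solve_dual T hT1 f hT2
    refine ⟨a, a.2, fun c hc => ?_⟩
    have := LinearMap.congr_fun ha ⟨c, hc⟩
    simp only [T, f, LinearMap.mk₂_apply, LinearMap.comp_apply, Submodule.subtype_apply,
      mD_apply] at this
    rw [this, mul_assoc]
  set a0 := b - l * a1 with ha0
  have ha0m : a0 ∈ W ^ k := Submodule.sub_mem _ hb (mul_Wm hl ha1)
  have hbe : b = a0 + l * a1 := by rw [ha0]; ring
  have ha0p : ∀ c ∈ Wm W k, D (l ^ m * (a0 * c)) = 0 := by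
    intro c hc
    rw [ha0, show l ^ m * ((b - l * a1) * c) = l ^ m * (b * c) - l ^ (m + 1) * (a1 * c) by ring,
      map_sub, ha1' c hc, sub_self]
  have hb'r : ∀ q ∈ W ^ (k + m), D (b' * q) = - ((m : ℝ) + 1) * D (a1 * q) := by
    have := HLf (b' + ((m : ℝ) + 1) • a1) (Submodule.add_mem _ hb' (Submodule.smul_mem _ _ ha1)) ?_
    · intro q hq
      have h3 := this q hq
      rw [add_mul, map_add, smul_mul_assoc, map_smul, smul_eq_mul] at h3
      linarith
    · intro c hc
      have h3 := h1 c hc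
      rw [← ha1' c hc] at h3
      rw [add_mul, mul_add, map_add, smul_mul_assoc, mul_smul_comm, map_smul, smul_eq_mul]
      linarith
  have ha1d := HRf a1 ha1 (by
    intro c hc
    have h3 := ha1' (l * c) (mul_Wm2 hl hc)
    have h4 := h2 c hc
    rw [show l ^ (m + 2) * (a1 * c) = l ^ (m + 1) * (a1 * (l * c)) by ring, h3, ← h4]
    congr 1; ring)
  have hv2 : D (l ^ m * (b * b')) = - ((m : ℝ) + 1) * D (l ^ (m + 1) * (a1 * a1)) := by
    rw [show l ^ m * (b * b') = b' * (l ^ m * b) by ring, hb'r _ hlb, ha1' a1 ha1]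
    congr 2; ring
  have hv1 : D (gg l e 0 m * (b * b)) =
      D (gg l e 0 m * (a0 * a0)) + m * D (l ^ (m + 1) * (a1 * a1)) := by
    cases m with
    | zero => simp [gg]
    | succ m =>
      rw [gg_zero]
      simp only [smul_mul_assoc, map_smul, smul_eq_mul]
      rw [hbe, show l ^ m * ((a0 + l * a1) * (a0 + l * a1)) = l ^ m * (a0 * a0) +
        (l ^ (m + 1) * (a0 * a1) + l ^ (m + 1) * (a0 * a1)) + l ^ (m + 1 + 1) * (a1 * a1) by ring]
      simp only [map_add]
      rw [ha0p a1 ha1]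
      push_cast; ring
  have ha0d : (∀ q ∈ Wm W (k + m), D (a0 * q) = 0) ∨ 0 < (-1) ^ k * D (gg l e 0 m * (a0 * a0)) := by
    cases m with
    | zero =>
      left
      intro q hq
      have := ha0p q hq
      rwa [pow_zero, one_mul] at this
    | succ m =>
      by_cases hcon : ∃ q ∈ W ^ (k + m), D (a0 * q) ≠ 0
      · right
        have := h k m (by omega) a0 ha0m ha0p hcon
        rw [gg_zero]
        simp only [smul_mul_assoc, map_smul, smul_eq_mul]
        have hm : (0:ℝ) < m + 1 := by positivity
        nlinarith [mul_pos hm this]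
      · left; push Not at hcon
        exact hcon
  have ha0n : 0 ≤ (-1) ^ k * D (gg l e 0 m * (a0 * a0)) := by
    rcases ha0d with h3 | h3
    · cases m with
      | zero => simp [gg]
      | succ m =>
        rw [gg_zero]
        simp only [smul_mul_assoc, map_smul, smul_eq_mul]
        rw [show l ^ m * (a0 * a0) = a0 * (l ^ m * a0) by ring, h3]
        · simp
        · exact mem_of_add (lin_pow_mem hl m) ha0m (add_comm _ _)
    · exact h3.le
  have ha1n : 0 ≤ -((-1) ^ k * D (l ^ (m + 1) * (a1 * a1))) := by
    rcases ha1d with h3 | h3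
    · rw [show l ^ (m + 1) * (a1 * a1) = a1 * (l ^ m * (l * a1)) by ring, h3]
      · simp
      · exact mem_of_add (lin_pow_mem hl m) (mul_Wm hl ha1) (add_comm _ _)
    · exact h3.le
  have htot : (-1) ^ k * (D (gg l e 0 m * (b * b)) + 2 * D (l ^ m * (b * b'))) =
      (-1) ^ k * D (gg l e 0 m * (a0 * a0)) +
        ((m : ℝ) + 2) * -((-1) ^ k * D (l ^ (m + 1) * (a1 * a1))) := by
    rw [hv1, hv2]; ring
  rw [htot]
  have hm2 : (0:ℝ) < m + 2 := by positivity
  rcases ha1d with h3 | h3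
  · rcases ha0d with h4 | h4
    · exfalso
      refine hne ⟨?_, ?_⟩
      · intro q hq
        rw [hbe, add_mul, map_add, h4 q hq, zero_add, mul_comm l, mul_assoc]
        exact h3 _ (mul_Wm hl hq)
      · intro q hq
        rw [hb'r q hq, h3 q hq, mul_zero]
    · exact add_pos_of_pos_of_nonneg h4 (mul_nonneg hm2.le ha1n)
  · exact add_pos_of_nonneg_of_pos ha0n (mul_pos hm2 h3)

end abstractHR
end AHK

namespace AHK
open Finset Matrix Filter Topology

section abstractHR
variable {A : Type*} [CommRing A] [Algebra ℝ A]

theorem sup_y_decomp {W : Submodule ℝ A} {y e : A} (he : e ∈ W) (hy : y * y = y * e) (k : ℕ) :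
    ∀ a ∈ (W ⊔ Submodule.span ℝ {y}) ^ k, ∃ b ∈ W ^ k, ∃ b' ∈ Wm W k, a = b + y * b' := by
  induction k with
  | zero => intro a ha; exact ⟨a, by simpa using ha, 0, Submodule.zero_mem _, by simp⟩
  | succ k ih =>
    intro a ha
    rw [pow_succ] at ha
    refine Submodule.mul_induction_on ha ?_ ?_
    · intro u hu v hv
      obtain ⟨b, hb, b', hb', rfl⟩ := ih u hu
      obtain ⟨w, hw, z, hz, rfl⟩ := Submodule.mem_sup.1 hv
      obtain ⟨t, rfl⟩ := Submodule.mem_span_singleton.1 hz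
      refine ⟨b * w, by rw [pow_succ]; exact Submodule.mul_mem_mul hb hw,
        b' * w + t • b + t • (e * b'), ?_, ?_⟩
      · refine Submodule.add_mem _ (Submodule.add_mem _ ?_ ?_) ?_
        · exact Wm_mul hb' (show w ∈ W ^ 1 by rwa [pow_one]) rfl
        · exact Submodule.smul_mem _ _ hb
        · exact Submodule.smul_mem _ _ (mul_Wm he hb')
      · simp only [Algebra.smul_def]
        linear_combination (algebraMap ℝ A t) * b' * hy
    · rintro _ _ ⟨b, hb, b', hb', rfl⟩ ⟨c, hc, c', hc', rfl⟩
      exact ⟨b + c, Submodule.add_mem _ hb hc, b' + c', Submodule.add_mem _ hb' hc', by ring⟩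

theorem sup_y_mem {W : Submodule ℝ A} {y : A} {k : ℕ} {b b' : A} (hb : b ∈ W ^ k)
    (hb' : b' ∈ Wm W k) : b + y * b' ∈ (W ⊔ Submodule.span ℝ {y}) ^ k := by
  refine Submodule.add_mem _ (pow_le_pow_left' (le_sup_left (a := W) (b := Submodule.span ℝ {y})) k hb) ?_
  exact mul_Wm (le_sup_right (a := W) (Submodule.mem_span_singleton_self y))
    (Wm_mono le_sup_left k hb')

theorem coloop_HRk {W : Submodule ℝ A} {D : A →ₗ[ℝ] ℝ}
    (hfin : ∀ k, FiniteDimensional ℝ (W ^ k : Submodule ℝ A)) {y e l : A} (he : e ∈ W)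
    (hl : l ∈ W) (hy : y * y = y * e) {N : ℕ} (hD0 : ∀ b ∈ W ^ (N + 1), D b = 0)
    (h : HR W (mD D y) N l) {k m : ℕ} (hkm : 2 * k + m = N + 1) :
    ∀ᶠ s : ℝ in 𝓝[>] 0, HRk (W ⊔ Submodule.span ℝ {y}) D k m (l + s • y) := by
  classical
  have hWf : ∀ k, FiniteDimensional ℝ (Wm W k) := by
    intro k
    cases k with
    | zero => show FiniteDimensional ℝ (⊥ : Submodule ℝ A); infer_instance
    | succ j => exact hfin j
  have hW2f : FiniteDimensional ℝ (Wm2 W k) := by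
    cases k with
    | zero => show FiniteDimensional ℝ (⊥ : Submodule ℝ A); infer_instance
    | succ j => exact hWf j
  have := hfin k
  have := hWf k
  set Dy := mD D y with hDy
  obtain ⟨p, ee, heU, hec, hei⟩ := coords (W ^ k) (radD Dy (Wm W (k + m)))
  obtain ⟨p', ff, hfU, hfc, hfi⟩ := coords (Wm W k) (radD Dy (W ^ (k + m)))
  obtain ⟨p'', hh, hhU, hhc, hhi⟩ := coords (Wm2 W k) ⊥
  let P1 : (Fin p ⊕ Fin p' → ℝ) →ₗ[ℝ] A :=
    Fintype.linearCombination ℝ ee ∘ₗ LinearMap.funLeft ℝ ℝ Sum.inl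
  let P2 : (Fin p ⊕ Fin p' → ℝ) →ₗ[ℝ] A :=
    Fintype.linearCombination ℝ ff ∘ₗ LinearMap.funLeft ℝ ℝ Sum.inr
  have hP1 : ∀ v, P1 v = ∑ i, v (Sum.inl i) • ee i := fun v => by
    simp [P1, Fintype.linearCombination_apply, LinearMap.funLeft_apply]
  have hP2 : ∀ v, P2 v = ∑ i, v (Sum.inr i) • ff i := fun v => by
    simp [P2, Fintype.linearCombination_apply, LinearMap.funLeft_apply]
  have hP1m : ∀ v, P1 v ∈ W ^ k := fun v => by
    rw [hP1]; exact Submodule.sum_mem _ fun i _ => Submodule.smul_mem _ _ (heU i)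
  have hP2m : ∀ v, P2 v ∈ Wm W k := fun v => by
    rw [hP2]; exact Submodule.sum_mem _ fun i _ => Submodule.smul_mem _ _ (hfU i)
  let q : ℝ → (Fin p ⊕ Fin p' → ℝ) → ℝ := fun s v =>
    (-1) ^ k * (Dy (gg l e s m * (P1 v * P1 v)) + 2 * Dy ((l + s • e) ^ m * (P1 v * P2 v)) +
      s * Dy ((l + s • e) ^ m * (P2 v * ((LinearMap.mulLeft ℝ e ∘ₗ P2) v))))
  let C : ℝ → (Fin p ⊕ Fin p' → ℝ) → (Fin p' ⊕ Fin p'' → ℝ) := fun s v => Sum.elim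
    (fun j => Dy (gg l e s (m + 1) * (P1 v * ff j)) + Dy ((l + s • e) ^ (m + 1) * (P2 v * ff j)))
    (fun r => Dy ((l + s • e) ^ (m + 1) * (P1 v * hh r)) +
      s * Dy ((l + s • e) ^ (m + 1) * (P2 v * (e * hh r))))
  have key := open_lem q C ?_ ?_ ?_ ?_ 0 ?_
  · filter_upwards [nhdsWithin_le_nhds key, self_mem_nhdsWithin] with s hs (hs0 : 0 < s)
    have hlV : l + s • y ∈ W ⊔ Submodule.span ℝ {y} :=
      Submodule.add_mem _ (le_sup_left (b := Submodule.span ℝ {y}) hl)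
        (Submodule.smul_mem _ _ (le_sup_right (a := W) (Submodule.mem_span_singleton_self y)))
    have hform : ∀ μ i i', i + i' + μ = N + 1 → ∀ b ∈ W ^ i, ∀ c ∈ W ^ i', ∀ b' c',
        D ((l + s • y) ^ μ * ((b + y * (s • b')) * (c + y * (s • c')))) =
        s * (Dy (gg l e s μ * (b * c)) + Dy ((l + s • e) ^ μ * (b * c' + b' * c)) +
          s * Dy ((l + s • e) ^ μ * (e * (b' * c')))) := by
      intro μ i i' hi b hb c hc b' c'
      rw [y_formula hy, map_add, hD0 _ (mem_of_add (lin_pow_mem hl μ) (mem_of_add hb hc rfl)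
        (by omega)), zero_add, map_smul, smul_eq_mul, ← mD_apply, map_add, map_add, map_smul,
        smul_eq_mul]
    refine HRk_of_rep hlV (Set.range fun v => P1 v + y * (s • P2 v)) ?_ ?_
    · intro a ha
      obtain ⟨b, hb, b', hb', rfl⟩ := sup_y_decomp he hy k a ha
      obtain ⟨u, hu⟩ := hec b hb
      obtain ⟨w, hw⟩ := hfc (s⁻¹ • b') (Submodule.smul_mem _ _ hb')
      refine ⟨P1 (Sum.elim u w) + y * (s • P2 (Sum.elim u w)), sup_y_mem (hP1m _)
        (Submodule.smul_mem _ _ (hP2m _)), ⟨_, rfl⟩, ?_⟩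
      have hu' : b - P1 (Sum.elim u w) ∈ radD Dy (Wm W (k + m)) := by
        rw [hP1]; simpa using hu
      have hw' : b' - s • P2 (Sum.elim u w) ∈ radD Dy (W ^ (k + m)) := by
        rw [hP2]
        have := Submodule.smul_mem _ s hw
        rw [smul_sub, smul_smul, mul_inv_cancel₀ hs0.ne', one_smul] at this
        simpa using this
      intro c hc
      obtain ⟨z, hz, z', hz', rfl⟩ := sup_y_decomp he hy (k + m) c hc
      rw [← sub_eq_zero, ← map_sub]
      have e1 : (b + y * b') * (z + y * z') -
          (P1 (Sum.elim u w) + y * (s • P2 (Sum.elim u w))) * (z + y * z') =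
          (b - P1 (Sum.elim u w)) * z + y * ((b - P1 (Sum.elim u w)) * z') +
          y * ((b' - s • P2 (Sum.elim u w)) * (z + e * z')) := by
        linear_combination ((b' - s • P2 (Sum.elim u w)) * z') * hy
      rw [e1, map_add, map_add, ← mD_apply D y ((b - _) * _), ← mD_apply D y ((b' - _) * _),
        hD0 _ (mem_of_add (Submodule.sub_mem _ hb (hP1m _)) hz (by omega)), ← hDy, hu' _ hz',
        hw' _ (Submodule.add_mem _ hz (mul_Wm he hz'))]
      simp
    · rintro _ _ ⟨v, rfl⟩ hab ⟨d, hd, hne⟩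
      have hv0 : v ≠ 0 := by
        rintro rfl
        simp at hne
      have hqv := hs v hv0 ?_
      · simp only
        rw [hform m k k (by omega) _ (hP1m v) _ (hP1m v)]
        have e1 : (-1) ^ k * (s * (Dy (gg l e s m * (P1 v * P1 v)) +
            Dy ((l + s • e) ^ m * (P1 v * P2 v + P2 v * P1 v)) +
            s * Dy ((l + s • e) ^ m * (e * (P2 v * P2 v))))) = s * q s v := by
          simp only [q, LinearMap.comp_apply, LinearMap.mulLeft_apply]
          rw [mul_comm (P2 v) (P1 v), mul_add _ (P1 v * P2 v), map_add,
            mul_left_comm (P2 v) e (P2 v)]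
          ring
        rw [e1]
        exact mul_pos hs0 hqv
      · cases k with
        | zero =>
          have hp' : IsEmpty (Fin p') := ⟨fun j => by
            have h1 := Wm_zero (hfU j)
            have h2 := hfi (Pi.single j 1) (by
              refine Submodule.sum_mem _ fun i _ => ?_
              rw [Wm_zero (hfU i), smul_zero]; exact Submodule.zero_mem _)
            have := congrFun h2 j
            simp at this⟩
          funext r
          rcases r with j | r
          · exact hp'.elim j
          · have : hh r = 0 := by
              have := hhU r
              rwa [Wm2, Submodule.mem_bot] at this
            simp [C, this]
        | succ k =>
          funext r
          rcases r with j | r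
          · have h1 := hab (ff j) (Wm_mono le_sup_left _ (hfU j))
            have h2 := hform (m + 1) (k + 1) k (by omega) _ (hP1m v) (ff j) (hfU j) (P2 v) 0
            simp only [smul_zero, mul_zero, add_zero, map_zero, zero_add] at h2
            rw [h2] at h1
            exact (mul_eq_zero.1 h1).resolve_left hs0.ne'
          · have h1 := hab (0 + y * (s • hh r)) (sup_y_mem (k := k) (Submodule.zero_mem _)
              (Submodule.smul_mem _ _ (hhU r)))
            rw [hform (m + 1) (k + 1) k (by omega) _ (hP1m v) 0 (Submodule.zero_mem _) (P2 v)
              (hh r)] at h1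
            have h2 := (mul_eq_zero.1 h1).resolve_left hs0.ne'
            simp only [mul_zero, map_zero, zero_add, add_zero] at h2
            simp only [C, Sum.elim_inr, Pi.zero_apply]
            rw [mul_left_comm (P2 v) e]
            exact h2
  · refine continuous_const.mul ((Continuous.add ?_ (continuous_const.mul ?_)).add
      (continuous_fst.mul ?_))
    · exact joint2 Dy _ (cont_gg Dy l e m) P1 P1
    · exact joint2 Dy _ (cont_pow Dy l e m) P1 P2
    · exact joint2 Dy _ (cont_pow Dy l e m) P2 _
  · refine continuous_pi fun r => ?_
    rcases r with j | r
    · exact (joint1 Dy _ (cont_gg Dy l e _) P1 _).add (joint1 Dy _ (cont_pow Dy l e _) P2 _)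
    · exact (joint1 Dy _ (cont_pow Dy l e _) P1 _).add (continuous_fst.mul
        (joint1 Dy _ (cont_pow Dy l e _) P2 _))
  · intro t c v
    simp only [q, map_smul, smul_mul_assoc, mul_smul_comm, smul_eq_mul]
    ring
  · intro t c v
    funext r
    rcases r with j | r
    · simp only [C, map_smul, smul_mul_assoc, mul_smul_comm, smul_eq_mul, Sum.elim_inl,
        Pi.smul_apply]
      ring
    · simp only [C, map_smul, smul_mul_assoc, mul_smul_comm, smul_eq_mul, Sum.elim_inr,
        Pi.smul_apply]
      ring
  · intro v hv hCv
    have hc1 : ∀ j, ((m : ℝ) + 1) * Dy (l ^ m * (P1 v * ff j)) +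
        Dy (l ^ (m + 1) * (P2 v * ff j)) = 0 := by
      intro j
      have := congrFun hCv (Sum.inl j)
      simp only [C, Sum.elim_inl, gg_zero, zero_smul, add_zero, smul_mul_assoc, map_smul,
        smul_eq_mul, Pi.zero_apply] at this
      exact this
    have hc2 : ∀ r, Dy (l ^ (m + 1) * (P1 v * hh r)) = 0 := by
      intro r
      have := congrFun hCv (Sum.inr r)
      simpa [C] using this
    have hlim := coloop_limit (e := e) hfin hkm hl h (hP1m v) (hP2m v) ?_ ?_ ?_
    · simpa [q] using hlim
    · intro c hc
      obtain ⟨w, hw⟩ := hfc c hc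
      have hsub : ∀ b ∈ W ^ (k + m), Dy (c * b) = ∑ i, w i * Dy (ff i * b) := by
        intro b hb
        have := hw b hb
        rw [sub_mul, map_sub, sub_eq_zero] at this
        rw [this, Finset.sum_mul, map_sum]
        simp
      rw [show l ^ m * (P1 v * c) = c * (l ^ m * P1 v) by ring,
        show l ^ (m + 1) * (P2 v * c) = c * (l ^ m * (l * P2 v)) by ring,
        hsub _ (mem_of_add (lin_pow_mem hl m) (hP1m v) (add_comm _ _)),
        hsub _ (mem_of_add (lin_pow_mem hl m) (mul_Wm hl (hP2m v)) (add_comm _ _)),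
        Finset.mul_sum, ← Finset.sum_add_distrib]
      refine Finset.sum_eq_zero fun j _ => ?_
      have := hc1 j
      rw [show l ^ m * (P1 v * ff j) = ff j * (l ^ m * P1 v) by ring,
        show l ^ (m + 1) * (P2 v * ff j) = ff j * (l ^ m * (l * P2 v)) by ring] at this
      linear_combination w j * this
    · intro c hc
      obtain ⟨w, hw⟩ := hhc c hc
      rw [Submodule.mem_bot, sub_eq_zero] at hw
      rw [hw, Finset.mul_sum, Finset.mul_sum, map_sum]
      refine Finset.sum_eq_zero fun r _ => ?_
      rw [mul_smul_comm, mul_smul_comm, map_smul, hc2, smul_zero]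
    · rintro ⟨h1, h2⟩
      apply hv
      have e1 := hei (fun i => v (Sum.inl i)) (by rw [← hP1]; exact h1)
      have e2 := hfi (fun i => v (Sum.inr i)) (by rw [← hP2]; exact h2)
      funext i
      rcases i with i | i
      · exact congrFun e1 i
      · exact congrFun e2 i

theorem coloop_HR {W : Submodule ℝ A} {D : A →ₗ[ℝ] ℝ}
    (hfin : ∀ k, FiniteDimensional ℝ (W ^ k : Submodule ℝ A)) {y e l : A} (he : e ∈ W)
    (hl : l ∈ W) (hy : y * y = y * e) {N : ℕ} (hD0 : ∀ b ∈ W ^ (N + 1), D b = 0)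
    (h : HR W (mD D y) N l) :
    ∀ᶠ s : ℝ in 𝓝[>] 0, HR (W ⊔ Submodule.span ℝ {y}) D (N + 1) (l + s • y) := by
  have : ∀ᶠ s : ℝ in 𝓝[>] 0, ∀ k ∈ Finset.range (N + 2), 2 * k ≤ N + 1 →
      HRk (W ⊔ Submodule.span ℝ {y}) D k (N + 1 - 2 * k) (l + s • y) := by
    rw [Filter.eventually_all_finset]
    intro k _
    rw [Filter.eventually_imp_distrib_left]
    intro hk
    exact coloop_HRk hfin he hl hy hD0 h (by omega)
  filter_upwards [this] with s hs k m hkm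
  have := hs k (Finset.mem_range.2 (by omega)) (by omega)
  rwa [show N + 1 - 2 * k = m by omega] at this

end abstractHR
end AHK

namespace AHK

variable {α : Type*} [Fintype α] [DecidableEq α] {B : Type*} [CommRing B] [Algebra ℝ B]
variable {R : RkFn α} {X : Finset α} {x : Finset α → B}

/-- pairwise comparable -/
def Chn (σ : Finset (Finset α)) : Prop := ∀ F ∈ σ, ∀ G ∈ σ, F ⊆ G ∨ G ⊆ F

def Ini (X : Finset α) (f : α → ℕ) (A : Finset α) : Prop := ∀ a ∈ A, ∀ b ∈ X, b ∉ A → f a < f b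

/-- strict submodularity on pairs compatible with the flag -/
def Am (σ : Finset (Finset α)) (X : Finset α) (c : Finset α → ℝ) : Prop :=
  c ∅ = 0 ∧ ∀ A ⊆ X, ∀ B ⊆ X, ¬ A ⊆ B → ¬ B ⊆ A →
    (∀ F ∈ σ, (A ⊆ F ∧ B ⊆ F) ∨ (F ⊆ A ∧ F ⊆ B)) → c (A ∪ B) + c (A ∩ B) < c A + c B

noncomputable def ell (x : Finset α → B) (c : Finset α → ℝ) : B := ∑ F, c F • x F

theorem ell_mem (c : Finset α → ℝ) : ell x c ∈ Vx x :=
  Submodule.sum_mem _ fun F _ => Submodule.smul_mem _ _ (x_mem_Vx F)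

theorem ell_lin (hx : ChowRel R X x) (lam : α → ℝ) : ell x (fun F => ∑ e ∈ F, lam e) = 0 := by
  have h : ∀ e, ∑ F with e ∈ F, x F = 0 := by
    intro e
    by_cases he : e ∈ X
    · exact hx.lin e he
    · refine Finset.sum_eq_zero fun F hF => hx.zero F fun h => he (h.1.1 (Finset.mem_filter.1 hF).2)
  have : ell x (fun F => ∑ e ∈ F, lam e) = ∑ e, lam e • ∑ F with e ∈ F, x F := by
    simp only [ell, Finset.smul_sum, Finset.sum_smul, Finset.sum_filter]
    rw [Finset.sum_comm]
    refine Finset.sum_congr rfl fun F _ => ?_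
    simp [Finset.sum_ite_mem]
  rw [this]; simp [h]

theorem ell_sub (c c' : Finset α → ℝ) : ell x (fun F => c F - c' F) = ell x c - ell x c' := by
  simp [ell, sub_smul]

theorem chn_order (σ : Finset (Finset α)) (hσ : Chn σ) {e g : α} (hne : e ≠ g)
    (h : ∀ F ∈ σ, g ∈ F ↔ e ∈ F) :
    ∃ f : α → ℕ, Function.Injective f ∧ (∀ F ∈ σ, ∀ Y, Ini Y f F) ∧ f e < f g := by
  obtain ⟨N, idx, hinj, hlt, heg⟩ : ∃ (N : ℕ) (idx : α → ℕ), Function.Injective idx ∧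
      (∀ a, idx a < N) ∧ idx e < idx g := by
    let φ := Fintype.equivFin α
    rcases lt_or_gt_of_ne (φ.injective.ne hne) with h1 | h1
    · exact ⟨Fintype.card α, fun a => (φ a).1, fun a b h => φ.injective (Fin.ext h),
        fun a => (φ a).2, h1⟩
    · exact ⟨Fintype.card α, fun a => (φ a).rev.1,
        fun a b h => φ.injective (Fin.rev_injective (Fin.ext h)),
        fun a => (φ a).rev.2, Fin.rev_lt_rev.2 h1⟩
  let L : α → ℕ := fun a => (σ.filter (a ∉ ·)).card
  have key : ∀ a b, L a < L b → N * L a + idx a < N * L b + idx b := by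
    intro a b hab
    have := Nat.mul_le_mul_left N (Nat.succ_le_of_lt hab)
    have := hlt a
    nlinarith
  refine ⟨fun a => N * L a + idx a, ?_, ?_, ?_⟩
  · intro a b hab
    simp only at hab
    rcases lt_trichotomy (L a) (L b) with h1 | h1 | h1
    · have := key _ _ h1; omega
    · rw [h1] at hab; exact hinj (by omega)
    · have := key _ _ h1; omega
  · intro F hF Y a ha b _ hb
    refine key _ _ (Finset.card_lt_card ?_)
    refine Finset.ssubset_iff_subset_ne.2 ⟨?_, ?_⟩
    · intro G hG
      rw [Finset.mem_filter] at hG ⊢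
      refine ⟨hG.1, fun hbG => ?_⟩
      rcases hσ F hF G hG.1 with h1 | h1
      · exact hG.2 (h1 ha)
      · exact hb (h1 hbG)
    · intro heq
      have : F ∈ σ.filter (b ∉ ·) := Finset.mem_filter.2 ⟨hF, hb⟩
      rw [← heq] at this
      exact (Finset.mem_filter.1 this).2 ha
  · have : L e = L g := by
      simp only [L]; congr 1
      refine Finset.filter_congr fun F hF => ?_
      rw [h F hF]
    simp only [this]; omega

section lam
variable (X) (f : α → ℕ) (c : Finset α → ℝ)

noncomputable def lam (e : α) : ℝ := c (X.filter (f · ≤ f e)) - c (X.filter (f · < f e))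

variable {X f c}

theorem ini_max (hf : Function.Injective f) {A : Finset α} (hAX : A ⊆ X) {e : α} (he : e ∈ A)
    (hmax : ∀ a ∈ A, f a ≤ f e) (hA : Ini X f A) :
    A = X.filter (f · ≤ f e) ∧ A.erase e = X.filter (f · < f e) := by
  have h1 : A = X.filter (f · ≤ f e) := by
    ext b
    rw [Finset.mem_filter]
    refine ⟨fun hb => ⟨hAX hb, hmax b hb⟩, fun hb => ?_⟩
    by_contra h
    exact absurd (hA e he b hb.1 h) (not_lt.2 hb.2)
  refine ⟨h1, ?_⟩
  conv_lhs => rw [h1]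
  ext b
  simp only [Finset.mem_erase, Finset.mem_filter]
  constructor
  · rintro ⟨h2, h3, h4⟩; exact ⟨h3, lt_of_le_of_ne h4 fun h => h2 (hf h)⟩
  · rintro ⟨h3, h4⟩; exact ⟨fun h => by simp [h] at h4, h3, h4.le⟩

theorem ini_filter (n : ℕ) : Ini X f (X.filter (f · < n)) := by
  intro a ha b hb hbn
  simp only [Finset.mem_filter, not_and, not_lt] at ha hbn
  exact ha.2.trans_le (hbn hb)

theorem lam_ini (hf : Function.Injective f) (hc : c ∅ = 0) (n : ℕ) : ∀ {A : Finset α}, A.card = n →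
    A ⊆ X → Ini X f A → ∑ e ∈ A, lam X f c e = c A := by
  induction n with
  | zero => intro A hA _ _; rw [Finset.card_eq_zero.1 hA]; simp [hc]
  | succ n ih =>
    intro A hA hAX hAi
    obtain ⟨e, he, hmax⟩ := Finset.exists_max_image A f (Finset.card_pos.1 (by omega))
    obtain ⟨h1, h2⟩ := ini_max hf hAX he hmax hAi
    rw [← Finset.add_sum_erase _ _ he, ih (by rw [Finset.card_erase_of_mem he]; omega)
      ((Finset.erase_subset _ _).trans hAX) (by rw [h2]; exact ini_filter _), lam, ← h1, ← h2]
    ring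

theorem lam_le {σ : Finset (Finset α)} (hf : Function.Injective f) (hc : Am σ X c)
    (hσ : ∀ F ∈ σ, F ⊆ X ∧ Ini X f F) (n : ℕ) : ∀ {A : Finset α}, A.card = n →
    A ⊆ X → (∀ F ∈ σ, F ⊆ A ∨ A ⊆ F) →
    ∑ e ∈ A, lam X f c e ≤ c A ∧ (¬ Ini X f A → ∑ e ∈ A, lam X f c e < c A) := by
  induction n with
  | zero => intro A hA _ _; rw [Finset.card_eq_zero.1 hA]; simp [hc.1, Ini]
  | succ n ih =>
    intro A hA hAX hAc
    by_cases hAi : Ini X f A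
    · exact ⟨(lam_ini hf hc.1 _ rfl hAX hAi).le, fun h => (h hAi).elim⟩
    obtain ⟨e, he, hmax⟩ := Finset.exists_max_image A f (Finset.card_pos.1 (by omega))
    have hAF : ∀ F ∈ σ, e ∈ F → A ⊆ F := fun F hF heF b hb => by
      by_contra h
      exact absurd ((hσ F hF).2 e heF b (hAX hb) h) (not_lt.2 (hmax b hb))
    have hi := (ih (A := A.erase e) (by rw [Finset.card_erase_of_mem he]; omega)
      ((Finset.erase_subset _ _).trans hAX) (by
        intro F hF
        by_cases heF : e ∈ F
        · exact Or.inr ((Finset.erase_subset _ _).trans (hAF F hF heF))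
        · rcases hAc F hF with h | h
          · exact Or.inl fun b hb => Finset.mem_erase.2 ⟨fun hh => heF (hh ▸ hb), h hb⟩
          · exact (heF (h he)).elim)).1
    have e1 : A ∪ X.filter (f · < f e) = X.filter (f · ≤ f e) := by
      ext b
      simp only [Finset.mem_union, Finset.mem_filter]
      constructor
      · rintro (h | h)
        · exact ⟨hAX h, hmax b h⟩
        · exact ⟨h.1, h.2.le⟩
      · rintro ⟨h, h'⟩
        rcases h'.lt_or_eq with h2 | h2
        · exact Or.inr ⟨h, h2⟩
        · exact Or.inl (hf h2 ▸ he)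
    have e2 : A ∩ X.filter (f · < f e) = A.erase e := by
      ext b
      simp only [Finset.mem_inter, Finset.mem_filter, Finset.mem_erase]
      constructor
      · rintro ⟨h, h1, h2⟩; exact ⟨fun hh => by simp [hh] at h2, h⟩
      · rintro ⟨h, h1⟩; exact ⟨h1, hAX h1, lt_of_le_of_ne (hmax b h1) fun hh => h (hf hh)⟩
    have hs := hc.2 A hAX (X.filter (f · < f e)) (Finset.filter_subset _ _)
      (fun h => by have := (Finset.mem_filter.1 (h he)).2; omega)
      (fun h => hAi (by
        have : A = X.filter (f · ≤ f e) := by rw [← e1]; exact (Finset.union_eq_left.2 h).symm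
        rw [this]
        simpa [Nat.lt_succ_iff] using ini_filter (X := X) (f := f) (f e + 1)))
      (by
        intro F hF
        by_cases heF : e ∈ F
        · refine Or.inl ⟨hAF F hF heF, fun b hb => ?_⟩
          by_contra h
          have := (hσ F hF).2 e heF b (Finset.mem_filter.1 hb).1 h
          have := (Finset.mem_filter.1 hb).2
          omega
        · rcases hAc F hF with h | h
          · refine Or.inr ⟨h, fun b hb => Finset.mem_filter.2 ⟨(hσ F hF).1 hb,
              (hσ F hF).2 b hb e (hAX he) heF⟩⟩
          · exact (heF (h he)).elim)
    rw [e1, e2] at hs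
    have : ∑ e ∈ A, lam X f c e < c A := by
      rw [← Finset.add_sum_erase _ _ he, lam]
      linarith
    exact ⟨this.le, fun _ => this⟩
end lam

theorem chn_max {T : Finset (Finset α)} (hT : Chn T) {G : Finset α} (hG : G.Nonempty)
    (h : ∀ F ∈ T, F ⊂ G) : ∃ g ∈ G, ∀ F ∈ T, g ∉ F := by
  rcases T.eq_empty_or_nonempty with rfl | hTn
  · obtain ⟨g, hg⟩ := hG; exact ⟨g, hg, by simp⟩
  obtain ⟨F, hF, hmax⟩ := Finset.exists_max_image T Finset.card hTn
  obtain ⟨g, hg, hgF⟩ := Finset.exists_of_ssubset (h F hF)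
  refine ⟨g, hg, fun F' hF' hgF' => hgF ?_⟩
  rcases hT F hF F' hF' with h1 | h1
  · rw [Finset.eq_of_subset_of_card_le h1 (hmax F' hF')]; exact hgF'
  · exact h1 hgF'

theorem chn_min {T : Finset (Finset α)} (hT : Chn T) {G X : Finset α} (hG : G ⊂ X)
    (h : ∀ F ∈ T, G ⊂ F ∧ F ⊆ X) : ∃ g ∈ X, g ∉ G ∧ ∀ F ∈ T, g ∈ F := by
  rcases T.eq_empty_or_nonempty with rfl | hTn
  · obtain ⟨g, hg, hg'⟩ := Finset.exists_of_ssubset hG; exact ⟨g, hg, hg', by simp⟩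
  obtain ⟨F, hF, hmin⟩ := Finset.exists_min_image T Finset.card hTn
  obtain ⟨g, hg, hgF⟩ := Finset.exists_of_ssubset (h F hF).1
  refine ⟨g, (h F hF).2 hg, hgF, fun F' hF' => ?_⟩
  rcases hT F hF F' hF' with h1 | h1
  · exact h1 hg
  · rw [Finset.eq_of_subset_of_card_le h1 (hmin F' hF')]; exact hg

/-- the index set of flats refining the flag -/
noncomputable def Sig (R : RkFn α) (X : Finset α) (σ : Finset (Finset α)) : Finset (Finset α) :=
  Finset.univ.filter fun G => R.Flat X G ∧ G.Nonempty ∧ G ≠ X ∧ G ∉ σ ∧ ∀ F ∈ σ, F ⊆ G ∨ G ⊆ F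

theorem ell_prod (hx : ChowRel R X x) (D : B →ₗ[ℝ] ℝ) {σ : Finset (Finset α)}
    (c : Finset α → ℝ) (f : α → ℕ) (hf : Function.Injective f) (hc : c ∅ = 0)
    (hσ : ∀ F ∈ σ, F ⊆ X ∧ Ini X f F) (p : B) :
    D ((∏ F ∈ σ, x F) * (ell x c * p)) =
      ∑ G ∈ Sig R X σ, (c G - ∑ e ∈ G, lam X f c e) * D ((∏ F ∈ σ, x F) * (x G * p)) := by
  have h1 : ell x c = ell x (fun G => c G - ∑ e ∈ G, lam X f c e) := by
    rw [ell_sub, ell_lin hx, sub_zero]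
  rw [h1, ell, Finset.sum_mul, Finset.mul_sum, map_sum]
  have h2 : ∀ G, D ((∏ F ∈ σ, x F) * ((c G - ∑ e ∈ G, lam X f c e) • x G * p)) =
      (c G - ∑ e ∈ G, lam X f c e) * D ((∏ F ∈ σ, x F) * (x G * p)) := by
    intro G; simp
  simp only [h2]
  symm
  refine Finset.sum_subset (Finset.subset_univ _) fun G _ hG => ?_
  by_cases hfl : R.Flat X G ∧ G.Nonempty
  swap
  · simp [hx.zero G hfl]
  by_cases hini : G = X ∨ G ∈ σ
  · rw [lam_ini hf hc _ rfl hfl.1.1, sub_self, zero_mul]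
    rcases hini with rfl | h
    · exact fun a _ b hb hb' => (hb' hb).elim
    · exact (hσ G h).2
  have hinc : ∃ F ∈ σ, ¬ F ⊆ G ∧ ¬ G ⊆ F := by
    by_contra hcon
    refine hG (Finset.mem_filter.2 ⟨Finset.mem_univ _, hfl.1, hfl.2, fun h => hini (Or.inl h),
      fun h => hini (Or.inr h), fun F hF => ?_⟩)
    by_contra h3
    exact hcon ⟨F, hF, not_or.1 h3⟩
  obtain ⟨F, hF, h3, h4⟩ := hinc
  rw [← Finset.mul_prod_erase _ _ hF]
  have : x F * (∏ F ∈ σ.erase F, x F) * (x G * p) = (x F * x G) * ((∏ F ∈ σ.erase F, x F) * p) := by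
    ring
  rw [this, hx.mul F G h3 h4]; simp

/-- flags of proper nonempty flats -/
def Flg (R : RkFn α) (X : Finset α) (σ : Finset (Finset α)) : Prop :=
  (∀ F ∈ σ, R.Flat X F ∧ F.Nonempty ∧ F ≠ X) ∧ Chn σ

theorem ample_gen (hx : ChowRel R X x) (D : B →ₗ[ℝ] ℝ) {σ : Finset (Finset α)} (hσ : Flg R X σ) :
    ∀ v ∈ Vx x, ∃ c : Finset α → ℝ, ∀ p, mD D (∏ F ∈ σ, x F) (v * p) =
      ∑ G ∈ Sig R X σ, c G * mD D (∏ F ∈ σ, x F) (x G * p) := by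
  have hord : ∃ f : α → ℕ, Function.Injective f ∧ ∀ F ∈ σ, ∀ Y, Ini Y f F := by
    by_cases hS : ∃ e g : α, e ≠ g ∧ ∀ F ∈ σ, g ∈ F ↔ e ∈ F
    · obtain ⟨e, g, h1, h2⟩ := hS
      obtain ⟨f, hf, hf', -⟩ := chn_order σ hσ.2 h1 h2
      exact ⟨f, hf, hf'⟩
    · refine ⟨fun a => (σ.filter (a ∉ ·)).card, ?_, ?_⟩
      · intro a b hab
        by_contra hne
        refine hS ⟨a, b, hne, fun F hF => ?_⟩
        by_contra hcon
        have hlt : ∀ a b, a ∈ F → b ∉ F → (σ.filter (a ∉ ·)).card < (σ.filter (b ∉ ·)).card := by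
          intro a b ha hb
          refine Finset.card_lt_card (Finset.ssubset_iff_subset_ne.2 ⟨?_, ?_⟩)
          · intro G hG
            rw [Finset.mem_filter] at hG ⊢
            refine ⟨hG.1, fun hbG => ?_⟩
            rcases hσ.2 F hF G hG.1 with h1 | h1
            · exact hG.2 (h1 ha)
            · exact hb (h1 hbG)
          · intro heq
            have : F ∈ σ.filter (b ∉ ·) := Finset.mem_filter.2 ⟨hF, hb⟩
            rw [← heq] at this
            exact (Finset.mem_filter.1 this).2 ha
        simp only at hab
        by_cases ha : a ∈ F
        · have := hlt a b ha (fun hb => hcon ⟨fun _ => ha, fun _ => hb⟩); omega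
        · have := hlt b a (by tauto) ha; omega
      · intro F hF Y a ha b _ hb
        refine Finset.card_lt_card (Finset.ssubset_iff_subset_ne.2 ⟨?_, ?_⟩)
        · intro G hG
          rw [Finset.mem_filter] at hG ⊢
          refine ⟨hG.1, fun hbG => ?_⟩
          rcases hσ.2 F hF G hG.1 with h1 | h1
          · exact hG.2 (h1 ha)
          · exact hb (h1 hbG)
        · intro heq
          have : F ∈ σ.filter (b ∉ ·) := Finset.mem_filter.2 ⟨hF, hb⟩
          rw [← heq] at this
          exact (Finset.mem_filter.1 this).2 ha
  obtain ⟨f, hf, hf'⟩ := hord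
  intro v hv
  have : ∃ c : Finset α → ℝ, c ∅ = 0 ∧ v = ell x c := by
    refine Submodule.span_induction (p := fun v _ => ∃ c : Finset α → ℝ, c ∅ = 0 ∧ v = ell x c)
      ?_ ⟨0, rfl, by simp [ell]⟩ ?_ ?_ hv
    · rintro _ ⟨F, rfl⟩
      by_cases hF : F = ∅
      · exact ⟨0, rfl, by rw [hx.zero F (fun h => h.2.ne_empty hF)]; simp [ell]⟩
      · exact ⟨Pi.single F 1, Pi.single_eq_of_ne (Ne.symm hF) _, by simp [ell, Pi.single_apply]⟩
    · rintro _ _ _ _ ⟨c, h, rfl⟩ ⟨c', h', rfl⟩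
      exact ⟨c + c', by simp [h, h'], by simp [ell, add_smul, Finset.sum_add_distrib]⟩
    · rintro a _ _ ⟨c, h, rfl⟩
      exact ⟨a • c, by simp [h], by simp [ell, Finset.smul_sum, mul_smul]⟩
  obtain ⟨c, hc, rfl⟩ := this
  exact ⟨_, fun p => ell_prod hx D c f hf hc (fun F hF => ⟨(hσ.1 F hF).1.1, hf' F hF X⟩) p⟩

theorem ample_pos (hx : ChowRel R X x) (D : B →ₗ[ℝ] ℝ) {σ : Finset (Finset α)} (hσ : Flg R X σ)
    {c : Finset α → ℝ} (hc : Am σ X c) : ∀ G₀ ∈ Sig R X σ,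
    ∃ c' : Finset α → ℝ, (∀ G ∈ Sig R X σ, 0 ≤ c' G) ∧ 0 < c' G₀ ∧
      ∀ p, mD D (∏ F ∈ σ, x F) (ell x c * p) =
      ∑ G ∈ Sig R X σ, c' G * mD D (∏ F ∈ σ, x F) (x G * p) := by
  intro G₀ hG₀
  obtain ⟨-, hfl, hne, hX, hns, hcomp⟩ := Finset.mem_filter.1 hG₀
  obtain ⟨g, hg, hg'⟩ := chn_max (T := σ.filter (· ⊂ G₀)) (fun F hF G hG =>
    hσ.2 F (Finset.mem_filter.1 hF).1 G (Finset.mem_filter.1 hG).1) hne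
    (fun F hF => (Finset.mem_filter.1 hF).2)
  obtain ⟨e, heX, he, he'⟩ := chn_min (T := σ.filter (G₀ ⊂ ·)) (fun F hF G hG =>
    hσ.2 F (Finset.mem_filter.1 hF).1 G (Finset.mem_filter.1 hG).1)
    (Finset.ssubset_iff_subset_ne.2 ⟨hfl.1, hX⟩)
    (fun F hF => ⟨(Finset.mem_filter.1 hF).2, (hσ.1 F (Finset.mem_filter.1 hF).1).1.1⟩)
  have hlev : ∀ F ∈ σ, g ∈ F ↔ e ∈ F := by
    intro F hF
    have hneF : F ≠ G₀ := fun h => hns (h ▸ hF)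
    rcases hcomp F hF with h | h
    · exact ⟨fun h1 => absurd h1 (hg' F (Finset.mem_filter.2 ⟨hF, Finset.ssubset_iff_subset_ne.2
        ⟨h, hneF⟩⟩)), fun h1 => absurd (h h1) he⟩
    · exact ⟨fun _ => he' F (Finset.mem_filter.2 ⟨hF, Finset.ssubset_iff_subset_ne.2
        ⟨h, hneF.symm⟩⟩), fun _ => h hg⟩
  obtain ⟨f, hf, hf', hlt⟩ := chn_order σ hσ.2 (fun h => he (h ▸ hg) : e ≠ g) hlev
  have hle := fun {A : Finset α} => lam_le hf hc
    (fun F hF => ⟨(hσ.1 F hF).1.1, hf' F hF X⟩) _ (A := A) rfl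
  refine ⟨fun G => c G - ∑ e ∈ G, lam X f c e, fun G hG => ?_, ?_, fun p =>
    ell_prod hx D c f hf hc.1 (fun F hF => ⟨(hσ.1 F hF).1.1, hf' F hF X⟩) p⟩
  · obtain ⟨-, h1, -, -, -, h2⟩ := Finset.mem_filter.1 hG
    exact sub_nonneg.2 (hle h1.1 h2).1
  · refine sub_pos.2 ((hle hfl.1 hcomp).2 fun hini => ?_)
    exact absurd (hini g hg e heX he) (not_lt.2 hlt.le)

end AHK

namespace AHK

section md
variable {A : Type*} [CommRing A] [Algebra ℝ A]

/-- elements congruent to `T` after multiplication by `z` -/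
def Md (z : A) (T : Submodule ℝ A) : Submodule ℝ A where
  carrier := {v | ∃ w ∈ T, z * v = z * w}
  add_mem' := by
    rintro a b ⟨w, hw, h⟩ ⟨w', hw', h'⟩
    exact ⟨w + w', T.add_mem hw hw', by rw [mul_add, mul_add, h, h']⟩
  zero_mem' := ⟨0, T.zero_mem, rfl⟩
  smul_mem' := by
    rintro c a ⟨w, hw, h⟩
    exact ⟨c • w, T.smul_mem c hw, by rw [mul_smul_comm, mul_smul_comm, h]⟩

theorem mem_Md {z v : A} {T : Submodule ℝ A} : v ∈ Md z T ↔ ∃ w ∈ T, z * v = z * w := Iff.rfl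

theorem Md_le {z : A} {T : Submodule ℝ A} : T ≤ Md z T := fun v hv => ⟨v, hv, rfl⟩

theorem Md_zero {z v : A} {T : Submodule ℝ A} (h : z * v = 0) : v ∈ Md z T :=
  ⟨0, T.zero_mem, by rw [h, mul_zero]⟩

theorem Md_mul {z v u : A} {T T' : Submodule ℝ A} (hv : v ∈ Md z T)
    (h : ∀ w ∈ T, w * u ∈ Md z T') : v * u ∈ Md z T' := by
  obtain ⟨w, hw, e⟩ := hv
  obtain ⟨w', hw', e'⟩ := h w hw
  exact ⟨w', hw', by rw [← e', ← mul_assoc, e, mul_assoc]⟩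

theorem Md_congr {z v v' : A} {T : Submodule ℝ A} (h : z * v = z * v') (hv : v' ∈ Md z T) :
    v ∈ Md z T := by
  obtain ⟨w, hw, e⟩ := hv
  exact ⟨w, hw, h.trans e⟩

/-- the degree `k` target -/
def TT (V' S : Submodule ℝ A) (k : ℕ) : Submodule ℝ A := V' ^ k ⊔ S * Wm V' k

theorem TT_left {V' S : Submodule ℝ A} {k : ℕ} {a : A} (h : a ∈ V' ^ k) : a ∈ TT V' S k :=
  Submodule.mem_sup_left h

theorem TT_right {V' S : Submodule ℝ A} {k : ℕ} {s b : A} (hs : s ∈ S) (h : b ∈ Wm V' k) :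
    s * b ∈ TT V' S k := Submodule.mem_sup_right (Submodule.mul_mem_mul hs h)

theorem TT_ind {V' S : Submodule ℝ A} {k : ℕ} {P : Submodule ℝ A}
    (h1 : ∀ a ∈ V' ^ k, a ∈ P) (h2 : ∀ s ∈ S, ∀ b ∈ Wm V' k, s * b ∈ P) : TT V' S k ≤ P :=
  sup_le h1 (Submodule.mul_le.2 h2)

theorem TT_pow {V V' S : Submodule ℝ A} {z : A} (h1 : ∀ v ∈ V, v ∈ Md z (V' ⊔ S))
    (h2 : ∀ s ∈ S, ∀ t ∈ S, s * t ∈ Md z (TT V' S 2)) (k : ℕ) :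
    ∀ a ∈ V ^ k, a ∈ Md z (TT V' S k) := by
  induction k with
  | zero => intro a ha; exact Md_le (TT_left (by simpa using ha))
  | succ k ih =>
    intro a ha
    rw [pow_succ'] at ha
    refine Submodule.mul_induction_on ha ?_ fun a b ha hb => Submodule.add_mem _ ha hb
    intro v hv a ha
    refine Md_mul (h1 v hv) fun w hw => ?_
    rw [mul_comm]
    refine Md_mul (ih a ha) ?_
    suffices TT V' S k ≤ (Md z (TT V' S (k + 1))).comap (LinearMap.mulLeft ℝ w) by
      intro b hb
      have := this hb
      simpa [mul_comm] using this
    obtain ⟨w₁, hw₁, s₁, hs₁, rfl⟩ := Submodule.mem_sup.1 hw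
    refine TT_ind ?_ ?_
    · intro b hb
      simp only [Submodule.mem_comap, LinearMap.mulLeft_apply, add_mul]
      exact Md_le (Submodule.add_mem _ (TT_left (mul_mem_pow_succ hw₁ hb)) (TT_right hs₁ hb))
    · intro s hs b hb
      simp only [Submodule.mem_comap, LinearMap.mulLeft_apply, add_mul]
      refine Submodule.add_mem _ ?_ ?_
      · rw [show w₁ * (s * b) = s * (w₁ * b) by ring]
        exact Md_le (TT_right hs (mul_Wm hw₁ hb))
      · cases k with
        | zero => rw [Wm_zero hb]; simp
        | succ k =>
          rw [← mul_assoc]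
          refine Md_mul (h2 s₁ hs₁ s hs) ?_
          suffices TT V' S 2 ≤ (Md z (TT V' S (k + 1 + 1))).comap (LinearMap.mulLeft ℝ b) by
            intro b' hb'
            have := this hb'
            simpa [mul_comm] using this
          refine TT_ind ?_ ?_
          · intro a ha
            exact Md_le (TT_left (mem_of_add (show b ∈ V' ^ k from hb) ha (by omega)))
          · intro s hs c hc
            simp only [Submodule.mem_comap, LinearMap.mulLeft_apply]
            rw [show b * (s * c) = s * (c * b) by ring]
            exact Md_le (TT_right hs (Wm_mul hc (show b ∈ V' ^ k from hb) (by omega)))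

theorem TT_extract {V' : Submodule ℝ A} {ι : Type*} {J : Finset ι} {x : ι → A} {k : ℕ} :
    ∀ a ∈ TT V' (Submodule.span ℝ (Set.image x J)) k, ∃ b ∈ V' ^ k, ∃ c : ι → A,
      (∀ j ∈ J, c j ∈ Wm V' k) ∧ a = b + ∑ j ∈ J, x j * c j := by
  classical
  intro a ha
  obtain ⟨b, hb, a', ha', rfl⟩ := Submodule.mem_sup.1 ha
  refine ⟨b, hb, ?_⟩
  suffices ∃ c : ι → A, (∀ j ∈ J, c j ∈ Wm V' k) ∧ a' = ∑ j ∈ J, x j * c j by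
    obtain ⟨c, hc, rfl⟩ := this; exact ⟨c, hc, rfl⟩
  have hadd : ∀ p q : A, (∃ c : ι → A, (∀ j ∈ J, c j ∈ Wm V' k) ∧ p = ∑ j ∈ J, x j * c j) →
      (∃ c : ι → A, (∀ j ∈ J, c j ∈ Wm V' k) ∧ q = ∑ j ∈ J, x j * c j) →
      (∃ c : ι → A, (∀ j ∈ J, c j ∈ Wm V' k) ∧ p + q = ∑ j ∈ J, x j * c j) := by
    rintro p q ⟨c, hc, rfl⟩ ⟨c', hc', rfl⟩
    exact ⟨fun j => c j + c' j, fun j hj => Submodule.add_mem _ (hc j hj) (hc' j hj), by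
      simp [mul_add, Finset.sum_add_distrib]⟩
  refine Submodule.mul_induction_on ha' ?_ hadd
  intro s hs w hw
  refine Submodule.span_induction (p := fun s _ => ∃ c : ι → A, (∀ j ∈ J, c j ∈ Wm V' k) ∧
    s * w = ∑ j ∈ J, x j * c j) ?_ ?_ ?_ ?_ hs
  · rintro _ ⟨j, hj, rfl⟩
    refine ⟨fun j' => if j' = j then w else 0, fun j' _ => ?_, ?_⟩
    · dsimp only; split_ifs
      · exact hw
      · exact Submodule.zero_mem _
    · rw [Finset.sum_eq_single j]
      · simp
      · intro b _ hb; simp [hb]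
      · intro h; exact (h hj).elim
  · exact ⟨fun _ => 0, fun _ _ => Submodule.zero_mem _, by simp⟩
  · intro p q _ _ hp hq
    rw [add_mul]; exact hadd _ _ hp hq
  · rintro t p _ ⟨c, hc, h⟩
    exact ⟨fun j => t • c j, fun j hj => Submodule.smul_mem _ _ (hc j hj), by
      rw [smul_mul_assoc, h, Finset.smul_sum]; simp⟩
end md

variable {α : Type*} [Fintype α] [DecidableEq α] {B : Type*} [CommRing B] [Algebra ℝ B]
variable {R : RkFn α} {X : Finset α} {x : Finset α → B}

noncomputable def Js (R : RkFn α) (X Fm : Finset α) (i : α) : Finset (Finset α) :=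
  Finset.univ.filter fun F => R.Flat X F ∧ Fm ⊂ F ∧ i ∉ F ∧ R.Flat X (insert i F) ∧ insert i F ≠ X

def VV (x : Finset α → B) (X : Finset α) (i : α) : Submodule ℝ B :=
  Vx (thx (X.erase i) x) ⊔ Submodule.span ℝ {x (X.erase i)}

def SJ (R : RkFn α) (x : Finset α → B) (X Fm : Finset α) (i : α) : Submodule ℝ B :=
  Submodule.span ℝ (Set.image (fun F => x (insert i F)) (Js R X Fm i : Set (Finset α)))

theorem VV_le {i : α} : VV x X i ≤ Vx x :=
  sup_le thx_le (Submodule.span_le.2 (by rintro _ rfl; exact x_mem_Vx _))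

theorem thx_VV {i : α} (G : Finset α) : thx (X.erase i) x G ∈ VV x X i :=
  Submodule.mem_sup_left (x_mem_Vx G)

theorem lin_pair (hx : ChowRel R X x) {a i : α} (ha : a ∈ X) (hi : i ∈ X) :
    ∑ K, ((if a ∈ K then (1:ℝ) else 0) - (if i ∈ K then 1 else 0)) • x K = 0 := by
  have h1 := hx.lin a ha
  have h2 := hx.lin i hi
  rw [Finset.sum_filter] at h1 h2
  simp only [sub_smul, Finset.sum_sub_distrib, ite_smul, one_smul, zero_smul, h1, h2, sub_zero]

section caseB
variable {i : α} {Fm : Finset α} {z : B}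

theorem g1a (hx : ChowRel R X x) (hi : i ∈ X) (hX' : (X.erase i).Nonempty) (hiF : i ∉ Fm)
    (hz : ∀ K, ¬ Fm ⊆ K → ¬ K ⊆ Fm → z * x K = 0) {K : Finset α} (hK : i ∈ K)
    (hKF : K ≠ insert i Fm) : x K ∈ Md z (VV x X i ⊔ SJ R x X Fm i) := by
  by_cases hfl : R.Flat X K ∧ K.Nonempty
  swap
  · rw [hx.zero K hfl]; exact Submodule.zero_mem _
  by_cases hFK : Fm ⊆ K
  swap
  · exact Md_zero (hz K hFK fun h => hiF (h hK))
  refine Md_le ?_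
  by_cases hKX : K = X
  · have h := thx_erase hx hi hX' (Finset.notMem_erase i X) (Finset.erase_subset i X)
    rw [Finset.insert_erase hi] at h
    rw [hKX, show x X = thx (X.erase i) x (X.erase i) - x (X.erase i) by rw [h]; ring]
    exact Submodule.mem_sup_left (Submodule.sub_mem _ (thx_VV _)
      (Submodule.mem_sup_right (Submodule.mem_span_singleton_self _)))
  have hne : Fm ≠ K.erase i := fun h => hKF (by rw [h, Finset.insert_erase hK])
  have hss : Fm ⊂ K.erase i := Finset.ssubset_iff_subset_ne.2
    ⟨fun a ha => Finset.mem_erase.2 ⟨fun h => hiF (h ▸ ha), hFK ha⟩, hne⟩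
  have hn : (K.erase i).Nonempty := by
    obtain ⟨a, ha, _⟩ := Finset.exists_of_ssubset hss; exact ⟨a, ha⟩
  by_cases hfl' : R.Flat X (K.erase i)
  · refine Submodule.mem_sup_right (Submodule.subset_span ⟨K.erase i, ?_, by
      simp [Finset.insert_erase hK]⟩)
    simp only [Js, Finset.coe_filter, Finset.mem_univ, true_and, Set.mem_setOf_eq]
    rw [Finset.insert_erase hK]
    exact ⟨hfl', hss, Finset.notMem_erase _ _, hfl.1, hKX⟩
  · have h := thx_erase hx hi hn (Finset.notMem_erase i K) ((Finset.erase_subset i K).trans hfl.1.1)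
    rw [Finset.insert_erase hK, hx.zero (K.erase i) (fun h => hfl' h.1), zero_add] at h
    rw [← h]
    exact Submodule.mem_sup_left (thx_VV _)

theorem g1 (hx : ChowRel R X x) (hi : i ∈ X) (hX' : (X.erase i).Nonempty) (hiF : i ∉ Fm)
    (hz : ∀ K, ¬ Fm ⊆ K → ¬ K ⊆ Fm → z * x K = 0) (K : Finset α) :
    x K ∈ Md z (VV x X i ⊔ SJ R x X Fm i) := by
  have hin : ∀ K, i ∈ K → x K ∈ Md z (VV x X i ⊔ SJ R x X Fm i) := by
    intro K hK
    by_cases h : K = insert i Fm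
    · have hl := hx.lin i hi
      rw [← Finset.add_sum_erase _ _ (Finset.mem_filter.2 ⟨Finset.mem_univ K, hK⟩)] at hl
      rw [eq_neg_of_add_eq_zero_left hl]
      refine Submodule.neg_mem _ (Submodule.sum_mem _ fun K' hK' => ?_)
      rw [Finset.mem_erase, Finset.mem_filter] at hK'
      exact g1a hx hi hX' hiF hz hK'.2.2 (h ▸ hK'.1)
    · exact g1a hx hi hX' hiF hz hK h
  by_cases hK : i ∈ K
  · exact hin K hK
  by_cases hfl : R.Flat X K ∧ K.Nonempty
  swap
  · rw [hx.zero K hfl]; exact Submodule.zero_mem _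
  have h := thx_erase hx hi hfl.2 hK hfl.1.1
  rw [show x K = thx (X.erase i) x K - x (insert i K) by rw [h]; ring]
  exact Submodule.sub_mem _ (Md_le (Submodule.mem_sup_left (thx_VV _)))
    (hin _ (Finset.mem_insert_self _ _))

theorem xH_thx (hx : ChowRel R X x) (hi : i ∈ X) {F K : Finset α} (hF : F ∈ Js R X Fm i)
    (hK : i ∈ K) (hKF : K ⊂ insert i F) : x K * x (insert i F) = x K * thx (X.erase i) x F := by
  obtain ⟨-, h1, h2, h3, h4, h5⟩ := Finset.mem_filter.1 hF
  have hn : F.Nonempty := by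
    obtain ⟨a, ha, _⟩ := Finset.exists_of_ssubset h2; exact ⟨a, ha⟩
  rw [thx_erase hx hi hn h3 h1.1, mul_add, hx.mul K F (fun h => h3 (h hK))
    (fun h => hKF.2 (Finset.insert_subset hK h)), zero_add]

theorem xHH_thx (hx : ChowRel R X x) (hi : i ∈ X) {F F' : Finset α} (hF' : F' ∈ Js R X Fm i)
    (hiF : i ∉ F) (h : F ⊂ F') :
    x (insert i F) * x (insert i F') = x (insert i F) * thx (X.erase i) x F' := by
  obtain ⟨-, h1, h2, h3, h4, h5⟩ := Finset.mem_filter.1 hF'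
  refine xH_thx hx hi hF' (Finset.mem_insert_self _ _) ?_
  refine Finset.ssubset_iff_subset_ne.2 ⟨Finset.insert_subset_insert _ h.1, fun h' => h.2 ?_⟩
  rw [← Finset.erase_insert hiF, h', Finset.erase_insert h3]

theorem g2 (hx : ChowRel R X x) (hi : i ∈ X) (hX' : (X.erase i).Nonempty) (hiF : i ∉ Fm)
    (hz : ∀ K, ¬ Fm ⊆ K → ¬ K ⊆ Fm → z * x K = 0) {F F' : Finset α} (hF : F ∈ Js R X Fm i)
    (hF' : F' ∈ Js R X Fm i) :
    x (insert i F) * x (insert i F') ∈ Md z (TT (VV x X i) (SJ R x X Fm i) 2) := by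
  have hS : ∀ F ∈ Js R X Fm i, x (insert i F) ∈ SJ R x X Fm i := fun F hF =>
    Submodule.subset_span ⟨F, hF, rfl⟩
  have hW : ∀ G, thx (X.erase i) x G ∈ Wm (VV x X i) 2 := fun G => by
    change _ ∈ VV x X i ^ 1
    rw [pow_one]; exact thx_VV G
  have hmulW : ∀ K G, x K * thx (X.erase i) x G ∈ Md z (TT (VV x X i) (SJ R x X Fm i) 2) := by
    intro K G
    refine Md_mul (g1 hx hi hX' hiF hz K) fun w hw => Md_le ?_
    obtain ⟨w₁, hw₁, s₁, hs₁, rfl⟩ := Submodule.mem_sup.1 hw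
    rw [add_mul]
    refine Submodule.add_mem _ (TT_left ?_) (TT_right hs₁ (hW G))
    rw [pow_two]; exact Submodule.mul_mem_mul hw₁ (thx_VV G)
  have hlt : ∀ F F', F ∈ Js R X Fm i → F' ∈ Js R X Fm i → F ⊂ F' →
      x (insert i F) * x (insert i F') ∈ Md z (TT (VV x X i) (SJ R x X Fm i) 2) := by
    intro F F' hF hF' h
    rw [xHH_thx hx hi hF' (Finset.mem_filter.1 hF).2.2.2.1 h]
    exact hmulW _ _
  obtain ⟨-, h1, h2, h3, h4, h5⟩ := Finset.mem_filter.1 hF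
  obtain ⟨-, h1', h2', h3', h4', h5'⟩ := Finset.mem_filter.1 hF'
  by_cases hFF : F = F'
  · subst hFF
    have hn : F.Nonempty := by
      obtain ⟨a, ha, _⟩ := Finset.exists_of_ssubset h2; exact ⟨a, ha⟩
    -- elements strictly below
    have hbelow_i : ∀ K, i ∈ K → K ⊂ insert i F →
        x K * x (insert i F) ∈ Md z (TT (VV x X i) (SJ R x X Fm i) 2) := by
      intro K hK hKF
      rw [xH_thx hx hi hF hK hKF]; exact hmulW _ _
    have hbelow : ∀ K, K ⊂ insert i F → K ≠ F →
        x K * x (insert i F) ∈ Md z (TT (VV x X i) (SJ R x X Fm i) 2) := by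
      intro K hK hKF
      by_cases hiK : i ∈ K
      · exact hbelow_i K hiK hK
      by_cases hKn : K.Nonempty
      swap
      · rw [hx.zero K (fun h => hKn h.2), zero_mul]; exact Submodule.zero_mem _
      have hKF' : K ⊆ F := fun a ha => (Finset.mem_insert.1 (hK.1 ha)).resolve_left
        fun h => hiK (h ▸ ha)
      have h := thx_erase hx hi hKn hiK (hKF'.trans h1.1)
      rw [show x K = thx (X.erase i) x K - x (insert i K) by rw [h]; ring, sub_mul]
      refine Submodule.sub_mem _ ?_ (hbelow_i _ (Finset.mem_insert_self _ _) ?_)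
      · rw [mul_comm]; exact hmulW _ _
      · refine Finset.ssubset_iff_subset_ne.2 ⟨Finset.insert_subset_insert _ hKF', fun h' => hKF ?_⟩
        rw [← Finset.erase_insert hiK, h', Finset.erase_insert h3]
    obtain ⟨a, ha⟩ := hn
    have hl := lin_pair hx (h1.1 ha) hi
    rw [← Finset.add_sum_erase _ _ (Finset.mem_univ F), if_pos ha, if_neg h3, sub_zero, one_smul]
      at hl
    have hFH : x F * x (insert i F) ∈ Md z (TT (VV x X i) (SJ R x X Fm i) 2) := by
      rw [eq_neg_of_add_eq_zero_left hl, neg_mul, Finset.sum_mul]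
      refine Submodule.neg_mem _ (Submodule.sum_mem _ fun K hK => ?_)
      rw [smul_mul_assoc]
      by_cases hHK : insert i F ⊆ K
      · rw [if_pos (hHK (Finset.mem_insert_of_mem ha)), if_pos (hHK (Finset.mem_insert_self _ _))]
        simp
      refine Submodule.smul_mem _ _ ?_
      by_cases hKH : K ⊆ insert i F
      · exact hbelow K ⟨hKH, hHK⟩ (Finset.mem_erase.1 hK).1
      · rw [hx.mul _ _ hKH hHK]; exact Submodule.zero_mem _
    have h := thx_erase hx hi ⟨a, ha⟩ h3 h1.1
    have e : x (insert i F) * x (insert i F) =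
        x (insert i F) * thx (X.erase i) x F - x F * x (insert i F) := by rw [h]; ring
    rw [e]
    exact Submodule.sub_mem _ (hmulW _ _) hFH
  · by_cases h : F ⊆ F'
    · exact hlt F F' hF hF' (Finset.ssubset_iff_subset_ne.2 ⟨h, hFF⟩)
    by_cases h' : F' ⊆ F
    · rw [mul_comm]
      exact hlt F' F hF' hF (Finset.ssubset_iff_subset_ne.2 ⟨h', Ne.symm hFF⟩)
    · rw [hx.mul]
      · exact Submodule.zero_mem _
      · exact fun hh => h fun a ha => (Finset.mem_insert.1 (hh (Finset.mem_insert_of_mem ha))).resolve_left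
          fun e => h3 (e ▸ ha)
      · exact fun hh => h' fun a ha => (Finset.mem_insert.1 (hh (Finset.mem_insert_of_mem ha))).resolve_left
          fun e => h3' (e ▸ ha)

theorem s1_all (hx : ChowRel R X x) (hi : i ∈ X) (hX' : (X.erase i).Nonempty) (hiF : i ∉ Fm)
    (hz : ∀ K, ¬ Fm ⊆ K → ¬ K ⊆ Fm → z * x K = 0) (k : ℕ) :
    ∀ a ∈ Vx x ^ k, ∃ b ∈ VV x X i ^ k, ∃ c : Finset α → B, (∀ j ∈ Js R X Fm i, c j ∈ Wm (VV x X i) k) ∧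
      z * a = z * (b + ∑ j ∈ Js R X Fm i, x (insert i j) * c j) := by
  intro a ha
  obtain ⟨w, hw, e⟩ := TT_pow (V := Vx x) (V' := VV x X i) (S := SJ R x X Fm i) (z := z) (by
      intro v hv
      exact (Submodule.span_le.2 (by rintro _ ⟨K, rfl⟩; exact g1 hx hi hX' hiF hz K) :
        Vx x ≤ Md z (VV x X i ⊔ SJ R x X Fm i)) hv) (by
      intro s hs t ht
      have : SJ R x X Fm i * SJ R x X Fm i ≤ Md z (TT (VV x X i) (SJ R x X Fm i) 2) := by
        rw [SJ, Submodule.span_mul_span, Submodule.span_le]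
        rintro _ ⟨_, ⟨F, hF, rfl⟩, _, ⟨F', hF', rfl⟩, rfl⟩
        exact g2 hx hi hX' hiF hz hF hF'
      exact this (Submodule.mul_mem_mul hs ht)) k a ha
  obtain ⟨b, hb, c, hc, rfl⟩ := TT_extract (x := fun F => x (insert i F)) w hw
  exact ⟨b, hb, c, hc, e⟩

theorem s2_all (hx : ChowRel R X x) (hi : i ∈ X) {F : Finset α} (hF : F ∈ Js R X Fm i) (k : ℕ) :
    ∀ a ∈ Vx x ^ k, ∃ b ∈ VV x X i ^ k,
      (x F * x (insert i F)) * a = (x F * x (insert i F)) * b := by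
  obtain ⟨-, h1, h2, h3, h4, h5⟩ := Finset.mem_filter.1 hF
  have hn : F.Nonempty := by
    obtain ⟨a, ha, _⟩ := Finset.exists_of_ssubset h2; exact ⟨a, ha⟩
  set z := x F * x (insert i F) with hz
  have hlow : ∀ G, G ⊂ F → x G ∈ Md z (VV x X i) := by
    intro G hG
    by_cases hGn : G.Nonempty
    swap
    · rw [hx.zero G (fun h => hGn h.2)]; exact Submodule.zero_mem _
    have hiG : i ∉ G := fun h => h3 (hG.1 h)
    refine ⟨_, thx_VV G, ?_⟩
    have : x F * x (insert i G) = 0 := by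
      refine hx.mul _ _ (fun h => hG.2 fun a ha => ?_) (fun h => h3 (h (Finset.mem_insert_self _ _)))
      exact (Finset.mem_insert.1 (h ha)).resolve_left fun e => h3 (e ▸ ha)
    rw [thx_erase hx hi hGn hiG (hG.1.trans h1.1), mul_add, hz,
      show x F * x (insert i F) * x (insert i G) = x F * x (insert i G) * x (insert i F) by ring,
      this]; simp
  have hhigh : ∀ G, insert i F ⊂ G → x G ∈ Md z (VV x X i) := by
    intro G hG
    by_cases hfl : R.Flat X G ∧ G.Nonempty
    swap
    · rw [hx.zero G hfl]; exact Submodule.zero_mem _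
    have hiG : i ∈ G := hG.1 (Finset.mem_insert_self _ _)
    refine ⟨_, thx_VV (G.erase i), ?_⟩
    have hGn : (G.erase i).Nonempty := by
      obtain ⟨a, ha⟩ := hn
      exact ⟨a, Finset.mem_erase.2 ⟨fun e => h3 (e ▸ ha), hG.1 (Finset.mem_insert_of_mem ha)⟩⟩
    have : x (insert i F) * x (G.erase i) = 0 := by
      refine hx.mul _ _ (fun h => Finset.notMem_erase i G (h (Finset.mem_insert_self _ _)))
        (fun h => hG.2 ?_)
      rw [← Finset.insert_erase hiG]
      exact Finset.insert_subset (Finset.mem_insert_self _ _) h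
    rw [thx_erase hx hi hGn (Finset.notMem_erase i G) ((Finset.erase_subset i G).trans hfl.1.1),
      Finset.insert_erase hiG, mul_add, hz, mul_assoc (x F) _ (x (G.erase i)), this]; simp
  have hinc : ∀ G, ¬ G ⊂ F → ¬ insert i F ⊂ G → G ≠ F → G ≠ insert i F → z * x G = 0 := by
    intro G g1 g2 g3 g4
    by_cases g5 : G ⊆ F
    · exact (g1 (Finset.ssubset_iff_subset_ne.2 ⟨g5, g3⟩)).elim
    by_cases g6 : insert i F ⊆ G
    · exact (g2 (Finset.ssubset_iff_subset_ne.2 ⟨g6, g4.symm⟩)).elim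
    by_cases g7 : F ⊆ G
    · have : ¬ G ⊆ insert i F := fun h => by
        by_cases hiG : i ∈ G
        · exact g6 (Finset.insert_subset hiG g7)
        · exact g5 fun a ha => (Finset.mem_insert.1 (h ha)).resolve_left fun e => hiG (e ▸ ha)
      rw [hz, mul_assoc, hx.mul _ _ g6 this, mul_zero]
    · rw [hz, mul_right_comm, hx.mul _ _ g7 g5, zero_mul]
  have hFm : x F ∈ Md z (VV x X i) := by
    obtain ⟨a, ha⟩ := hn
    have hl := lin_pair hx (h1.1 ha) hi
    rw [← Finset.add_sum_erase _ _ (Finset.mem_univ F), if_pos ha, if_neg h3, sub_zero, one_smul]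
      at hl
    rw [eq_neg_of_add_eq_zero_left hl]
    refine Submodule.neg_mem _ (Submodule.sum_mem _ fun K hK => ?_)
    by_cases k1 : K = insert i F
    · rw [k1]; simp [ha, Submodule.zero_mem]
    refine Submodule.smul_mem _ _ ?_
    by_cases k2 : K ⊂ F
    · exact hlow K k2
    by_cases k3 : insert i F ⊂ K
    · exact hhigh K k3
    exact Md_zero (hinc K k2 k3 (Finset.mem_erase.1 hK).1 k1)
  have hHm : x (insert i F) ∈ Md z (VV x X i) := by
    have hl := hx.lin i hi
    have hm : insert i F ∈ Finset.univ.filter (fun K : Finset α => i ∈ K) :=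
      Finset.mem_filter.2 ⟨Finset.mem_univ _, Finset.mem_insert_self _ _⟩
    rw [← Finset.add_sum_erase _ _ hm] at hl
    rw [eq_neg_of_add_eq_zero_left hl]
    refine Submodule.neg_mem _ (Submodule.sum_mem _ fun K hK => ?_)
    rw [Finset.mem_erase, Finset.mem_filter] at hK
    by_cases k3 : insert i F ⊂ K
    · exact hhigh K k3
    exact Md_zero (hinc K (fun h => h3 (h.1 hK.2.2)) k3 (fun h => h3 (h ▸ hK.2.2)) hK.1)
  have hall : ∀ G, x G ∈ Md z (VV x X i) := by
    intro G
    by_cases k1 : G = F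
    · rw [k1]; exact hFm
    by_cases k2 : G = insert i F
    · rw [k2]; exact hHm
    by_cases k3 : G ⊂ F
    · exact hlow G k3
    by_cases k4 : insert i F ⊂ G
    · exact hhigh G k4
    exact Md_zero (hinc G k3 k4 k1 k2)
  refine mod_pow (fun v hv => ?_) k
  exact (Submodule.span_le.2 (by rintro _ ⟨K, rfl⟩; exact hall K) : Vx x ≤ Md z (VV x X i)) hv

end caseB
end AHK

namespace AHK
open Filter Topology

variable {α : Type*} [Fintype α] [DecidableEq α] {B : Type*} [CommRing B] [Algebra ℝ B]
variable {R : RkFn α} {X : Finset α} {x : Finset α → B}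

theorem Vx_fin (x : Finset α → B) (k : ℕ) : FiniteDimensional ℝ (Vx x ^ k : Submodule ℝ B) := by
  have : (Vx x).FG := Submodule.fg_span (Set.finite_range x)
  exact Module.Finite.iff_fg.2 (this.pow k)

theorem hyp_zero (hx : ChowRel R X x) {F K : Finset α} (hF : R.Flat X F)
    (hr : R.r X ≤ R.r F + 1) (h : F ⊂ K) : x F * x K = 0 := by
  by_cases hK : R.Flat X K ∧ K.Nonempty
  swap
  · rw [hx.zero K hK, mul_zero]
  by_cases hFn : F.Nonempty
  swap
  · rw [hx.zero F (fun h => hFn h.2), zero_mul]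
  have hFX : F ≠ X := fun e => h.2 (e ▸ hK.1.1)
  exact R1x hx hF hFn hFX hr _ (by rw [pow_one]; exact US_mem h)

theorem hyp_mul (hx : ChowRel R X x) {F : Finset α} (hF : R.Flat X F)
    (hr : R.r X ≤ R.r F + 1) (G : Finset α) : x F * x G = x F * thx F x G := by
  by_cases hG : G = ∅
  · rw [thx, if_pos hG, hx.zero G (fun h => h.2.ne_empty hG)]
  rw [thx, if_neg hG, Finset.mul_sum]
  by_cases hGF : G ⊆ F
  · symm
    refine Finset.sum_eq_single_of_mem G (Finset.mem_filter.2 ⟨Finset.mem_univ _,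
      Finset.inter_eq_left.2 hGF⟩) fun K hK hne => ?_
    have hK := (Finset.mem_filter.1 hK).2
    by_cases h1 : K ⊆ F
    · exact (hne (by rw [← hK, Finset.inter_eq_left.2 h1])).elim
    by_cases h2 : F ⊆ K
    · exact hyp_zero hx hF hr ⟨h2, h1⟩
    · exact hx.mul _ _ h2 h1
  · rw [Finset.sum_eq_zero]
    · by_cases h2 : F ⊆ G
      · exact hyp_zero hx hF hr ⟨h2, hGF⟩
      · exact hx.mul _ _ h2 hGF
    · intro K hK
      exact (hGF (by rw [← (Finset.mem_filter.1 hK).2]; exact Finset.inter_subset_right)).elim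

noncomputable def DS (R : RkFn α) (X : Finset α) (σ : Finset (Finset α)) : Chow R X →ₗ[ℝ] ℝ :=
  mD (deg R X) (∏ F ∈ σ, cx R X F)

theorem DS_apply (σ : Finset (Finset α)) (p : Chow R X) :
    DS R X σ p = deg R X ((∏ F ∈ σ, cx R X F) * p) := rfl

theorem prod_mem_CV (σ : Finset (Finset α)) {n : ℕ} {b : Chow R X} (hb : b ∈ CV R X ^ n) :
    (∏ F ∈ σ, cx R X F) * b ∈ CV R X ^ (σ.card + n) := by
  refine pow_mul_mem ?_ hb
  induction σ using Finset.induction_on with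
  | empty => simpa using one_mem_pow_zero (CV R X)
  | insert F σ hF ih =>
    rw [Finset.prod_insert hF, Finset.card_insert_of_notMem hF]
    exact mul_mem_pow_succ (x_mem_Vx F) ih

theorem theta_ell {Y : Finset α} (hY : Y ⊆ X) (c : Finset α → ℝ) :
    theta R hY (ell (cx R Y) c) = ∑ G, c G • thx Y (cx R X) G := by
  simp [ell, theta_cx]

theorem theta_ell' {Y : Finset α} (hY : Y ⊆ X) {c : Finset α → ℝ} (hc : c ∅ = 0) :
    theta R hY (ell (cx R Y) c) = ell (cx R X) (fun K => c (K ∩ Y)) := by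
  rw [theta_ell, ell]
  refine Eq.trans ?_ (Finset.sum_fiberwise Finset.univ (fun K => K ∩ Y) _)
  refine Finset.sum_congr rfl fun G _ => ?_
  by_cases hG : G = ∅
  · subst hG
    rw [hc, zero_smul, Finset.sum_eq_zero]
    intro K hK
    rw [(Finset.mem_filter.1 hK).2, hc, zero_smul]
  · rw [thx, if_neg hG, Finset.smul_sum]
    refine Finset.sum_congr rfl fun K hK => ?_
    rw [(Finset.mem_filter.1 hK).2]

theorem theta_surj {Y : Finset α} (hY : Y ⊆ X) {n : ℕ} {a : Chow R X}
    (ha : a ∈ Vx (thx Y (cx R X)) ^ n) : ∃ b ∈ CV R Y ^ n, theta R hY b = a := by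
  rw [← theta_V_pow hY] at ha
  obtain ⟨b, hb, e⟩ := ha
  exact ⟨b, hb, e⟩

theorem caseA {σ : Finset (Finset α)} {F : Finset α} {n : ℕ} {c : Finset α → ℝ} (hF : F ∈ σ)
    (hσ : Flg R X σ) (hr : R.r X = R.r F + 1) (hn : R.r X = σ.card + n + 1)
    (IH : HR (CV R F) (DS R F (σ.erase F)) n (ell (cx R F) c)) :
    HR (CV R X) (DS R X σ) n (ell (cx R X) c) := by
  obtain ⟨hFl, hFn, hFX⟩ := hσ.1 F hF
  have hx := chowRel_cx R X
  have hm := hyp_mul hx hFl hr.le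
  have hzF : ∀ p, ∃ q, (∏ F ∈ σ, cx R X F) * p = q * (cx R X F * p) ∧
      ∀ p', (∏ F ∈ σ, cx R X F) * p' = q * (cx R X F * p') := by
    intro p
    refine ⟨∏ F ∈ σ.erase F, cx R X F, ?_, fun p' => ?_⟩ <;>
    · rw [← Finset.mul_prod_erase _ _ hF]; ring
  have hDz : ∀ p q, cx R X F * p = cx R X F * q → DS R X σ p = DS R X σ q := by
    intro p q h
    rw [DS_apply, DS_apply, ← Finset.mul_prod_erase _ _ hF,
      show ∀ u v w : Chow R X, u * v * w = v * (u * w) from fun _ _ _ => by ring, h]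
    congr 1; ring
  refine HR_transfer (theta R hFl.1) (V' := CV R F) (D' := DS R F (σ.erase F)) (l' := ell (cx R F) c)
    ?_ ?_ ?_ ?_ (ell_mem c) IH
  · intro v hv
    have := theta_mem (R := R) hFl.1 (n := 1) (b := v) (by rw [pow_one]; exact hv)
    rw [pow_one] at this
    exact thx_le this
  · intro k a ha
    obtain ⟨w, hw, e⟩ := mod_pow (z := cx R X F) (V := CV R X) (W := Vx (thx F (cx R X))) (by
      refine mod_span ?_
      rintro _ ⟨G, rfl⟩
      exact ⟨_, x_mem_Vx G, hm G⟩) k a ha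
    obtain ⟨a', ha', rfl⟩ := theta_surj hFl.1 hw
    refine ⟨a', ha', fun b => hDz _ _ ?_⟩
    rw [← mul_assoc, e, mul_assoc]
  · intro b hb
    have hcard : (σ.erase F).card + 1 = σ.card := Finset.card_erase_add_one hF
    have := deg_hyper hFl (d := (σ.erase F).card + n) (by omega) (by omega)
      (prod_mem_CV (σ.erase F) hb)
    rw [DS_apply, ← this, DS_apply, map_mul (theta R _), map_prod (theta R _), ← Finset.mul_prod_erase _ _ hF]
    congr 1
    have key : ∀ (s : Finset (Finset α)) (p : Chow R X),
        cx R X F * ((∏ G ∈ s, theta R hFl.1 (cx R F G)) * p) =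
        cx R X F * ((∏ G ∈ s, cx R X G) * p) := by
      intro s
      induction s using Finset.induction_on with
      | empty => intro p; simp
      | insert G s hG ih =>
        intro p
        rw [Finset.prod_insert hG, Finset.prod_insert hG, mul_assoc, mul_assoc, theta_cx,
          ← mul_assoc, ← hm, show ∀ u v w : Chow R X, u * v * w = v * (u * w) from
            fun _ _ _ => by ring, ih]
        ring
    rw [key, mul_assoc]
  · intro b
    refine hDz _ _ ?_
    rw [theta_ell, ← mul_assoc, ← mul_assoc, ell, Finset.mul_sum, Finset.mul_sum]
    congr 1
    refine Finset.sum_congr rfl fun G _ => ?_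
    rw [mul_smul_comm, mul_smul_comm, hm G]

theorem base_HR (hX : R.r X = 1) (l : Chow R X) : HR (CV R X) (DS R X ∅) 0 l := by
  intro k m hkm a ha _ hq
  obtain rfl : k = 0 := by omega
  obtain rfl : m = 0 := by omega
  rw [pow_zero, Submodule.mem_one] at ha
  obtain ⟨t, rfl⟩ := ha
  obtain ⟨b, hb, hq⟩ := hq
  have ht : t ≠ 0 := by rintro rfl; simp at hq
  have h1 := deg_top (d := 0) hX
  rw [pow_zero, pow_zero] at h1
  rw [DS_apply]
  have : (∏ F ∈ (∅ : Finset (Finset α)), cx R X F) *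
      (l ^ 0 * (algebraMap ℝ (Chow R X) t * algebraMap ℝ (Chow R X) t)) = (t * t) • (1 : Chow R X) := by
    rw [Algebra.smul_def, map_mul]; simp
  rw [this, map_smul, h1]
  simp only [pow_zero, smul_eq_mul, mul_one, one_mul]
  exact mul_self_pos.2 ht

theorem Flg_insert {σ : Finset (Finset α)} (hσ : Flg R X σ) {G : Finset α}
    (h : R.Flat X G ∧ G.Nonempty ∧ G ≠ X) (hc : ∀ F ∈ σ, F ⊆ G ∨ G ⊆ F) : Flg R X (insert G σ) := by
  refine ⟨?_, ?_⟩
  · intro F hF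
    rcases Finset.mem_insert.1 hF with rfl | hF
    · exact h
    · exact hσ.1 F hF
  · intro F hF K hK
    rcases Finset.mem_insert.1 hF with hF' | hF' <;> rcases Finset.mem_insert.1 hK with hK' | hK'
    · subst hF' hK'; exact Or.inl le_rfl
    · subst hF'; exact (hc K hK').symm
    · subst hK'; exact hc F hF'
    · exact hσ.2 F hF' K hK'

theorem HL_of {σ : Finset (Finset α)} {n : ℕ} {c : Finset α → ℝ} (hσ : Flg R X σ) (hc : Am σ X c)
    (IH : ∀ G ∈ Sig R X σ, HR (CV R X) (DS R X (insert G σ)) n (ell (cx R X) c)) {k m : ℕ}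
    (hkm : 2 * k + m = n + 1) : HLk (CV R X) (DS R X σ) k m (ell (cx R X) c) := by
  refine HL_step (Sig R X σ) (cx R X) (fun G _ => x_mem_Vx G) ?_
    (ample_gen (chowRel_cx R X) (deg R X) hσ)
    (ample_pos (chowRel_cx R X) (deg R X) hσ hc) (ell_mem c) hkm
  intro G hG
  have : mD (DS R X σ) (cx R X G) = DS R X (insert G σ) := by
    ext p
    rw [mD_apply, DS_apply, DS_apply, Finset.prod_insert (Finset.mem_filter.1 hG).2.2.2.2.1]
    congr 1; ring
  change HR (CV R X) (mD (DS R X σ) (cx R X G)) n _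
  rw [this]
  exact IH G hG

/-- The situation of the deletion step. -/
structure BB (R : RkFn α) (X : Finset α) (σ : Finset (Finset α)) (Fm : Finset α) (i : α)
    (N : ℕ) : Prop where
  flg : Flg R X σ
  hn : R.r X = σ.card + N + 2
  hi : i ∈ X
  hiF : i ∉ Fm
  hr : R.r Fm + 2 ≤ R.r X
  sub : ∀ F ∈ σ, F ⊆ Fm
  mem : Fm ∈ σ ∨ Fm = ∅

namespace BB
variable {σ : Finset (Finset α)} {Fm : Finset α} {i : α} {N : ℕ}

theorem all (h : BB R X σ Fm i N) : ∀ F ∈ σ, R.Flat X F ∧ F.Nonempty ∧ i ∉ F ∧ insert i F ≠ X := by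
  intro F hF
  obtain ⟨h1, h2, h3⟩ := h.flg.1 F hF
  refine ⟨h1, h2, fun hh => h.hiF (h.sub F hF hh), fun e => ?_⟩
  have h4 := R.r_insert i F
  rw [e] at h4
  have h5 := R.mono (h.sub F hF)
  have := h.hr
  omega

theorem ne' (h : BB R X σ Fm i N) : (X.erase i).Nonempty := by
  by_contra hh
  rw [Finset.not_nonempty_iff_eq_empty] at hh
  have h1 := R.r_insert i (X.erase i)
  rw [Finset.insert_erase h.hi, hh, R.r_empty] at h1
  have := h.hr
  omega

theorem hz (h : BB R X σ Fm i N) (hx : ChowRel R X x) : ∀ K, ¬ Fm ⊆ K → ¬ K ⊆ Fm →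
    (∏ F ∈ σ, x F) * x K = 0 := by
  intro K h1 h2
  rcases h.mem with hm | hm
  · rw [← Finset.mul_prod_erase _ _ hm, mul_right_comm, hx.mul _ _ h1 h2, zero_mul]
  · exact (h1 (by rw [hm]; exact Finset.empty_subset _)).elim

theorem r_erase (h : BB R X σ Fm i N) : R.r X ≤ R.r (X.erase i) + 1 := by
  have h1 := R.r_insert i (X.erase i)
  rwa [Finset.insert_erase h.hi] at h1

theorem yy (h : BB R X σ Fm i N) (hx : ChowRel R X x) :
    x (X.erase i) * x (X.erase i) = x (X.erase i) * thx (X.erase i) x (X.erase i) := by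
  by_cases hf : R.Flat X (X.erase i)
  · exact hyp_mul hx hf h.r_erase _
  · rw [hx.zero _ (fun h => hf h.1)]; simp

theorem o2 (h : BB R X σ Fm i N) (hx : ChowRel R X x) {j : Finset α} (hj : j ∈ Js R X Fm i)
    {b : B} (hb : b ∈ VV x X i ^ N) : (∏ F ∈ σ, x F) * (x (insert i j) * b) = 0 := by
  obtain ⟨-, h1, h2, h3, h4, h5⟩ := Finset.mem_filter.1 hj
  obtain ⟨b₀, hb₀, b', hb', rfl⟩ := sup_y_decomp (x_mem_Vx (X.erase i)) (h.yy hx) N b hb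
  have hjn : j.Nonempty := by
    obtain ⟨a, ha, _⟩ := Finset.exists_of_ssubset h2; exact ⟨a, ha⟩
  have e1 := lemZ' hx h.hi σ j (m := N) (by
      intro F hF
      rcases Finset.mem_insert.1 hF with rfl | hF
      · exact ⟨h1, hjn, h3, h5⟩
      · exact h.all F hF) (fun hj' => h2.2 (h.sub j hj')) (by have := h.hn; omega) b₀ hb₀
  have e2 : x (insert i j) * x (X.erase i) = 0 :=
    hx.mul _ _ (fun hh => Finset.notMem_erase i X (hh (Finset.mem_insert_self _ _)))
      (fun hh => h5 (le_antisymm h4.1 (by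
        rw [← Finset.insert_erase h.hi]
        exact Finset.insert_subset (Finset.mem_insert_self _ _) hh)))
  rw [mul_add, mul_add, ← mul_assoc, e1, ← mul_assoc (x (insert i j)), e2]; simp

theorem stepSS (h : BB R X σ Fm i N) {l : Chow R X} (hl : l ∈ VV (cx R X) X i)
    (hD : HR (VV (cx R X) X i) (DS R X σ) (N + 1) l)
    (hE : ∀ F ∈ Js R X Fm i, ∀ n', n' + 2 = N + 1 →
      HR (CV R X) (DS R X (insert F (insert (insert i F) σ))) n' l) :
    HR (CV R X) (DS R X σ) (N + 1) l := by
  have hx := chowRel_cx R X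
  have ho2 : ∀ j ∈ Js R X Fm i, ∀ b ∈ VV (cx R X) X i ^ N, DS R X σ (cx R X (insert i j) * b) = 0 := by
    intro j hj b hb
    rw [DS_apply, h.o2 hx hj hb, map_zero]
  have hprod : ∀ j ∈ Js R X Fm i, ∀ p, (∏ F ∈ insert j (insert (insert i j) σ), cx R X F) * p =
      (∏ F ∈ σ, cx R X F) * (cx R X j * cx R X (insert i j) * p) := by
    intro j hj p
    obtain ⟨-, h1, h2, h3, h4, h5⟩ := Finset.mem_filter.1 hj
    have hne : j ≠ insert i j := fun e => h3 (by rw [e]; exact Finset.mem_insert_self _ _)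
    rw [Finset.prod_insert, Finset.prod_insert]
    · ring
    · exact fun hh => (h.all _ hh).2.2.1 (Finset.mem_insert_self _ _)
    · rw [Finset.mem_insert]
      rintro (e | e)
      · exact hne e
      · exact h2.2 (h.sub j e)
  refine SS (Js R X Fm i) (fun F => cx R X (insert i F))
    (fun F => DS R X (insert F (insert (insert i F) σ))) VV_le (fun j _ => x_mem_Vx _) hl hD hE
    ho2 ?_ ?_ ?_ ?_
  · intro F hF F' hF' hne n' hn' b hb
    obtain ⟨-, h1, h2, h3, h4, h5⟩ := Finset.mem_filter.1 hF
    obtain ⟨-, h1', h2', h3', h4', h5'⟩ := Finset.mem_filter.1 hF'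
    have hmem : ∀ G, thx (X.erase i) (cx R X) G * b ∈ VV (cx R X) X i ^ N := fun G => by
      have := mul_mem_pow_succ (thx_VV (x := cx R X) (X := X) (i := i) G) hb
      rwa [show n' + 1 = N by omega] at this
    by_cases k1 : F ⊆ F'
    · rw [xHH_thx hx h.hi hF' h3 (Finset.ssubset_iff_subset_ne.2 ⟨k1, hne⟩), mul_assoc]
      exact ho2 F hF _ (hmem _)
    by_cases k2 : F' ⊆ F
    · rw [mul_comm (cx R X (insert i F)),
        xHH_thx hx h.hi hF h3' (Finset.ssubset_iff_subset_ne.2 ⟨k2, Ne.symm hne⟩), mul_assoc]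
      exact ho2 F' hF' _ (hmem _)
    · rw [hx.mul]
      · simp
      · exact fun hh => k1 fun a ha => (Finset.mem_insert.1 (hh (Finset.mem_insert_of_mem ha))).resolve_left
          fun e => h3 (e ▸ ha)
      · exact fun hh => k2 fun a ha => (Finset.mem_insert.1 (hh (Finset.mem_insert_of_mem ha))).resolve_left
          fun e => h3' (e ▸ ha)
  · intro F hF n' hn' b hb
    obtain ⟨-, h1, h2, h3, h4, h5⟩ := Finset.mem_filter.1 hF
    have hFn : F.Nonempty := by
      obtain ⟨a, ha, _⟩ := Finset.exists_of_ssubset h2; exact ⟨a, ha⟩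
    have hmem : thx (X.erase i) (cx R X) F * b ∈ VV (cx R X) X i ^ N := by
      have := mul_mem_pow_succ (thx_VV (x := cx R X) (X := X) (i := i) F) hb
      rwa [show n' + 1 = N by omega] at this
    have e1 := ho2 F hF _ hmem
    rw [thx_erase hx h.hi hFn h3 h1.1] at e1
    have e2 : DS R X (insert F (insert (insert i F) σ)) b =
        DS R X σ (cx R X F * cx R X (insert i F) * b) := by
      rw [DS_apply, DS_apply, hprod F hF]
    rw [e2, eq_neg_iff_add_eq_zero, ← map_add, ← e1]
    congr 1; ring
  · intro k a ha
    obtain ⟨b, hb, c, hc, e⟩ := s1_all hx h.hi h.ne' h.hiF (h.hz hx) k a ha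
    refine ⟨b, hb, c, hc, fun p => ?_⟩
    rw [DS_apply, DS_apply, ← mul_assoc, e, mul_assoc]
  · intro k F hF a ha
    obtain ⟨b, hb, e⟩ := s2_all hx h.hi hF k a ha
    refine ⟨b, hb, fun p => ?_⟩
    rw [DS_apply, DS_apply, hprod F hF, hprod F hF, ← mul_assoc (_ * _) a, e, ← mul_assoc (_ * _) b]

theorem hnon (h : BB R X σ Fm i N) (hr : R.r (X.erase i) = R.r X) {c : Finset α → ℝ} (hc : c ∅ = 0)
    (IH : HR (CV R (X.erase i)) (DS R (X.erase i) σ) (N + 1) (ell (cx R (X.erase i)) c)) :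
    HR (VV (cx R X) X i) (DS R X σ) (N + 1) (ell (cx R X) (fun K => c (K ∩ X.erase i))) := by
  have hx := chowRel_cx R X
  have hsub : X.erase i ⊆ X := Finset.erase_subset i X
  have hy : cx R X (X.erase i) = 0 := hx.zero _ fun hf => by
    have := hf.1.lt_of_ssubset le_rfl (Finset.erase_ssubset h.hi)
    omega
  have hVV : VV (cx R X) X i = Vx (thx (X.erase i) (cx R X)) := by
    rw [VV, hy]; simp
  rw [← theta_ell' hsub hc, hVV]
  refine HR_transfer (theta R hsub) ?_ ?_ ?_ (fun b => rfl) (ell_mem c) IH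
  · intro v hv
    have := theta_mem (R := R) hsub (n := 1) (b := v) (by rw [pow_one]; exact hv)
    rwa [pow_one] at this
  · intro k a ha
    obtain ⟨b, hb, rfl⟩ := theta_surj hsub ha
    exact ⟨b, hb, fun _ => rfl⟩
  · intro b hb
    have hn := h.hn
    rw [DS_apply, DS_apply, ← thx_prod hx h.hi σ h.all (by omega) _ (theta_mem hsub hb),
      ← deg_theta hsub (d := σ.card + (N + 1)) (by omega) (by omega) (prod_mem_CV σ hb),
      map_mul (theta R _), map_prod (theta R _)]
    simp only [theta_cx]

theorem hcol (h : BB R X σ Fm i N) (hr : R.r (X.erase i) + 1 = R.r X) {c : Finset α → ℝ}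
    (hc : c ∅ = 0)
    (IH : HR (CV R (X.erase i)) (DS R (X.erase i) σ) N (ell (cx R (X.erase i)) c)) :
    ∀ᶠ s : ℝ in 𝓝[>] 0, HR (VV (cx R X) X i) (DS R X σ) (N + 1)
      (ell (cx R X) (fun K => c (K ∩ X.erase i)) + s • cx R X (X.erase i)) := by
  have hx := chowRel_cx R X
  have hn := h.hn
  have hsub : X.erase i ⊆ X := Finset.erase_subset i X
  have hfl : R.Flat X (X.erase i) := ⟨hsub, fun a ha ha' => by
    have : a = i := by
      by_contra hne
      exact ha' (Finset.mem_erase.2 ⟨hne, ha⟩)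
    rw [this, Finset.insert_erase h.hi]; omega⟩
  have hm := hyp_mul hx hfl (by omega)
  rw [← theta_ell' hsub hc]
  have hlm : theta R hsub (ell (cx R (X.erase i)) c) ∈ Vx (thx (X.erase i) (cx R X)) := by
    have := theta_mem (R := R) hsub (n := 1) (b := ell (cx R (X.erase i)) c)
      (by rw [pow_one]; exact ell_mem c)
    rwa [pow_one] at this
  refine coloop_HR (fun k => Vx_fin _ k) (x_mem_Vx (X.erase i)) hlm (h.yy hx) ?_ ?_
  · intro b hb
    rw [DS_apply, ← thx_prod hx h.hi σ h.all (by omega) _ hb]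
    obtain ⟨b, hb', rfl⟩ := theta_surj hsub hb
    have := Vx_pow_eq_zero (chowRel_cx R (X.erase i)) h.ne' (n := σ.card + (N + 1)) (by omega) _ (prod_mem_CV σ hb')
    have e : (∏ F ∈ σ, thx (X.erase i) (cx R X) F) * theta R hsub b =
        theta R hsub ((∏ F ∈ σ, cx R (X.erase i) F) * b) := by
      rw [map_mul, map_prod]; simp only [theta_cx]
    rw [e, this, map_zero, map_zero]
  · refine HR_transfer (theta R hsub) ?_ ?_ ?_ (fun b => rfl) (ell_mem c) IH
    · intro v hv
      have := theta_mem (R := R) hsub (n := 1) (b := v) (by rw [pow_one]; exact hv)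
      rwa [pow_one] at this
    · intro k a ha
      obtain ⟨b, hb, rfl⟩ := theta_surj hsub ha
      exact ⟨b, hb, fun _ => rfl⟩
    · intro b hb
      rw [mD_apply, DS_apply, DS_apply, ← deg_hyper hfl (d := σ.card + N) (by omega) (by omega)
        (prod_mem_CV σ hb), map_mul (theta R _), map_prod (theta R _)]
      congr 1
      have key : ∀ (s : Finset (Finset α)) (p : Chow R X),
          cx R X (X.erase i) * ((∏ G ∈ s, theta R hsub (cx R (X.erase i) G)) * p) =
          cx R X (X.erase i) * ((∏ G ∈ s, cx R X G) * p) := by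
        intro s
        induction s using Finset.induction_on with
        | empty => intro p; simp
        | insert G s hG ih =>
          intro p
          rw [Finset.prod_insert hG, Finset.prod_insert hG, mul_assoc, mul_assoc, theta_cx,
            ← mul_assoc, ← hm, show ∀ u v w : Chow R X, u * v * w = v * (u * w) from
              fun _ _ _ => by ring, ih]
          ring
      rw [key]; ring
end BB
end AHK

namespace AHK
open Filter Topology

variable {α : Type*} [Fintype α] [DecidableEq α]
variable {R : RkFn α} {X : Finset α}

theorem Am.mono {σ τ : Finset (Finset α)} {c : Finset α → ℝ} (h : Am σ X c) (hs : σ ⊆ τ) : Am τ X c :=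
  ⟨h.1, fun A hA B hB h1 h2 h3 => h.2 A hA B hB h1 h2 fun F hF => h3 F (hs hF)⟩

theorem Am.sub {σ : Finset (Finset α)} {c : Finset α → ℝ} (h : Am σ X c) {Y : Finset α} (hY : Y ⊆ X) :
    Am σ Y c :=
  ⟨h.1, fun A hA B hB h1 h2 h3 => h.2 A (hA.trans hY) B (hB.trans hY) h1 h2 h3⟩

/-- weak version of `Am` -/
def Wk (σ : Finset (Finset α)) (X : Finset α) (c : Finset α → ℝ) : Prop :=
  c ∅ = 0 ∧ ∀ A ⊆ X, ∀ B ⊆ X, ¬ A ⊆ B → ¬ B ⊆ A →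
    (∀ F ∈ σ, (A ⊆ F ∧ B ⊆ F) ∨ (F ⊆ A ∧ F ⊆ B)) → c (A ∪ B) + c (A ∩ B) ≤ c A + c B

theorem Wk.path {σ : Finset (Finset α)} {c₀ c₁ : Finset α → ℝ} (h₀ : Wk σ X c₀) (h₁ : Am σ X c₁)
    {t : ℝ} (ht : 0 < t) (ht1 : t ≤ 1) : Am σ X (fun K => c₀ K + t * (c₁ K - c₀ K)) := by
  refine ⟨by simp [h₀.1, h₁.1], fun A hA B hB h1 h2 h3 => ?_⟩
  have e0 := h₀.2 A hA B hB h1 h2 h3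
  have e1 := h₁.2 A hA B hB h1 h2 h3
  nlinarith [mul_pos ht (sub_pos.2 e1), mul_nonneg (sub_nonneg.2 ht1) (sub_nonneg.2 e0)]

theorem ell_path {B : Type*} [CommRing B] [Algebra ℝ B] {x : Finset α → B}
    (c₀ c₁ : Finset α → ℝ) (t : ℝ) :
    ell x (fun K => c₀ K + t * (c₁ K - c₀ K)) = ell x c₀ + t • (ell x c₁ - ell x c₀) := by
  simp only [ell]
  rw [← Finset.sum_sub_distrib, Finset.smul_sum, ← Finset.sum_add_distrib]
  refine Finset.sum_congr rfl fun K _ => ?_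
  rw [add_smul, mul_smul, sub_smul]

theorem deform {σ : Finset (Finset α)} {n : ℕ} {c₀ c₁ : Finset α → ℝ} (hσ : Flg R X σ)
    (h₀ : Wk σ X c₀) (h₁ : Am σ X c₁)
    (IH : ∀ c, Am σ X c → ∀ G ∈ Sig R X σ, HR (CV R X) (DS R X (insert G σ)) n (ell (cx R X) c))
    (h : HR (CV R X) (DS R X σ) (n + 1) (ell (cx R X) c₀)) :
    HR (CV R X) (DS R X σ) (n + 1) (ell (cx R X) c₁) := by
  have key : ∀ t ∈ Set.Icc (0:ℝ) 1, ∀ k m, 2 * k + m = n + 1 →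
      HLk (CV R X) (DS R X σ) k m (ell (cx R X) c₀ + t • (ell (cx R X) c₁ - ell (cx R X) c₀)) := by
    intro t ht k m hkm
    rcases ht.1.eq_or_lt with e | e
    · rw [← e, zero_smul, add_zero]
      exact (h k m hkm).hl (ell_mem c₀)
    · rw [← ell_path]
      exact HL_of hσ (h₀.path h₁ e ht.2) (IH _ (h₀.path h₁ e ht.2)) hkm
  intro k m hkm
  exact path_HR (fun k => Vx_fin _ k) (ell_mem c₀) (ell_mem c₁) (fun t ht => key t ht k m hkm)
    (fun t ht j hj => key t ht j (m + 2) (by omega)) (h k m hkm)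

/-- the perturbed pullback weight -/
noncomputable def cs (c : Finset α → ℝ) (Y : Finset α) (s : ℝ) (K : Finset α) : ℝ :=
  c (K ∩ Y) + if K = Y then s else 0

theorem ell_cs {B : Type*} [CommRing B] [Algebra ℝ B] {x : Finset α → B}
    (c : Finset α → ℝ) (Y : Finset α) (s : ℝ) :
    ell x (cs c Y s) = ell x (fun K => c (K ∩ Y)) + s • x Y := by
  simp only [ell, cs, add_smul, Finset.sum_add_distrib, ite_smul, zero_smul]
  simp

section
variable {σ : Finset (Finset α)} {c : Finset α → ℝ} {i : α} {s : ℝ}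

theorem cs_ineq (hc : c ∅ = 0) (hi : i ∈ X) (hs : 0 ≤ s)
    (hgap : ∀ A B, 0 < c A + c B - c (A ∪ B) - c (A ∩ B) → s < c A + c B - c (A ∪ B) - c (A ∩ B))
    {A B : Finset α} (hA : A ⊆ X) (hB : B ⊆ X) (h1 : ¬ A ⊆ B) (h2 : ¬ B ⊆ A)
    (hst : ¬ (A ∩ X.erase i ⊆ B ∩ X.erase i) → ¬ (B ∩ X.erase i ⊆ A ∩ X.erase i) →
      c ((A ∩ X.erase i) ∪ (B ∩ X.erase i)) + c ((A ∩ X.erase i) ∩ (B ∩ X.erase i)) <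
        c (A ∩ X.erase i) + c (B ∩ X.erase i)) :
    cs c (X.erase i) s (A ∪ B) + cs c (X.erase i) s (A ∩ B) ≤
      cs c (X.erase i) s A + cs c (X.erase i) s B ∧
    ((i ∈ A ↔ i ∈ B) → cs c (X.erase i) s (A ∪ B) + cs c (X.erase i) s (A ∩ B) <
      cs c (X.erase i) s A + cs c (X.erase i) s B) := by
  set Y := X.erase i with hY
  have hu : (A ∪ B) ∩ Y = (A ∩ Y) ∪ (B ∩ Y) := Finset.union_inter_distrib_right _ _ _
  have hn : (A ∩ B) ∩ Y = (A ∩ Y) ∩ (B ∩ Y) := by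
    ext a; simp only [Finset.mem_inter]; tauto
  have hmem : ∀ {K : Finset α}, K ⊆ X → ∀ a ∈ K, a = i ∨ a ∈ Y := fun hK a ha => by
    by_cases e : a = i
    · exact Or.inl e
    · exact Or.inr (Finset.mem_erase.2 ⟨e, hK ha⟩)
  have hX : ∀ K : Finset α, K ⊆ X → Y ⊆ K → K = Y ∨ K = X := by
    intro K hK hYK
    by_cases hiK : i ∈ K
    · right
      refine le_antisymm hK ?_
      rw [← Finset.insert_erase hi]
      exact Finset.insert_subset hiK hYK
    · left
      refine le_antisymm (fun a ha => ?_) hYK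
      rcases hmem hK a ha with rfl | h
      · exact (hiK ha).elim
      · exact h
  have hAB : A ∩ B ≠ Y := by
    intro e
    rcases hX A hA (by rw [← e]; exact Finset.inter_subset_left) with e1 | e1
    · exact h1 (by rw [e1, ← e]; exact Finset.inter_subset_right)
    · exact h2 (by rw [e1]; exact hB)
  have tA : (0:ℝ) ≤ if A = Y then s else 0 := by split_ifs <;> simp [hs]
  have tB : (0:ℝ) ≤ if B = Y then s else 0 := by split_ifs <;> simp [hs]
  have hst' : (i ∈ A ↔ i ∈ B) → ¬ (A ∩ Y ⊆ B ∩ Y) ∧ ¬ (B ∩ Y ⊆ A ∩ Y) := by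
    intro hiff
    constructor
    · intro hh
      refine h1 fun a ha => ?_
      rcases hmem hA a ha with rfl | h
      · exact hiff.1 ha
      · exact (Finset.mem_inter.1 (hh (Finset.mem_inter.2 ⟨ha, h⟩))).1
    · intro hh
      refine h2 fun a ha => ?_
      rcases hmem hB a ha with rfl | h
      · exact hiff.2 ha
      · exact (Finset.mem_inter.1 (hh (Finset.mem_inter.2 ⟨ha, h⟩))).1
  by_cases hU : A ∪ B = Y
  · have hAY : A ⊆ Y := by rw [← hU]; exact Finset.subset_union_left
    have hBY : B ⊆ Y := by rw [← hU]; exact Finset.subset_union_right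
    have e1 := Finset.inter_eq_left.2 hAY
    have e2 := Finset.inter_eq_left.2 hBY
    rw [e1, e2] at hst
    have h3 := hst h1 h2
    have h4 := hgap A B (by linarith)
    have : cs c Y s (A ∪ B) + cs c Y s (A ∩ B) < cs c Y s A + cs c Y s B := by
      simp only [cs]
      rw [if_pos hU, if_neg hAB, hu, hn, e1, e2]
      linarith
    exact ⟨this.le, fun _ => this⟩
  · simp only [cs]
    rw [if_neg hU, if_neg hAB, hu, hn]
    refine ⟨?_, fun hiff => ?_⟩
    · by_cases k1 : A ∩ Y ⊆ B ∩ Y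
      · rw [Finset.union_eq_right.2 k1, Finset.inter_eq_left.2 k1]; linarith
      by_cases k2 : B ∩ Y ⊆ A ∩ Y
      · rw [Finset.union_eq_left.2 k2, Finset.inter_eq_right.2 k2]; linarith
      have := hst k1 k2
      linarith
    · have := hst (hst' hiff).1 (hst' hiff).2
      linarith

theorem cs_compat {A B : Finset α} {Y : Finset α} (hσ : ∀ F ∈ σ, F ⊆ Y)
    (h : ∀ F ∈ σ, (A ⊆ F ∧ B ⊆ F) ∨ (F ⊆ A ∧ F ⊆ B)) :
    ∀ F ∈ σ, (A ∩ Y ⊆ F ∧ B ∩ Y ⊆ F) ∨ (F ⊆ A ∩ Y ∧ F ⊆ B ∩ Y) := by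
  intro F hF
  rcases h F hF with h | h
  · exact Or.inl ⟨Finset.inter_subset_left.trans h.1, Finset.inter_subset_left.trans h.2⟩
  · exact Or.inr ⟨Finset.subset_inter h.1 (hσ F hF), Finset.subset_inter h.2 (hσ F hF)⟩

theorem cs_empty (hc : c ∅ = 0) {Y : Finset α} (hY : Y.Nonempty) : cs c Y s ∅ = 0 := by
  simp [cs, hc, hY.ne_empty.symm]

theorem cs_wk (hc : Am σ X c) (hi : i ∈ X) (hY : (X.erase i).Nonempty) (hσ : ∀ F ∈ σ, F ⊆ X.erase i)
    (hs : 0 ≤ s)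
    (hgap : ∀ A B, 0 < c A + c B - c (A ∪ B) - c (A ∩ B) → s < c A + c B - c (A ∪ B) - c (A ∩ B)) :
    Wk σ X (cs c (X.erase i) s) := by
  refine ⟨cs_empty hc.1 hY, fun A hA B hB h1 h2 h3 => ?_⟩
  exact (cs_ineq hc.1 hi hs hgap hA hB h1 h2 fun k1 k2 => hc.2 _
    (Finset.inter_subset_left.trans hA) _ (Finset.inter_subset_left.trans hB) k1 k2
    (cs_compat hσ h3)).1

theorem cs_am (hc : Am σ X c) (hi : i ∈ X) (hY : (X.erase i).Nonempty) (hσ : ∀ F ∈ σ, F ⊆ X.erase i)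
    (hs : 0 ≤ s)
    (hgap : ∀ A B, 0 < c A + c B - c (A ∪ B) - c (A ∩ B) → s < c A + c B - c (A ∪ B) - c (A ∩ B))
    {F : Finset α} (hiF : i ∉ F) :
    Am (insert F (insert (insert i F) σ)) X (cs c (X.erase i) s) := by
  refine ⟨cs_empty hc.1 hY, fun A hA B hB h1 h2 h3 => ?_⟩
  refine (cs_ineq hc.1 hi hs hgap hA hB h1 h2 fun k1 k2 => hc.2 _
    (Finset.inter_subset_left.trans hA) _ (Finset.inter_subset_left.trans hB) k1 k2
    (cs_compat hσ fun G hG => h3 G (Finset.mem_insert_of_mem (Finset.mem_insert_of_mem hG)))).2 ?_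
  rcases h3 F (Finset.mem_insert_self _ _) with ⟨e1, e2⟩ | ⟨e1, e2⟩
  · exact iff_of_false (fun h => hiF (e1 h)) (fun h => hiF (e2 h))
  · rcases h3 (insert i F) (Finset.mem_insert_of_mem (Finset.mem_insert_self _ _)) with ⟨e3, e4⟩ | ⟨e3, e4⟩
    · by_cases hAi : i ∈ A
      · exact (h2 (e4.trans (Finset.insert_subset hAi e1))).elim
      · refine (h1 (fun a ha => e2 ?_)).elim
        exact (Finset.mem_insert.1 (e3 ha)).resolve_left fun e => hAi (e ▸ ha)
    · exact iff_of_true (e3 (Finset.mem_insert_self _ _)) (e4 (Finset.mem_insert_self _ _))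

theorem gap_ev (c : Finset α → ℝ) : ∀ᶠ s : ℝ in 𝓝[>] 0, ∀ A B : Finset α,
    0 < c A + c B - c (A ∪ B) - c (A ∩ B) → s < c A + c B - c (A ∪ B) - c (A ∩ B) := by
  rw [eventually_all]
  intro A
  rw [eventually_all]
  intro B
  by_cases h : 0 < c A + c B - c (A ∪ B) - c (A ∩ B)
  · filter_upwards [Ioo_mem_nhdsGT h] with s hs _
    exact hs.2
  · exact Eventually.of_forall fun s h' => (h h').elim

end

theorem flag_card {σ : Finset (Finset α)} (hσ : Flg R X σ) {Fm : Finset α} (h : ∀ F ∈ σ, F ⊆ Fm) :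
    σ.card ≤ R.r Fm := by
  have : σ.card ≤ (Finset.Icc 1 (R.r Fm)).card := by
    refine Finset.card_le_card_of_injOn R.r (fun F hF => ?_) ?_
    · rw [Finset.mem_coe, Finset.mem_Icc]
      exact ⟨RkFn.r_pos_of_nonempty (hσ.1 F hF).2.1, R.mono (h F hF)⟩
    · have key : ∀ F ∈ σ, ∀ G ∈ σ, R.r F = R.r G → F ⊆ G → F = G := by
        intro F hF G hG e hs
        by_contra hne
        have := (hσ.1 F hF).1.lt_of_ssubset (hσ.1 G hG).1.1 (Finset.ssubset_iff_subset_ne.2 ⟨hs, hne⟩)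
        omega
      intro F hF G hG e
      rcases hσ.2 F hF G hG with h | h
      · exact key F hF G hG e h
      · exact (key G hG F hF e.symm h).symm
  simpa using this

theorem main_HR (R : RkFn α) (X : Finset α) : ∀ (n : ℕ) (σ : Finset (Finset α)) (c : Finset α → ℝ),
    Flg R X σ → R.r X = σ.card + n + 1 → Am σ X c →
    HR (CV R X) (DS R X σ) n (ell (cx R X) c) := by
  induction X using Finset.strongInduction with
  | H X IHX =>
  intro n
  induction n using Nat.strong_induction_on with
  | _ n IHn =>
  intro σ c hσ hn hc
  by_cases hX1 : R.r X = 1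
  · obtain rfl : n = 0 := by omega
    obtain rfl : σ = ∅ := by rw [← Finset.card_eq_zero]; omega
    exact base_HR hX1 _
  by_cases hex : ∃ F ∈ σ, R.r X = R.r F + 1
  · obtain ⟨F, hF, hr⟩ := hex
    obtain ⟨hFl, hFn, hFX⟩ := hσ.1 F hF
    refine caseA hF hσ hr hn ?_
    have hsub : ∀ G ∈ σ.erase F, G ⊆ F := by
      intro G hG
      obtain ⟨hne, hG⟩ := Finset.mem_erase.1 hG
      rcases hσ.2 G hG F hF with h | h
      · exact h
      · have h1 := hFl.lt_of_ssubset (hσ.1 G hG).1.1 (Finset.ssubset_iff_subset_ne.2 ⟨h, Ne.symm hne⟩)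
        have h2 := (hσ.1 G hG).1.lt_of_ssubset le_rfl
          (Finset.ssubset_iff_subset_ne.2 ⟨(hσ.1 G hG).1.1, (hσ.1 G hG).2.2⟩)
        omega
    refine IHX F (Finset.ssubset_iff_subset_ne.2 ⟨hFl.1, hFX⟩) n (σ.erase F) c ⟨?_, ?_⟩ ?_ ⟨hc.1, ?_⟩
    · intro G hG
      have hG' := hσ.1 G (Finset.mem_of_mem_erase hG)
      exact ⟨hG'.1.restrict hFl.1 (hsub G hG), hG'.2.1, (Finset.mem_erase.1 hG).1⟩
    · exact fun G hG K hK => hσ.2 G (Finset.mem_of_mem_erase hG) K (Finset.mem_of_mem_erase hK)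
    · have : (σ.erase F).card + 1 = σ.card := Finset.card_erase_add_one hF
      omega
    · intro A hA B hB h1 h2 h3
      refine hc.2 A (hA.trans hFl.1) B (hB.trans hFl.1) h1 h2 fun G hG => ?_
      by_cases e : G = F
      · exact Or.inl (e ▸ ⟨hA, hB⟩)
      · exact h3 G (Finset.mem_erase.2 ⟨e, hG⟩)
  push Not at hex
  obtain ⟨Fm, hFmem, hFsub, hFr, hFX⟩ : ∃ Fm : Finset α, (Fm ∈ σ ∨ Fm = ∅) ∧ (∀ F ∈ σ, F ⊆ Fm) ∧
      R.r Fm + 2 ≤ R.r X ∧ Fm ⊆ X := by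
    rcases σ.eq_empty_or_nonempty with he | hne
    · refine ⟨∅, Or.inr rfl, by simp [he], ?_, Finset.empty_subset _⟩
      rw [R.r_empty]; omega
    · obtain ⟨Fm, hF, hmax⟩ := Finset.exists_max_image σ Finset.card hne
      refine ⟨Fm, Or.inl hF, fun F hF' => ?_, ?_, (hσ.1 Fm hF).1.1⟩
      · rcases hσ.2 F hF' Fm hF with h | h
        · exact h
        · rw [Finset.eq_of_subset_of_card_le h (hmax F hF')]
      · have h1 := (hσ.1 Fm hF).1.lt_of_ssubset le_rfl
          (Finset.ssubset_iff_subset_ne.2 ⟨(hσ.1 Fm hF).1.1, (hσ.1 Fm hF).2.2⟩)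
        have := hex Fm hF
        omega
  have hcard := flag_card hσ hFsub
  obtain ⟨N, rfl⟩ : ∃ N, n = N + 1 := ⟨n - 1, by omega⟩
  obtain ⟨i, hi, hiF⟩ := Finset.exists_of_ssubset (Finset.ssubset_iff_subset_ne.2
    ⟨hFX, fun e => by rw [e] at hFr; omega⟩)
  have hBB : BB R X σ Fm i N := ⟨hσ, by omega, hi, hiF, hFr, hFsub, hFmem⟩
  have hσY : ∀ F ∈ σ, F ⊆ X.erase i := fun F hF =>
    Finset.subset_erase.2 ⟨(hσ.1 F hF).1.1, (hBB.all F hF).2.2.1⟩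
  have hYs : X.erase i ⊂ X := Finset.erase_ssubset hi
  have hflY : Flg R (X.erase i) σ := by
    refine ⟨fun F hF => ⟨(hσ.1 F hF).1.restrict hYs.1 (hσY F hF), (hσ.1 F hF).2.1, fun e => ?_⟩, hσ.2⟩
    have h1 := R.mono (hFsub F hF)
    have h2 := hBB.r_erase
    rw [← e] at h2
    omega
  have hamY : Am σ (X.erase i) c := hc.sub hYs.1
  have hmem : ∀ s : ℝ, ell (cx R X) (cs c (X.erase i) s) ∈ VV (cx R X) X i := by
    intro s
    rw [ell_cs, VV]
    refine Submodule.add_mem_sup ?_ (Submodule.smul_mem _ _ (Submodule.mem_span_singleton_self _))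
    rw [← theta_ell' (R := R) hYs.1 hc.1]
    have := theta_mem (R := R) hYs.1 (n := 1) (b := ell (cx R (X.erase i)) c)
      (by rw [pow_one]; exact ell_mem c)
    rwa [pow_one] at this
  obtain ⟨s, hs, hgap, hHR⟩ : ∃ s : ℝ, 0 ≤ s ∧ (∀ A B : Finset α,
      0 < c A + c B - c (A ∪ B) - c (A ∩ B) → s < c A + c B - c (A ∪ B) - c (A ∩ B)) ∧
      HR (VV (cx R X) X i) (DS R X σ) (N + 1) (ell (cx R X) (cs c (X.erase i) s)) := by
    by_cases hr : R.r (X.erase i) = R.r X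
    · refine ⟨0, le_rfl, fun _ _ h => h, ?_⟩
      rw [ell_cs, zero_smul, add_zero]
      exact hBB.hnon hr hc.1 (IHX _ hYs (N + 1) σ c hflY (by omega) hamY)
    · have h1 := R.mono hYs.1
      have h2 := hBB.r_erase
      have hev := hBB.hcol (by omega) hc.1 (IHX _ hYs N σ c hflY (by omega) hamY)
      obtain ⟨s, h3, h4, h5⟩ := (hev.and ((gap_ev c).and self_mem_nhdsWithin)).exists
      exact ⟨s, le_of_lt h5, h4, by rw [ell_cs]; exact h3⟩
  have hstep : HR (CV R X) (DS R X σ) (N + 1) (ell (cx R X) (cs c (X.erase i) s)) := by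
    refine hBB.stepSS (hmem s) hHR ?_
    intro F hF n' hn'
    obtain ⟨-, h1, h2, h3, h4, h5⟩ := Finset.mem_filter.1 hF
    have hFn : F.Nonempty := by
      obtain ⟨a, ha, _⟩ := Finset.exists_of_ssubset h2; exact ⟨a, ha⟩
    have hi1 : insert i F ∉ σ := fun hh => (hBB.all _ hh).2.2.1 (Finset.mem_insert_self _ _)
    have hi2 : F ∉ insert (insert i F) σ := by
      rw [Finset.mem_insert]
      rintro (e | e)
      · exact h3 (by rw [e]; exact Finset.mem_insert_self _ _)
      · exact h2.2 (hFsub F e)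
    refine IHn n' (by omega) _ _ (Flg_insert (Flg_insert hσ ⟨h4, Finset.insert_nonempty _ _, h5⟩ ?_)
      ⟨h1, hFn, ?_⟩ ?_) ?_ (cs_am hc hi hBB.ne' hσY hs hgap h3)
    · exact fun G hG => Or.inl ((hFsub G hG).trans (h2.1.trans (Finset.subset_insert _ _)))
    · rintro rfl; exact h3 hi
    · intro G hG
      rcases Finset.mem_insert.1 hG with e | hG
      · exact Or.inr (e ▸ Finset.subset_insert _ _)
      · exact Or.inl ((hFsub G hG).trans h2.1)
    · rw [Finset.card_insert_of_notMem hi2, Finset.card_insert_of_notMem hi1]; omega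
  refine deform hσ (cs_wk hc hi hBB.ne' hσY hs hgap) hc ?_ hstep
  intro c' hc' G hG
  obtain ⟨-, h1, h2, h3, h4, h5⟩ := Finset.mem_filter.1 hG
  exact IHn N (by omega) _ _ (Flg_insert hσ ⟨h1, h2, h3⟩ h5)
    (by rw [Finset.card_insert_of_notMem h4]; omega) (hc'.mono (Finset.subset_insert _ _))

end AHK

namespace AHK

section
variable {α : Type*} [Fintype α] [DecidableEq α] {R : RkFn α} {X : Finset α}

theorem top_zero {d : ℕ} (hd : R.r X = d + 1) {u : Chow R X} (hu : u ∈ CV R X ^ d)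
    (h : deg R X u = 0) : u = 0 := by
  obtain ⟨c, rfl⟩ := Vx_top (chowRel_cx R X) hd u hu
  rw [map_smul, deg_top hd, smul_eq_mul] at h
  have : c = 0 := by
    rcases mul_eq_zero.1 h with h | h
    · exact h
    · exact (pow_ne_zero d (by norm_num) h).elim
  rw [this, zero_smul]

theorem PDdeg {d n s : ℕ} (hd : R.r X = d + 1) (hns : n + s = d) {u : Chow R X}
    (hu : u ∈ CV R X ^ n) (h : ∀ v ∈ CV R X ^ s, deg R X (u * v) = 0) : u = 0 := by
  have hx := chowRel_cx R X
  have hne : cx R X X ^ d ≠ 0 := fun e => by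
    have := deg_top hd
    rw [e, map_zero] at this
    exact pow_ne_zero d (by norm_num : (-1 : ℝ) ≠ 0) this.symm
  have hV : CV R X = US (cx R X) ∅ := Vx_eq hx
  have := PD hx hd hne R.flat_empty (t := d) (n := n) (s := s) (by rw [R.r_empty]; omega) hns u
    (by rw [← hV]; exact hu) (by
      intro v hv
      rw [← hV] at hv
      simp only [xb, if_true, one_mul]
      refine top_zero hd ?_ (h v hv)
      rw [← hns]
      exact pow_mul_mem hu hv)
  simpa [xb] using this

theorem HL_inj {d k : ℕ} (hd : R.r X = d + 1) (hk : 2 * k ≤ d) {c : Finset α → ℝ} (hc : Am ∅ X c)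
    {a : Chow R X} (ha : a ∈ CV R X ^ k) (h : ell (cx R X) c ^ (d - 2 * k) * a = 0) : a = 0 := by
  have hHR := main_HR R X d ∅ c ⟨by simp, fun F hF => by simp at hF⟩ (by simpa using hd) hc
  have hl := (hHR k (d - 2 * k) (by omega)).hl (ell_mem c)
  refine PDdeg hd (n := k) (s := k + (d - 2 * k)) (by omega) ha fun v hv => ?_
  have := hl a ha (fun b _ => by rw [← mul_assoc, h, zero_mul, map_zero]) v hv
  simpa [DS_apply] using this

theorem pd_finrank {d n s : ℕ} (hd : R.r X = d + 1) (hns : n + s = d) :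
    Module.finrank ℝ (CV R X ^ n : Submodule ℝ (Chow R X)) ≤
      Module.finrank ℝ (CV R X ^ s : Submodule ℝ (Chow R X)) := by
  have : FiniteDimensional ℝ (CV R X ^ n : Submodule ℝ (Chow R X)) := Vx_fin _ n
  have : FiniteDimensional ℝ (CV R X ^ s : Submodule ℝ (Chow R X)) := Vx_fin _ s
  let f : (CV R X ^ n : Submodule ℝ (Chow R X)) →ₗ[ℝ]
      Module.Dual ℝ (CV R X ^ s : Submodule ℝ (Chow R X)) :=
    LinearMap.mk₂ ℝ (fun u v => deg R X ((u : Chow R X) * v))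
      (fun u u' v => by simp [add_mul]) (fun c u v => by simp)
      (fun u v v' => by simp [mul_add]) (fun c u v => by simp)
  rw [← Subspace.dual_finrank_eq (K := ℝ) (V := (CV R X ^ s : Submodule ℝ (Chow R X)))]
  refine LinearMap.finrank_le_finrank_of_injective (f := f) ?_
  rw [← LinearMap.ker_eq_bot, LinearMap.ker_eq_bot']
  intro u hu
  refine Subtype.ext (PDdeg hd hns u.2 fun v hv => ?_)
  have := LinearMap.congr_fun hu ⟨v, hv⟩
  exact this

theorem HL_surj {d k : ℕ} (hd : R.r X = d + 1) (hk : 2 * k ≤ d) {c : Finset α → ℝ} (hc : Am ∅ X c)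
    {b : Chow R X} (hb : b ∈ CV R X ^ (d - k)) :
    ∃ a ∈ CV R X ^ k, ell (cx R X) c ^ (d - 2 * k) * a = b := by
  have : FiniteDimensional ℝ (CV R X ^ k : Submodule ℝ (Chow R X)) := Vx_fin _ _
  have : FiniteDimensional ℝ (CV R X ^ (d - k) : Submodule ℝ (Chow R X)) := Vx_fin _ _
  let f : (CV R X ^ k : Submodule ℝ (Chow R X)) →ₗ[ℝ]
      (CV R X ^ (d - k) : Submodule ℝ (Chow R X)) :=
    (LinearMap.mulLeft ℝ (ell (cx R X) c ^ (d - 2 * k))).restrict (by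
      intro a ha
      have := pow_mul_mem (lin_pow_mem (V := CV R X) (ell_mem c) (d - 2 * k)) ha
      rwa [show d - 2 * k + k = d - k by omega] at this)
  have hinj : Function.Injective f := by
    rw [← LinearMap.ker_eq_bot, LinearMap.ker_eq_bot']
    intro u hu
    exact Subtype.ext (HL_inj hd hk hc u.2 (congrArg Subtype.val hu))
  have hfr : Module.finrank ℝ (CV R X ^ k : Submodule ℝ (Chow R X)) =
      Module.finrank ℝ (CV R X ^ (d - k) : Submodule ℝ (Chow R X)) :=
    le_antisymm (pd_finrank hd (by omega)) (pd_finrank hd (by omega))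
  obtain ⟨a, ha⟩ := (LinearMap.injective_iff_surjective_of_finrank_eq_finrank hfr).1 hinj ⟨b, hb⟩
  exact ⟨a, a.2, congrArg Subtype.val ha⟩
end

section
open FinMatroid
variable {E : Type*} [Fintype E] [DecidableEq E]

theorem card_le_rank (M : FinMatroid E) {I A : Finset E} (hI : M.Indep I) (h : I ⊆ A) :
    I.card ≤ M.rank A := by
  classical
  unfold FinMatroid.rank
  exact Finset.le_sup (f := Finset.card) (Finset.mem_filter.2 ⟨Finset.mem_powerset.2 h, hI⟩)

theorem rank_le (M : FinMatroid E) {A : Finset E} {n : ℕ} (h : ∀ I ⊆ A, M.Indep I → I.card ≤ n) :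
    M.rank A ≤ n := by
  classical
  unfold FinMatroid.rank
  refine Finset.sup_le fun I hI => ?_
  obtain ⟨h1, h2⟩ := Finset.mem_filter.1 hI
  exact h I (Finset.mem_powerset.1 h1) h2

theorem extend_basis (M : FinMatroid E) {I A : Finset E} (hI : M.Indep I) (h : I ⊆ A) :
    ∃ J ⊆ A, I ⊆ J ∧ M.Indep J ∧ J.card = M.rank A := by
  classical
  obtain ⟨J, hJ, hmax⟩ := Finset.exists_max_image (A.powerset.filter fun J => I ⊆ J ∧ M.Indep J)
    Finset.card ⟨I, Finset.mem_filter.2 ⟨Finset.mem_powerset.2 h, le_rfl, hI⟩⟩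
  obtain ⟨h1, h2, h3⟩ := Finset.mem_filter.1 hJ
  rw [Finset.mem_powerset] at h1
  refine ⟨J, h1, h2, h3, le_antisymm (card_le_rank M h3 h1) (rank_le M fun K hK hK' => ?_)⟩
  by_contra hlt
  push Not at hlt
  obtain ⟨e, he, he', hi⟩ := M.indep_exchange h3 hK' hlt
  have := hmax (insert e J) (Finset.mem_filter.2 ⟨Finset.mem_powerset.2
    (Finset.insert_subset (hK he) h1), h2.trans (Finset.subset_insert _ _), hi⟩)
  rw [Finset.card_insert_of_notMem he'] at this
  omega

theorem rank_mono (M : FinMatroid E) {A B : Finset E} (h : A ⊆ B) : M.rank A ≤ M.rank B :=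
  rank_le M fun _ hI hI' => card_le_rank M hI' (hI.trans h)

theorem rank_empty (M : FinMatroid E) : M.rank ∅ = 0 :=
  Nat.le_zero.1 (rank_le M fun I hI _ => by rw [Finset.subset_empty.1 hI]; simp)

theorem rank_insert (M : FinMatroid E) (a : E) (S : Finset E) : M.rank (insert a S) ≤ M.rank S + 1 := by
  refine rank_le M fun I hI hI' => ?_
  have h1 := card_le_rank M (A := S) (M.indep_subset hI' (Finset.erase_subset a I))
    (Finset.erase_subset_iff_of_mem (Finset.mem_insert_self a S) |>.2 hI |> fun _ => by
      intro b hb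
      obtain ⟨hne, hb⟩ := Finset.mem_erase.1 hb
      exact (Finset.mem_insert.1 (hI hb)).resolve_left hne)
  have h2 := Finset.pred_card_le_card_erase (s := I) (a := a)
  omega

theorem rank_submod (M : FinMatroid E) (A B : Finset E) :
    M.rank (A ∪ B) + M.rank (A ∩ B) ≤ M.rank A + M.rank B := by
  obtain ⟨I, hI, -, hI', hIc⟩ := extend_basis M M.indep_empty (Finset.empty_subset (A ∩ B))
  obtain ⟨J, hJ, hIJ, hJ', hJc⟩ := extend_basis M hI'
    (hI.trans (Finset.inter_subset_left.trans Finset.subset_union_left) : I ⊆ A ∪ B)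
  have h1 := card_le_rank M (A := A) (M.indep_subset hJ' (Finset.inter_subset_left : J ∩ A ⊆ J))
    Finset.inter_subset_right
  have h2 := card_le_rank M (A := B) (M.indep_subset hJ' (Finset.inter_subset_left : J ∩ B ⊆ J))
    Finset.inter_subset_right
  have h3 := Finset.card_union_add_card_inter (J ∩ A) (J ∩ B)
  rw [← Finset.inter_union_distrib_left, Finset.inter_eq_left.2 hJ, ← Finset.inter_inter_distrib_left] at h3
  have h4 := Finset.card_le_card (Finset.subset_inter hIJ hI)
  omega

/-- rank function of a loopless matroid -/
noncomputable def toRk (M : FinMatroid E) (hM : M.Loopless) : RkFn E where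
  r := M.rank
  r_empty := rank_empty M
  r_insert := rank_insert M
  mono _ _ h := rank_mono M h
  submod := rank_submod M
  loopless a := by
    have h1 : a ∉ M.closure ∅ := by rw [show M.closure ∅ = ∅ from hM]; simp
    have h2 : M.rank {a} ≠ M.rank ∅ := fun e => h1 (by
      unfold FinMatroid.closure
      exact Finset.mem_filter.2 ⟨Finset.mem_univ _, e⟩)
    have h3 := rank_insert M a ∅
    rw [rank_empty] at h2 h3
    change M.rank {a} ≤ 0 + 1 at h3
    omega

variable {M : FinMatroid E} {hM : M.Loopless}

theorem flat_iff (F : Finset E) : (toRk M hM).Flat Finset.univ F ↔ M.IsFlat F := by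
  unfold FinMatroid.IsFlat
  constructor
  · intro h
    ext a
    unfold FinMatroid.closure
    rw [Finset.mem_filter]
    constructor
    · rintro ⟨-, e⟩
      by_contra ha
      have := h.2 a (Finset.mem_univ _) ha
      exact this.ne e.symm
    · intro ha
      exact ⟨Finset.mem_univ _, by rw [Finset.insert_eq_of_mem ha]⟩
  · intro h
    refine ⟨Finset.subset_univ _, fun a _ ha => lt_of_le_of_ne (rank_mono M (Finset.subset_insert _ _))
      fun e => ha ?_⟩
    rw [← h]
    unfold FinMatroid.closure
    exact Finset.mem_filter.2 ⟨Finset.mem_univ _, e.symm⟩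

theorem sum_flats {B : Type*} [AddCommMonoid B] (g : Finset E → B)
    (h : ∀ F, F ≠ Finset.univ → ¬ (M.IsFlat F ∧ F ≠ ∅ ∧ F ≠ Finset.univ) → g F = 0) :
    ∑ F, g F = g Finset.univ + ∑ P : ProperFlat M, g P.1 := by
  classical
  have hinj : Function.Injective (fun P : ProperFlat M => P.1) := Subtype.val_injective
  have h1 : ∑ P : ProperFlat M, g P.1 = ∑ F ∈ Finset.univ.image (fun P : ProperFlat M => P.1), g F :=
    (Finset.sum_image (fun _ _ _ _ e => hinj e)).symm
  have h2 : (Finset.univ : Finset E) ∉ Finset.univ.image (fun P : ProperFlat M => P.1) := by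
    rw [Finset.mem_image]
    rintro ⟨P, -, e⟩
    exact P.2.2.2 e
  rw [h1, ← Finset.sum_insert h2]
  symm
  refine Finset.sum_subset (Finset.subset_univ _) fun F _ hF => h F ?_ ?_
  · rintro rfl; exact hF (Finset.mem_insert_self _ _)
  · intro hp
    exact hF (Finset.mem_insert_of_mem (Finset.mem_image.2 ⟨⟨F, hp⟩, Finset.mem_univ _, rfl⟩))

theorem cx_zero {F : Finset E} (h1 : F ≠ Finset.univ)
    (h : ¬ (M.IsFlat F ∧ F ≠ ∅ ∧ F ≠ Finset.univ)) : cx (toRk M hM) Finset.univ F = 0 :=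
  (chowRel_cx _ _).zero F fun hf => h ⟨(flat_iff F).1 hf.1, hf.2.ne_empty, h1⟩

theorem cx_lin (a : E) : (∑ P : ProperFlat M, if a ∈ P.1 then cx (toRk M hM) Finset.univ P.1 else 0) =
    - cx (toRk M hM) Finset.univ Finset.univ := by
  have h := (chowRel_cx (toRk M hM) Finset.univ).lin a (Finset.mem_univ _)
  rw [Finset.sum_filter, sum_flats (M := M) _ (fun F h1 h2 => by rw [cx_zero h1 h2]; simp),
    if_pos (Finset.mem_univ a)] at h
  exact eq_neg_of_add_eq_zero_right h

noncomputable def phi (M : FinMatroid E) (hM : M.Loopless) :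
    ChowRing ℝ M →ₐ[ℝ] Chow (toRk M hM) Finset.univ :=
  Ideal.Quotient.liftₐ (chowIdeal ℝ M)
    (MvPolynomial.aeval fun P : ProperFlat M => cx (toRk M hM) Finset.univ P.1) (by
    intro p hp
    suffices chowIdeal ℝ M ≤ RingHom.ker (MvPolynomial.aeval (R := ℝ)
      fun P : ProperFlat M => cx (toRk M hM) Finset.univ P.1) from RingHom.mem_ker.1 (this hp)
    rw [chowIdeal, Ideal.span_le]
    rintro p (⟨ab, rfl⟩ | ⟨F, F', h1, h2, rfl⟩)
    · rw [SetLike.mem_coe, RingHom.mem_ker]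
      simp only [map_sub, map_sum, apply_ite (MvPolynomial.aeval (R := ℝ)
        fun P : ProperFlat M => cx (toRk M hM) Finset.univ P.1), MvPolynomial.aeval_X, map_zero]
      rw [cx_lin, cx_lin, sub_self]
    · rw [SetLike.mem_coe, RingHom.mem_ker, map_mul, MvPolynomial.aeval_X, MvPolynomial.aeval_X]
      exact (chowRel_cx _ _).mul _ _ h1 h2)

theorem phi_mk (p : MvPolynomial (ProperFlat M) ℝ) : phi M hM (chowMk ℝ M p) =
    MvPolynomial.aeval (fun P : ProperFlat M => cx (toRk M hM) Finset.univ P.1) p := rfl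

open Classical in
/-- images of the generators -/
noncomputable def yy (M : FinMatroid E) (a₀ : E) (F : Finset E) : ChowRing ℝ M :=
  if h : M.IsFlat F ∧ F ≠ ∅ ∧ F ≠ Finset.univ then chowMk ℝ M (MvPolynomial.X ⟨F, h⟩)
  else if F = Finset.univ then
    - ∑ P : ProperFlat M, if a₀ ∈ P.1 then chowMk ℝ M (MvPolynomial.X P) else 0
  else 0

theorem yy_proper (a₀ : E) (P : ProperFlat M) : yy M a₀ P.1 = chowMk ℝ M (MvPolynomial.X P) := by
  rw [yy, dif_pos P.2]; rfl

theorem yy_univ (a₀ : E) : yy M a₀ Finset.univ =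
    - ∑ P : ProperFlat M, if a₀ ∈ P.1 then chowMk ℝ M (MvPolynomial.X P) else 0 := by
  rw [yy, dif_neg (fun h => h.2.2 rfl), if_pos rfl]

theorem yy_zero (a₀ : E) {F : Finset E} (h1 : F ≠ Finset.univ)
    (h : ¬ (M.IsFlat F ∧ F ≠ ∅ ∧ F ≠ Finset.univ)) : yy M a₀ F = 0 := by
  rw [yy, dif_neg h, if_neg h1]

theorem mk_zero {p : MvPolynomial (ProperFlat M) ℝ} (h : p ∈ chowIdeal ℝ M) : chowMk ℝ M p = 0 :=
  Ideal.Quotient.eq_zero_iff_mem.2 h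

theorem yy_rel (a₀ : E) : ChowRel (toRk M hM) Finset.univ (yy M a₀) where
  zero F h := by
    refine yy_zero a₀ ?_ fun h' => h ⟨(flat_iff F).2 h'.1, Finset.nonempty_iff_ne_empty.2 h'.2.1⟩
    rintro rfl
    exact h ⟨RkFn.flat_self, ⟨a₀, Finset.mem_univ _⟩⟩
  mul F G h1 h2 := by
    have hF : F ≠ Finset.univ := by rintro rfl; exact h2 (Finset.subset_univ _)
    have hG : G ≠ Finset.univ := by rintro rfl; exact h1 (Finset.subset_univ _)
    by_cases kF : M.IsFlat F ∧ F ≠ ∅ ∧ F ≠ Finset.univ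
    swap
    · rw [yy_zero a₀ hF kF, zero_mul]
    by_cases kG : M.IsFlat G ∧ G ≠ ∅ ∧ G ≠ Finset.univ
    swap
    · rw [yy_zero a₀ hG kG, mul_zero]
    rw [yy_proper a₀ ⟨F, kF⟩, yy_proper a₀ ⟨G, kG⟩, ← map_mul]
    exact mk_zero (Ideal.subset_span (Or.inr ⟨⟨F, kF⟩, ⟨G, kG⟩, h1, h2, rfl⟩))
  lin a _ := by
    rw [Finset.sum_filter, sum_flats (M := M) _ (fun F h1 h2 => by rw [yy_zero a₀ h1 h2]; simp),
      if_pos (Finset.mem_univ a), yy_univ]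
    simp only [yy_proper]
    have := mk_zero (M := M) (Ideal.subset_span (Or.inl ⟨(a, a₀), rfl⟩))
    simp only [map_sub, map_sum, apply_ite (chowMk ℝ M), map_zero] at this
    rw [neg_add_eq_sub, this]

theorem phi_inj (a₀ : E) : Function.Injective (phi M hM) := by
  have key : ((Chow.lift (yy_rel (hM := hM) a₀)).comp (phi M hM)).comp (chowMk ℝ M) = chowMk ℝ M := by
    refine MvPolynomial.algHom_ext fun P => ?_
    change Chow.lift (yy_rel (hM := hM) a₀) (phi M hM (chowMk ℝ M (MvPolynomial.X P))) = _
    rw [phi_mk, MvPolynomial.aeval_X, Chow.lift_cx, yy_proper]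
  have hl : Function.LeftInverse (Chow.lift (yy_rel (hM := hM) a₀)) (phi M hM) := by
    intro u
    obtain ⟨p, rfl⟩ := Ideal.Quotient.mkₐ_surjective ℝ (chowIdeal ℝ M) u
    exact DFunLike.congr_fun key p
  exact hl.injective

theorem phi_piece (a₀ : E) (k : ℕ) :
    (piece ℝ M k).map (phi M hM).toLinearMap = CV (toRk M hM) Finset.univ ^ k := by
  rw [piece, ← Submodule.map_comp]
  change (MvPolynomial.homogeneousSubmodule (ProperFlat M) ℝ k).map
    ((phi M hM).comp (chowMk ℝ M)).toLinearMap = _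
  rw [← MvPolynomial.homogeneousSubmodule_one_pow, Submodule.map_pow,
    MvPolynomial.homogeneousSubmodule_one_eq_span_X, Submodule.map_span, ← Set.range_comp]
  congr 1
  have e : ((((phi M hM).comp (chowMk ℝ M)).toLinearMap : MvPolynomial (ProperFlat M) ℝ → _) ∘
      MvPolynomial.X) = fun P : ProperFlat M => cx (toRk M hM) Finset.univ P.1 := by
    funext P
    change phi M hM (chowMk ℝ M (MvPolynomial.X P)) = _
    rw [phi_mk, MvPolynomial.aeval_X]
  rw [e]
  refine le_antisymm (Submodule.span_mono ?_) (Submodule.span_le.2 ?_)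
  · rintro _ ⟨P, rfl⟩; exact ⟨P.1, rfl⟩
  · rintro _ ⟨F, rfl⟩
    by_cases hF : F = Finset.univ
    · subst hF
      have := cx_lin (M := M) (hM := hM) a₀
      rw [eq_neg_iff_add_eq_zero, add_comm, ← eq_neg_iff_add_eq_zero] at this
      rw [this]
      refine Submodule.neg_mem _ (Submodule.sum_mem _ fun P _ => ?_)
      split_ifs
      · exact Submodule.subset_span ⟨P, rfl⟩
      · exact Submodule.zero_mem _
    · by_cases h : M.IsFlat F ∧ F ≠ ∅ ∧ F ≠ Finset.univ
      · exact Submodule.subset_span ⟨⟨F, h⟩, rfl⟩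
      · rw [cx_zero hF h]; exact Submodule.zero_mem _

theorem phi_ell {c : Finset E → ℝ} (hc : c Finset.univ = 0) :
    phi M hM (chowMk ℝ M (∑ F : ProperFlat M, MvPolynomial.C (c F.1) * MvPolynomial.X F)) =
      ell (cx (toRk M hM) Finset.univ) c := by
  rw [phi_mk, ell, sum_flats (M := M) _ (fun F h1 h2 => by rw [cx_zero h1 h2, smul_zero]), hc, zero_smul,
    zero_add, map_sum]
  refine Finset.sum_congr rfl fun P _ => ?_
  rw [map_mul, MvPolynomial.aeval_X, MvPolynomial.aeval_C, Algebra.smul_def]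

theorem final (M : FinMatroid E) (hM : M.Loopless) (d : ℕ) (hrk : M.rk = d + 1)
    (l : ChowRing ℝ M) (hl : M.Ample l) (k : ℕ) (hk : 2 * k ≤ d) :
    ∃ L : (piece ℝ M k) →ₗ[ℝ] (piece ℝ M (d - k)),
      (∀ a : piece ℝ M k, (L a : ChowRing ℝ M) = l ^ (d - 2 * k) * (a : ChowRing ℝ M)) ∧
      Function.Bijective L := by
  have hd : (toRk M hM).r Finset.univ = d + 1 := hrk
  obtain ⟨a₀, -⟩ : (Finset.univ : Finset E).Nonempty := by
    by_contra h
    rw [Finset.not_nonempty_iff_eq_empty] at h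
    rw [h, (toRk M hM).r_empty] at hd
    omega
  have hl1 := hl.mem_piece_one
  obtain ⟨c, hc, hlc⟩ := hl
  have hphil : phi M hM l = ell (cx (toRk M hM) Finset.univ) c := by rw [hlc, phi_ell hc.2.2.1]
  have hAm : Am ∅ (Finset.univ : Finset E) c :=
    ⟨hc.2.1, fun A _ B _ h1 h2 _ => hc.2.2.2 A B h1 h2⟩
  have hmem : ∀ n, ∀ a ∈ piece ℝ M n, phi M hM a ∈ CV (toRk M hM) Finset.univ ^ n := by
    intro n a ha
    rw [← phi_piece a₀]
    exact ⟨a, ha, rfl⟩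
  let L : (piece ℝ M k) →ₗ[ℝ] (piece ℝ M (d - k)) :=
    (LinearMap.mulLeft ℝ (l ^ (d - 2 * k))).restrict (by
      intro a ha
      have := mul_mem_piece ℝ (pow_mem_piece ℝ hl1 (d - 2 * k)) ha
      rwa [show d - 2 * k + k = d - k by omega] at this)
  refine ⟨L, fun a => rfl, ?_, ?_⟩
  · rw [← LinearMap.ker_eq_bot, LinearMap.ker_eq_bot']
    intro u hu
    refine Subtype.ext (phi_inj (hM := hM) a₀ ?_)
    have h1 : l ^ (d - 2 * k) * (u : ChowRing ℝ M) = 0 := congrArg Subtype.val hu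
    have h2 : phi M hM (u : ChowRing ℝ M) = 0 := by
      refine HL_inj hd hk hAm (hmem k _ u.2) ?_
      rw [← hphil, ← map_pow, ← map_mul, h1, map_zero]
    rw [h2]
    exact (map_zero (phi M hM)).symm
  · rintro ⟨b, hb⟩
    obtain ⟨a, ha, e⟩ := HL_surj hd hk hAm (hmem _ b hb)
    rw [← phi_piece a₀] at ha
    obtain ⟨a', ha', rfl⟩ := ha
    refine ⟨⟨a', ha'⟩, Subtype.ext (phi_inj (hM := hM) a₀ ?_)⟩
    change phi M hM (l ^ (d - 2 * k) * a') = phi M hM b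
    rw [map_mul, map_pow, hphil]
    exact e

end
end AHK

set_option synthInstance.maxHeartbeats 1000000 in
set_option maxHeartbeats 1000000 in
open FinMatroid in
/-- **Adiprasito–Huh–Katz, Hard Lefschetz theorem.** Let `M` be a loopless matroid of rank
`d+1`, let `l ∈ A¹(M)_ℝ` be an ample class, and let `0 ≤ k ≤ d/2`. Then multiplication by
`l^{d-2k}` determines an isomorphism of real vector spaces `A^k(M)_ℝ → A^{d-k}(M)_ℝ`. -/
theorem chow_hard_lefschetz {E : Type*} [Fintype E] [DecidableEq E]
    (M : FinMatroid E) (hM : M.Loopless) (d : ℕ) (hrk : M.rk = d + 1)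
    (l : ChowRing ℝ M) (hl : M.Ample l) (k : ℕ) (hk : 2 * k ≤ d) :
    ∃ L : (piece ℝ M k) →ₗ[ℝ] (piece ℝ M (d - k)),
      (∀ a : piece ℝ M k, (L a : ChowRing ℝ M) = l ^ (d - 2 * k) * (a : ChowRing ℝ M)) ∧
      Function.Bijective L := by
  exact AHK.final M hM d hrk l hl k hk
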